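/- Let p ≡ 1 (mod 4) and d ≡ 1 (mod 4) be two primes with (p/d) = -1 or [(p/d) = 1 and (p/d)₄ ≠ (d/p)₄]. Let K₁ = Q(√p, √d, √2), k = Q(√(2pd)), and k₁ = Q(√(pd), √2). Then the 2-class number of K₁ is odd if and only if h₂(2pd) = 4 and q(k₁) = 1, where q(k₁) = [E_{k₁} : E_{Q(√2)}·E_{Q(√(pd))}·E_{Q(√(2pd))}] is the unit index. -/

import Mathlib

open NumberField

/-- The subfield of ℝ generated over ℚ by a set of real numbers. -/
noncomputable def Qadj (S : Set ℝ) : IntermediateField ℚ ℝ := IntermediateField.adjoin ℚ S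

/-- The 2-part of the class number of a subfield of ℝ. -/
noncomputable def h2pow (K : IntermediateField ℚ ℝ) : ℕ :=
  2 ^ ((Nat.card (ClassGroup (𝓞 K))).factorization 2)

/-- The rational quartic residue symbol (a/n)₄, defined (for (a/n) = 1) as ±1 according to
whether a^((n-1)/4) ≡ 1 (mod n) or not. -/
noncomputable def quarticSym (n a : ℕ) : ℤ :=
  if ((a : ZMod n)) ^ ((n - 1) / 4) = 1 then 1 else -1

/-- The subgroup of the units of 𝓞_K generated by the units lying in the subfields
belonging to `Fs` (e.g. the product E_{F₁}···E_{Fₙ} of the unit groups of subfields). -/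
noncomputable def subfieldUnits (K : IntermediateField ℚ ℝ)
    (Fs : Set (IntermediateField ℚ ℝ)) : Subgroup (𝓞 K)ˣ :=
  Subgroup.closure {u : (𝓞 K)ˣ | ∃ F ∈ Fs, ((algebraMap (𝓞 K) K (u : 𝓞 K) : K) : ℝ) ∈ F}

section
namespace Q2

section grp
variable {M I : Type*} [CommGroup M] [CommGroup I]

lemma relIndex_map_ker {G G' : Type*} [CommGroup G] [CommGroup G'] (φ : G →* G')
    (B A : Subgroup G) (hBA : B ≤ A) (hk : ∀ x ∈ A, φ x = 1 → x ∈ B) :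
    (B.map φ).relIndex (A.map φ) = B.relIndex A := by
  rw [← Subgroup.relIndex_comap, ← Subgroup.inf_relIndex_right]
  congr 1
  ext x
  constructor
  · rintro ⟨⟨b, hb, hbx⟩, hx⟩
    have : b⁻¹ * x ∈ B := hk _ (A.mul_mem (A.inv_mem (hBA hb)) hx) (by
      rw [map_mul, map_inv, hbx]; simp)
    simpa using B.mul_mem hb this
  · intro hx
    exact ⟨⟨x, hx, rfl⟩, hBA hx⟩

/-- fixed subgroup -/
def Fx (s : M →* M) : Subgroup M := MonoidHom.eqLocus s (MonoidHom.id M)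
/-- x / s x -/
def Dh (s : M →* M) : M →* M := MonoidHom.id M / s
/-- x * s x -/
def Nh (s : M →* M) : M →* M := MonoidHom.id M * s

@[simp] lemma mem_Fx (s : M →* M) (x : M) : x ∈ Fx s ↔ s x = x := Iff.rfl
@[simp] lemma Dh_apply (s : M →* M) (x : M) : Dh s x = x / s x := rfl
@[simp] lemma Nh_apply (s : M →* M) (x : M) : Nh s x = x * s x := rfl

/-- square map -/
def sqh (M : Type*) [CommGroup M] : M →* M := powMonoidHom 2
@[simp] lemma sqh_apply (x : M) : sqh M x = x ^ 2 := rfl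

/-- minus part -/
def Em (U : Subgroup M) (s : M →* M) : Subgroup M := U ⊓ (Nh s).ker

lemma mem_Em {U : Subgroup M} {s : M →* M} {x : M} : x ∈ Em U s ↔ x ∈ U ∧ x * s x = 1 := Iff.rfl

theorem herbrand (U : Subgroup M) (s : M →* M) (hs : ∀ x, s (s x) = x) (hU : ∀ x ∈ U, s x ∈ U)
    (e : M) (heU : e ∈ U) (hse : s e = e) (he2 : e * e = 1)
    (htor : ∀ u ∈ U, u * u = 1 → u = 1 ∨ u = e) (hnsq : ∀ u ∈ U, u ^ 2 ≠ e) (c : ℕ) (hc : c ≠ 0)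
    (h1 : (U.map (sqh M)).relIndex U = c * c)
    (h0 : ((U ⊓ Fx s).map (sqh M)).relIndex (U ⊓ Fx s) = c) :
    (U.map (Dh s)).relIndex (Em U s) = 2 * (U.map (Nh s)).relIndex (U ⊓ Fx s) ∧
    (U.map (Nh s)).relIndex (U ⊓ Fx s) ≠ 0 := by
  set E0 := U ⊓ Fx s with hE0
  set E1 := Em U s with hE1
  set B := E1 ⊔ E0 with hB
  have hE0U : E0 ≤ U := inf_le_left
  have hE1U : E1 ≤ U := inf_le_left
  have hBU : B ≤ U := sup_le hE1U hE0U
  have he1 : e ∈ E1 := mem_Em.2 ⟨heU, by rw [hse, he2]⟩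
  have he0 : e ∈ E0 := ⟨heU, hse⟩
  have hDU : U.map (Dh s) ≤ E1 := by
    rintro _ ⟨x, hx, rfl⟩
    refine mem_Em.2 ⟨U.div_mem hx (hU x hx), ?_⟩
    simp [hs]
  have hNU : U.map (Nh s) ≤ E0 := by
    rintro _ ⟨x, hx, rfl⟩
    refine ⟨U.mul_mem hx (hU x hx), ?_⟩
    simp [hs, mul_comm]
  have hDB : B.map (Dh s) = E1.map (sqh M) := by
    apply le_antisymm
    · rintro _ ⟨x, hx, rfl⟩
      obtain ⟨a, ha, b, hb, rfl⟩ := Subgroup.mem_sup.1 hx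
      refine ⟨a, ha, ?_⟩
      have h2 := (mem_Em.1 ha).2
      have h3 : s b = b := hb.2
      have h4 : s a = a⁻¹ := eq_inv_of_mul_eq_one_right h2
      simp [h3, h4, pow_two, div_eq_mul_inv, mul_comm, mul_left_comm]
    · rintro _ ⟨x, hx, rfl⟩
      refine ⟨x, Subgroup.mem_sup_left hx, ?_⟩
      have h4 : s x = x⁻¹ := eq_inv_of_mul_eq_one_right (mem_Em.1 hx).2
      simp [h4, pow_two]
  have hNB : B.map (Nh s) = E0.map (sqh M) := by
    apply le_antisymm
    · rintro _ ⟨x, hx, rfl⟩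
      obtain ⟨a, ha, b, hb, rfl⟩ := Subgroup.mem_sup.1 hx
      refine ⟨b, hb, ?_⟩
      have h3 : s b = b := hb.2
      have h4 : s a = a⁻¹ := eq_inv_of_mul_eq_one_right (mem_Em.1 ha).2
      simp only [sqh_apply, pow_two, Nh_apply, map_mul, h3, h4]
      rw [mul_inv_cancel, one_mul]
    · rintro _ ⟨x, hx, rfl⟩
      refine ⟨x, Subgroup.mem_sup_right hx, ?_⟩
      have h3 : s x = x := hx.2
      simp [h3, pow_two]
  have hUB1 : (B.map (Dh s)).relIndex (U.map (Dh s)) = B.relIndex U :=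
    relIndex_map_ker _ _ _ hBU fun x hx h => Subgroup.mem_sup_right ⟨hx, by
      have : x / s x = 1 := h
      exact (div_eq_one.1 this).symm⟩
  have hUB0 : (B.map (Nh s)).relIndex (U.map (Nh s)) = B.relIndex U :=
    relIndex_map_ker _ _ _ hBU fun x hx h => Subgroup.mem_sup_left (mem_Em.2 ⟨hx, h⟩)
  have hsqB : U.map (sqh M) ≤ B := by
    rintro _ ⟨x, hx, rfl⟩
    have : sqh M x = Dh s x * Nh s x := by simp [pow_two, div_mul_mul_cancel]
    rw [this]
    exact Subgroup.mul_mem_sup (hDU ⟨x, hx, rfl⟩) (hNU ⟨x, hx, rfl⟩)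
  have hUB : B.relIndex U ≠ 0 := by
    intro h
    have := Subgroup.relIndex_eq_zero_of_le_left hsqB h
    rw [h1] at this
    exact hc (by simpa using this)
  have hsq : (B.map (sqh M)).relIndex (U.map (sqh M)) = B.relIndex U :=
    relIndex_map_ker _ _ _ hBU fun x hx h => by
      rcases htor x hx (by simpa [pow_two] using h) with rfl | rfl
      · exact B.one_mem
      · exact Subgroup.mem_sup_left he1
  have hBB : (B.map (sqh M)).relIndex B = c * c := by
    have a1 := Subgroup.relIndex_mul_relIndex (B.map (sqh M)) B U
      (by rw [Subgroup.map_le_iff_le_comap]; intro x hx; exact B.pow_mem hx 2) hBU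
    have a2 := Subgroup.relIndex_mul_relIndex (B.map (sqh M)) (U.map (sqh M)) U
      (Subgroup.map_mono hBU) (hsqB.trans hBU)
    rw [hsq, h1] at a2
    rw [← a2, mul_comm] at a1
    exact Nat.eq_of_mul_eq_mul_left (Nat.pos_of_ne_zero hUB) a1
  -- second count
  set S0 := E0.map (sqh M) with hS0
  set S1 := E1.map (sqh M) with hS1
  have hS0E : S0 ≤ E0 := by rintro _ ⟨x, hx, rfl⟩; exact E0.pow_mem hx 2
  have hS1E : S1 ≤ E1 := by rintro _ ⟨x, hx, rfl⟩; exact E1.pow_mem hx 2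
  have hBs : B.map (sqh M) = S1 ⊔ S0 := Subgroup.map_sup _ _ _
  have hInt : ∀ x, x ∈ E1 → x ∈ E0 → x = 1 ∨ x = e := fun x h h' => by
    refine htor x h.1 ?_
    have h4 := (mem_Em.1 h).2
    rwa [show s x = x from h'.2] at h4
  have c1 : (S1 ⊔ S0).relIndex (E1 ⊔ S0) = S1.relIndex E1 := by
    have : E1 ⊔ S0 = E1 ⊔ (S1 ⊔ S0) := by
      rw [← sup_assoc, sup_eq_left.2 hS1E]
    rw [this, Subgroup.relIndex_sup_right, ← Subgroup.inf_relIndex_right]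
    congr 1
    apply le_antisymm
    · rintro x ⟨hx, hx1⟩
      obtain ⟨a, ha, b, hb, rfl⟩ := Subgroup.mem_sup.1 hx
      have hb1 : b ∈ E1 := by
        have := E1.mul_mem (E1.inv_mem (hS1E ha)) hx1
        simpa using this
      rcases hInt b hb1 (hS0E hb) with rfl | rfl
      · simpa using ha
      · obtain ⟨v, hv, hv2⟩ := hb
        exact absurd hv2 (hnsq v hv.1)
    · exact le_inf le_sup_left hS1E
  have c2 : (E1 ⊔ S0).relIndex (E1 ⊔ E0) * 2 = S0.relIndex E0 := by
    have : E1 ⊔ E0 = E0 ⊔ (E1 ⊔ S0) := by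
      apply le_antisymm
      · exact sup_le (le_sup_of_le_right le_sup_left) le_sup_left
      · exact sup_le le_sup_right (sup_le le_sup_left (hS0E.trans le_sup_right))
    rw [this, Subgroup.relIndex_sup_right, ← Subgroup.inf_relIndex_right]
    rw [← Subgroup.relIndex_mul_relIndex S0 ((E1 ⊔ S0) ⊓ E0) E0 (le_inf le_sup_right hS0E) inf_le_right,
      mul_comm]
    congr 1
    symm
    rw [Subgroup.relIndex_eq_two_iff_exists_notMem_and]
    refine ⟨e, ⟨Subgroup.mem_sup_left he1, he0⟩, ?_, ?_⟩
    · rintro ⟨v, hv, hv2⟩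
      exact hnsq v hv.1 hv2
    · rintro x ⟨hx, hx0⟩
      obtain ⟨a, ha, b, hb, rfl⟩ := Subgroup.mem_sup.1 hx
      have ha0 : a ∈ E0 := by
        have := E0.mul_mem hx0 (E0.inv_mem (hS0E hb))
        simpa using this
      rcases hInt a ha ha0 with rfl | rfl
      · right; simpa using hb
      · left; rw [mul_comm, ← mul_assoc, he2, one_mul]; exact hb
  have c3 := Subgroup.relIndex_mul_relIndex (S1 ⊔ S0) (E1 ⊔ S0) (E1 ⊔ E0)
    (sup_le_sup_right hS1E _) (sup_le_sup_left hS0E _)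
  rw [← hBs, hBB, hBs, c1] at c3
  have c4 : S1.relIndex E1 = 2 * c := by
    rw [h0] at c2
    have : S1.relIndex E1 * c = (2 * c) * c := by
      rw [← c2, ← mul_assoc, mul_comm _ 2]
      calc _ = 2 * (S1.relIndex E1 * (E1 ⊔ S0).relIndex (E1 ⊔ E0)) := by ring
        _ = 2 * (c * c) := by rw [c3]
        _ = _ := by rw [← c2]; ring
    exact Nat.eq_of_mul_eq_mul_right (Nat.pos_of_ne_zero hc) this
  have d1 := Subgroup.relIndex_mul_relIndex (B.map (Dh s)) (U.map (Dh s)) E1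
    (Subgroup.map_mono hBU) hDU
  have d0 := Subgroup.relIndex_mul_relIndex (B.map (Nh s)) (U.map (Nh s)) E0
    (Subgroup.map_mono hBU) hNU
  rw [hUB1, hDB, c4] at d1
  rw [hUB0, hNB, h0] at d0
  refine ⟨Nat.eq_of_mul_eq_mul_left (Nat.pos_of_ne_zero hUB) ?_, ?_⟩
  · rw [d1, ← d0]; ring
  · intro h
    rw [h, mul_zero] at d0
    exact hc d0.symm

variable (dv : M →* I) (s : M →* M) (t : I →* I)

theorem T2 (hs : ∀ x, s (s x) = x) (hst : ∀ x, t (dv x) = dv (s x))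
    (h90 : ∀ x, x * s x = 1 → ∃ a, x = a / s a) :
    (dv.ker.map (Dh s)).relIndex (Em dv.ker s) = ((Fx s).map dv).relIndex (dv.range ⊓ Fx t) := by
  set X := dv.ker.comap (Dh s) with hX
  have hXm : ∀ x, x ∈ X ↔ t (dv x) = dv x := fun x => by
    rw [hX, Subgroup.mem_comap, MonoidHom.mem_ker, Dh_apply, map_div, div_eq_one, hst, eq_comm]
  have e1 : X.map (Dh s) = Em dv.ker s := by
    apply le_antisymm
    · rintro _ ⟨x, hx, rfl⟩
      exact mem_Em.2 ⟨hx, by simp [hs]⟩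
    · intro x hx
      obtain ⟨a, rfl⟩ := h90 x (mem_Em.1 hx).2
      exact ⟨a, hx.1, rfl⟩
  have e2 : X.map dv = dv.range ⊓ Fx t := by
    apply le_antisymm
    · rintro _ ⟨x, hx, rfl⟩
      exact ⟨⟨x, rfl⟩, (hXm x).1 hx⟩
    · rintro _ ⟨⟨x, rfl⟩, hx⟩
      exact ⟨x, (hXm x).2 hx, rfl⟩
  have hkX : dv.ker ≤ X := fun x hx => (hXm x).2 (by
    have : dv x = 1 := hx
    rw [this, map_one])
  have hFX : Fx s ≤ X := fun x hx => (hXm x).2 (by rw [hst, show s x = x from hx])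
  have e3 : (Fx s ⊔ dv.ker).map (Dh s) = dv.ker.map (Dh s) := by
    rw [Subgroup.map_sup, sup_eq_right]
    rintro _ ⟨x, hx, rfl⟩
    rw [Dh_apply, show s x = x from hx, div_self']
    exact Subgroup.one_mem _
  have e4 : (Fx s ⊔ dv.ker).map dv = (Fx s).map dv := by
    rw [Subgroup.map_sup, sup_eq_left]
    rintro _ ⟨x, hx, rfl⟩
    rw [show dv x = 1 from hx]
    exact Subgroup.one_mem _
  rw [← e1, ← e2, ← e3, ← e4,
    relIndex_map_ker _ _ _ (sup_le hFX hkX) fun x hx h => Subgroup.mem_sup_left (by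
      rw [Dh_apply, div_eq_one] at h; exact h.symm),
    relIndex_map_ker _ _ _ (sup_le hFX hkX) fun x hx h => Subgroup.mem_sup_right h]

/-- norms of elements whose divisor is a / t a -/
def Wn : Subgroup M := ((Dh t).range.comap dv).map (Nh s)

theorem chev (hs : ∀ x, s (s x) = x) (ht : ∀ x, t (t x) = x) (hst : ∀ x, t (dv x) = dv (s x))
    (h90 : ∀ x, x * s x = 1 → ∃ a, x = a / s a) (J : Subgroup I) (hJ : J ≤ Fx t)
    (hPJ : (Fx s).map dv ≤ J)
    (hh : (dv.ker.map (Dh s)).relIndex (Em dv.ker s)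
        = 2 * (dv.ker.map (Nh s)).relIndex (dv.ker ⊓ Fx s))
    (hh0 : (dv.ker.map (Nh s)).relIndex (dv.ker ⊓ Fx s) ≠ 0) :
    dv.range.relIndex (dv.range.comap (Dh t)) * (2 * (Wn dv s t).relIndex (dv.ker ⊓ Fx s))
      = J.relIndex (Fx t) * ((Fx s).map dv).relIndex J := by
  set P := dv.range with hP
  set Y := P.comap (Dh t) with hY
  have hPt : ∀ x ∈ P, t x ∈ P := by
    rintro _ ⟨x, rfl⟩
    exact ⟨s x, (hst x).symm⟩
  have hPY : P ≤ Y := fun x hx => P.div_mem hx (hPt x hx)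
  have hFY : Fx t ≤ Y := fun x hx => by
    rw [hY, Subgroup.mem_comap, Dh_apply, show t x = x from hx, div_self']
    exact P.one_mem
  have hWE : Wn dv s t ≤ dv.ker ⊓ Fx s := by
    rintro _ ⟨x, ⟨a, ha⟩, rfl⟩
    refine ⟨?_, by simp [hs, mul_comm]⟩
    show dv (Nh s x) = 1
    rw [Nh_apply, map_mul, ← hst, ← ha]
    simp [ht]
  have hNW : dv.ker.map (Nh s) ≤ Wn dv s t := by
    rintro _ ⟨x, hx, rfl⟩
    refine ⟨x, ?_, rfl⟩
    show dv x ∈ (Dh t).range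
    rw [show dv x = 1 from hx]
    exact Subgroup.one_mem _
  -- key index
  have key : (Fx t ⊔ P).relIndex Y = (dv.ker.map (Nh s)).relIndex (Wn dv s t) := by
    let T : Subgroup (I × M) := MonoidHom.eqLocus ((Dh t).comp (MonoidHom.fst I M))
      (dv.comp (MonoidHom.snd I M))
    have hT : ∀ a x, (a, x) ∈ T ↔ a / t a = dv x := fun a x => Iff.rfl
    have t1 : T.map (MonoidHom.fst I M) = Y := by
      apply le_antisymm
      · rintro _ ⟨⟨a, x⟩, hx, rfl⟩
        exact ⟨x, hx.symm⟩
      · rintro a ⟨x, hx⟩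
        exact ⟨(a, x), hx.symm, rfl⟩
    have t2 : T.map ((Nh s).comp (MonoidHom.snd I M)) = Wn dv s t := by
      apply le_antisymm
      · rintro _ ⟨⟨a, x⟩, hx, rfl⟩
        exact ⟨x, ⟨a, hx⟩, rfl⟩
      · rintro _ ⟨x, ⟨a, ha⟩, rfl⟩
        exact ⟨(a, x), ha, rfl⟩
    rw [← t1, ← t2, ← Subgroup.relIndex_comap, ← Subgroup.relIndex_comap,
      ← Subgroup.inf_relIndex_right, ← Subgroup.inf_relIndex_right (Subgroup.comap _ (Subgroup.map _ _))]
    congr 1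
    ext ⟨a, x⟩
    simp only [Subgroup.mem_inf, Subgroup.mem_comap, MonoidHom.coe_fst, hT]
    refine and_congr_left fun hax => ?_
    constructor
    · intro h
      obtain ⟨b, hb, c, ⟨y, rfl⟩, rfl⟩ := Subgroup.mem_sup.1 h
      refine ⟨x / (y / s y), ?_, by simp [hs, div_mul_div_comm]⟩
      show dv _ = 1
      rw [map_div, ← hax, map_div, map_mul, hst, show t b = b from hb]
      simp
    · rintro ⟨u, hu, hux⟩
      have hux' : u * s u = x * s x := hux
      obtain ⟨b, hb⟩ := h90 (x / u) (by
        rw [map_div, div_mul_div_comm, hux', div_self'])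
      have hxu : x = b / s b * u := by rw [← hb]; simp
      have hu1 : dv u = 1 := hu
      refine Subgroup.mem_sup.2 ⟨a / dv b, ?_, dv b, ⟨b, rfl⟩, by simp⟩
      have : a / t a = dv b / t (dv b) := by
        rw [hax, hxu, map_mul, hu1, map_div, hst, mul_one]
      rw [mem_Fx, map_div, eq_comm, div_eq_div_iff_div_eq_div]
      exact this
  have k1 := Subgroup.relIndex_mul_relIndex P (Fx t ⊔ P) Y le_sup_right (sup_le hFY hPY)
  rw [Subgroup.relIndex_sup_right, key] at k1
  have k2 := Subgroup.relIndex_mul_relIndex _ _ _ hNW hWE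
  have k3 := T2 dv s t hs hst h90
  have hPfix : (Fx s).map dv ≤ P ⊓ Fx t := by
    rintro _ ⟨x, hx, rfl⟩
    exact ⟨⟨x, rfl⟩, by show t (dv x) = dv x; rw [hst, show s x = x from hx]⟩
  have k4 := Subgroup.relIndex_mul_relIndex ((Fx s).map dv) (P ⊓ Fx t) (Fx t) hPfix inf_le_right
  have k5 := Subgroup.relIndex_mul_relIndex ((Fx s).map dv) J (Fx t) hPJ hJ
  rw [Subgroup.inf_relIndex_right] at k4
  rw [← k3, hh, ← k5, ← k2] at k4
  have hne : (dv.ker.map (Nh s)).relIndex (Wn dv s t) ≠ 0 := by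
    intro h
    rw [h, zero_mul] at k2
    exact hh0 k2.symm
  apply Nat.eq_of_mul_eq_mul_left (Nat.pos_of_ne_zero hne)
  rw [← k1]
  linear_combination ((dv.ker.map (Nh s)).relIndex (Wn dv s t)) * k4
end grp
end Q2
end

section
open NumberField nonZeroDivisors
namespace Q2
set_option linter.all false

/-- group of fractional ideals -/
abbrev IG (L : Type*) [Field L] [NumberField L] := (FractionalIdeal (𝓞 L)⁰ L)ˣ

/-- divisor map -/
noncomputable def dvv (L : Type*) [Field L] [NumberField L] : Lˣ →* IG L := toPrincipalIdeal (𝓞 L) L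

/-- induced map on integers -/
noncomputable abbrev om {F L : Type*} [Field F] [Field L] (f : F →+* L) : 𝓞 F →+* 𝓞 L :=
  RingOfIntegers.mapRingHom f

section
variable {F L M : Type*} [Field F] [NumberField F] [Field L] [NumberField L] [Field M]
  [NumberField M]

lemma om_inj (f : F →+* L) : Function.Injective (om f) := fun x y h => by
  apply RingOfIntegers.ext
  apply f.injective
  exact congrArg (fun z : 𝓞 L => (z : L)) h

lemma om_nzd (f : F →+* L) : (𝓞 F)⁰ ≤ Submonoid.comap (om f) (𝓞 L)⁰ :=
  nonZeroDivisors_le_comap_nonZeroDivisors_of_injective _ (om_inj f)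

/-- induced map on fractional ideals -/
noncomputable def im (f : F →+* L) : IG F →* IG L :=
  Units.map (FractionalIdeal.extendedHom' (K := F) L (om_nzd f)).toMonoidHom

lemma locmap (f : F →+* L) (x : F) : IsLocalization.map (S := F) L (om f) (om_nzd f) x = f x := by
  have : (IsLocalization.map (S := F) L (om f) (om_nzd f)) = f := by
    apply IsLocalization.ringHom_ext (𝓞 F)⁰
    ext x
    simp only [RingHom.comp_apply, IsLocalization.map_eq]
    rfl
  rw [this]

lemma im_val (f : F →+* L) (a : IG F) :
    (im f a : FractionalIdeal (𝓞 L)⁰ L) = (a : FractionalIdeal (𝓞 F)⁰ F).extended L (om_nzd f) := rfl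

lemma im_dvv (f : F →+* L) (x : Fˣ) : im f (dvv F x) = dvv L (Units.map f.toMonoidHom x) := by
  apply Units.ext
  rw [im_val, dvv, dvv, coe_toPrincipalIdeal, coe_toPrincipalIdeal,
    FractionalIdeal.extended_spanSingleton, locmap]
  rfl

lemma im_comp (f : F →+* L) (g : L →+* M) (a : IG F) : im g (im f a) = im (g.comp f) a := by
  apply Units.ext
  rw [im_val, im_val, im_val, FractionalIdeal.extended_extended]
  rfl

lemma im_id (a : IG F) : im (RingHom.id F) a = a := by
  apply Units.ext
  apply FractionalIdeal.coeToSubmodule_injective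
  show ((im (RingHom.id F) a : FractionalIdeal (𝓞 F)⁰ F) : Submodule (𝓞 F) F) = ((a : FractionalIdeal (𝓞 F)⁰ F) : Submodule (𝓞 F) F)
  rw [im_val, FractionalIdeal.coe_extended_eq_span]
  have : (⇑(IsLocalization.map (S := F) F (om (RingHom.id F)) (om_nzd _))) = id := by
    ext x; rw [locmap]; rfl
  rw [this, Set.image_id]
  exact Submodule.span_eq _

/-- integral ideal as element of IG -/
noncomputable def ii (A : Ideal (𝓞 L)) (h : A ≠ ⊥) : IG L :=
  Units.mk0 (A : FractionalIdeal (𝓞 L)⁰ L) (by simpa using h)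

lemma ii_val (A : Ideal (𝓞 L)) (h : A ≠ ⊥) : (ii A h : FractionalIdeal (𝓞 L)⁰ L) = A := rfl

lemma ii_inj {A B : Ideal (𝓞 L)} {hA : A ≠ ⊥} {hB : B ≠ ⊥} : ii A hA = ii B hB ↔ A = B := by
  rw [Units.ext_iff, ii_val, ii_val]; exact FractionalIdeal.coeIdeal_inj

lemma ii_mul {A B : Ideal (𝓞 L)} (hA : A ≠ ⊥) (hB : B ≠ ⊥) (hAB : A * B ≠ ⊥) :
    ii (A * B) hAB = ii A hA * ii B hB := by
  apply Units.ext; simp [ii_val]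

lemma ii_top (h : (⊤ : Ideal (𝓞 L)) ≠ ⊥) : ii (⊤ : Ideal (𝓞 L)) h = 1 := by
  apply Units.ext; simp [ii_val]

lemma map_ne_bot (f : F →+* L) {A : Ideal (𝓞 F)} (h : A ≠ ⊥) : A.map (om f) ≠ ⊥ := by
  rwa [Ne, Ideal.map_eq_bot_iff_of_injective (om_inj f)]

lemma im_ii (f : F →+* L) (A : Ideal (𝓞 F)) (h : A ≠ ⊥) :
    im f (ii A h) = ii (A.map (om f)) (map_ne_bot f h) := by
  apply Units.ext
  rw [im_val, ii_val, ii_val, FractionalIdeal.extended_coeIdeal_eq_map]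

lemma ii_span (x : 𝓞 L) (hx : x ≠ 0) (h) (hx' : (x : L) ≠ 0) :
    ii (Ideal.span {x}) h = dvv L (Units.mk0 (x : L) hx') := by
  apply Units.ext
  rw [ii_val, dvv, coe_toPrincipalIdeal, FractionalIdeal.coeIdeal_span_singleton]
  rfl

/-- every fractional ideal is integral over a principal one with integer generator -/
lemma exists_ii (a : IG L) : ∃ (n : ℕ) (hn : (n : L) ≠ 0) (A : Ideal (𝓞 L)) (h : A ≠ ⊥),
    a * dvv L (Units.mk0 (n : L) hn) = ii A h := by
  obtain ⟨x, J, hx, hJ⟩ := FractionalIdeal.exists_eq_spanSingleton_mul (a : FractionalIdeal (𝓞 L)⁰ L)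
  have hN : Algebra.norm ℤ x ≠ 0 := by
    rwa [Ne, Algebra.norm_eq_zero_iff]
  obtain ⟨y, hy⟩ : x ∣ ((Algebra.norm ℤ x).natAbs : 𝓞 L) := by
    have := Ideal.absNorm_mem (Ideal.span {x})
    rwa [Ideal.mem_span_singleton, Ideal.absNorm_span_singleton] at this
  set n := (Algebra.norm ℤ x).natAbs with hn
  have hn0 : n ≠ 0 := by rw [hn]; simpa using hN
  have hnL : (n : L) ≠ 0 := by exact_mod_cast hn0
  have hy0 : y ≠ 0 := by
    rintro rfl
    rw [mul_zero] at hy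
    exact hn0 (by exact_mod_cast hy)
  have hJ0 : J ≠ ⊥ := by
    rintro rfl
    exact a.ne_zero (by rw [hJ]; simp)
  refine ⟨n, hnL, Ideal.span {y} * J, ?_, ?_⟩
  · rw [Ne, Ideal.mul_eq_bot]
    push Not
    exact ⟨by simpa using hy0, hJ0⟩
  · apply Units.ext
    rw [Units.val_mul, hJ, dvv, coe_toPrincipalIdeal, ii_val, FractionalIdeal.coeIdeal_mul,
      FractionalIdeal.coeIdeal_span_singleton, mul_right_comm,
      FractionalIdeal.spanSingleton_mul_spanSingleton]
    congr 2
    have : (n : L) = (x : L) * (y : L) := by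
      have := congrArg (fun z : 𝓞 L => (z : L)) hy
      simpa using this
    have hx' : (x : L) ≠ 0 := by simpa using hx
    rw [Units.val_mk0, this]
    field_simp

lemma le_ii_iff {A B : Ideal (𝓞 L)} (hA : A ≠ ⊥) (hB : B ≠ ⊥) (c : IG L) (h : ii A hA = ii B hB * c)
    (hle : A ≤ B) : ∃ (C : Ideal (𝓞 L)) (hC : C ≠ ⊥), c = ii C hC := by
  obtain ⟨C, rfl⟩ := Ideal.dvd_iff_le.2 hle
  have hC : C ≠ ⊥ := by rintro rfl; simp at hA
  refine ⟨C, hC, ?_⟩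
  rw [ii_mul hB hC] at h
  exact (mul_left_cancel h).symm

lemma mem_ker_dvv (x : Lˣ) : x ∈ (dvv L).ker ↔ ∃ u : (𝓞 L)ˣ, ((u : 𝓞 L) : L) = x := by
  rw [MonoidHom.mem_ker, dvv, toPrincipalIdeal_eq_iff, Units.val_one]
  constructor
  · intro h
    have h1 : (x : L) ∈ (1 : FractionalIdeal (𝓞 L)⁰ L) := by
      rw [← h]; exact FractionalIdeal.mem_spanSingleton_self _ _
    have h2 : ((x⁻¹ : Lˣ) : L) ∈ (1 : FractionalIdeal (𝓞 L)⁰ L) := by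
      have : FractionalIdeal.spanSingleton (𝓞 L)⁰ ((x⁻¹ : Lˣ) : L) = 1 := by
        have h3 := FractionalIdeal.spanSingleton_mul_spanSingleton (S := (𝓞 L)⁰) (x : L) ((x⁻¹ : Lˣ) : L)
        rw [h, one_mul] at h3
        rw [h3]; simp
      rw [← this]; exact FractionalIdeal.mem_spanSingleton_self _ _
    rw [FractionalIdeal.mem_one_iff] at h1 h2
    obtain ⟨a, ha⟩ := h1
    obtain ⟨b, hb⟩ := h2
    refine ⟨⟨a, b, ?_, ?_⟩, ha⟩
    · apply FaithfulSMul.algebraMap_injective (𝓞 L) L; rw [map_mul, ha, hb]; simp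
    · apply FaithfulSMul.algebraMap_injective (𝓞 L) L; rw [map_mul, ha, hb]; simp
  · rintro ⟨u, hu⟩
    rw [← hu]
    apply FractionalIdeal.coeToSubmodule_injective
    have : FractionalIdeal.spanSingleton (𝓞 L)⁰ (((u : 𝓞 L)) : L) =
      ((Ideal.span {(u : 𝓞 L)} : Ideal (𝓞 L)) : FractionalIdeal (𝓞 L)⁰ L) := by
      rw [FractionalIdeal.coeIdeal_span_singleton]; 
    rw [this, Ideal.span_singleton_eq_top.2 u.isUnit]
    simp

lemma card_cl (L : Type*) [Field L] [NumberField L] :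
    Nat.card (ClassGroup (𝓞 L)) = (dvv L).range.index := by
  rw [Subgroup.index_eq_card]
  exact Nat.card_congr (ClassGroup.equiv L).toEquiv

end
end Q2
end

section
open NumberField nonZeroDivisors
namespace Q2
set_option linter.all false

/-- quadratic extension data -/
structure QE (F L : Type*) [Field F] [Field L] where
  f : F →+* L
  s : L →+* L
  r : L
  ss : ∀ x, s (s x) = x
  sf : ∀ y, s (f y) = f y
  fix : ∀ x, s x = x → ∃ y, f y = x
  sr : s r = -r
  r0 : r ≠ 0

namespace QE
variable {F L : Type*} [Field F] [NumberField F] [Field L] [NumberField L] (q : QE F L)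

/-- conjugation on integers -/
noncomputable abbrev os : 𝓞 L →+* 𝓞 L := om q.s
/-- embedding on integers -/
noncomputable abbrev of : 𝓞 F →+* 𝓞 L := om q.f
/-- conjugation on units -/
noncomputable abbrev su : Lˣ →* Lˣ := Units.map q.s.toMonoidHom
/-- conjugation on ideals -/
noncomputable abbrev ti : IG L →* IG L := im q.s
/-- ideals from below -/
noncomputable abbrev J : Subgroup (IG L) := (im q.f).range

lemma os_os (x : 𝓞 L) : q.os (q.os x) = x := RingOfIntegers.ext (q.ss x)
lemma os_of (x : 𝓞 F) : q.os (q.of x) = q.of x := RingOfIntegers.ext (q.sf x)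
lemma su_su (x : Lˣ) : q.su (q.su x) = x := Units.ext (q.ss x)

lemma ofix (x : 𝓞 L) (h : q.os x = x) : ∃ y, q.of y = x := by
  obtain ⟨y, hy⟩ := q.fix x (congrArg (fun z : 𝓞 L => (z : L)) h)
  have hInt : IsIntegral ℤ y := by
    have h2 : IsIntegral ℤ (q.f y) := by rw [hy]; exact x.2
    have := isIntegral_algHom_iff (q.f.toIntAlgHom) (x := y) q.f.injective
    exact this.1 h2
  exact ⟨⟨y, hInt⟩, RingOfIntegers.ext hy⟩

lemma ufix (x : Lˣ) (h : q.su x = x) : ∃ y : Fˣ, Units.map q.f.toMonoidHom y = x := by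
  obtain ⟨y, hy⟩ := q.fix x (congrArg (fun z : Lˣ => (z : L)) h)
  have : y ≠ 0 := by rintro rfl; rw [map_zero] at hy; exact x.ne_zero hy.symm
  exact ⟨Units.mk0 y this, Units.ext hy⟩

lemma mem_Fx_su (x : Lˣ) : x ∈ Fx q.su ↔ ∃ y : Fˣ, Units.map q.f.toMonoidHom y = x :=
  ⟨fun h => q.ufix x h, by rintro ⟨y, rfl⟩; exact Units.ext (q.sf y)⟩

lemma h90 (x : Lˣ) (hx : x * q.su x = 1) : ∃ a, x = a / q.su a := by
  have h1 : (x : L) * q.s x = 1 := congrArg (fun z : Lˣ => (z : L)) hx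
  by_cases h : (x : L) = -1
  · refine ⟨Units.mk0 q.r q.r0, ?_⟩
    rw [eq_div_iff_mul_eq']
    apply Units.ext
    show (x : L) * q.s q.r = q.r
    rw [q.sr, h]; ring
  · have h2 : (1 + (x : L)) ≠ 0 := fun h3 => h (by linear_combination h3)
    refine ⟨Units.mk0 _ h2, ?_⟩
    rw [eq_div_iff_mul_eq']
    apply Units.ext
    show (x : L) * q.s (1 + (x : L)) = 1 + x
    rw [map_add, map_one]
    linear_combination h1

lemma ti_ti (a : IG L) : q.ti (q.ti a) = a := by
  rw [im_comp]
  have : q.s.comp q.s = RingHom.id L := RingHom.ext q.ss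
  rw [this, im_id]

lemma ti_dvv (x : Lˣ) : q.ti (dvv L x) = dvv L (q.su x) := im_dvv _ _

lemma J_le : q.J ≤ Fx q.ti := by
  rintro _ ⟨a, rfl⟩
  rw [mem_Fx, im_comp]
  have : q.s.comp q.f = q.f := RingHom.ext q.sf
  rw [this]

lemma im_inj {F L : Type*} [Field F] [NumberField F] [Field L] [NumberField L] (f : F →+* L) : Function.Injective (im f) := by
  have key : ∀ a : IG F, im f a = 1 → (a : FractionalIdeal (𝓞 F)⁰ F) ≤ 1 := by
    intro a ha x hx
    have h1 : f x ∈ (im f a : FractionalIdeal (𝓞 L)⁰ L) := by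
      rw [im_val, FractionalIdeal.mem_extended_iff]
      exact Submodule.subset_span ⟨x, hx, locmap f x⟩
    rw [ha, Units.val_one, FractionalIdeal.mem_one_iff] at h1
    obtain ⟨y, hy⟩ := h1
    show x ∈ (1 : FractionalIdeal (𝓞 F)⁰ F)
    rw [FractionalIdeal.mem_one_iff]
    have hInt : IsIntegral ℤ x := by
      have h2 : IsIntegral ℤ (f x) := by rw [← hy]; exact y.2
      exact (isIntegral_algHom_iff (f.toIntAlgHom) (x := x) f.injective).1 h2
    exact ⟨⟨x, hInt⟩, rfl⟩
  rw [injective_iff_map_eq_one]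
  intro a ha
  have h1 := key a ha
  have h2 := key a⁻¹ (by rw [map_inv, ha, inv_one])
  apply Units.ext
  apply le_antisymm h1
  have := mul_le_mul_right h2 (a : FractionalIdeal (𝓞 F)⁰ F)
  simpa using this

lemma P0_eq : (Fx q.su).map (dvv L) = (dvv F).range.map (im q.f) := by
  ext x
  constructor
  · rintro ⟨y, hy, rfl⟩
    obtain ⟨z, rfl⟩ := q.ufix y hy
    exact ⟨dvv F z, ⟨z, rfl⟩, im_dvv _ _⟩
  · rintro ⟨_, ⟨z, rfl⟩, rfl⟩
    exact ⟨_, (q.mem_Fx_su _).2 ⟨z, rfl⟩, (im_dvv _ _).symm⟩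

lemma P0_le : (Fx q.su).map (dvv L) ≤ q.J := by
  rw [P0_eq]
  rintro _ ⟨x, _, rfl⟩
  exact ⟨x, rfl⟩

lemma card_F : ((Fx q.su).map (dvv L)).relIndex q.J = Nat.card (ClassGroup (𝓞 F)) := by
  rw [P0_eq, card_cl, J, ← Subgroup.relIndex_top_right, MonoidHom.range_eq_map (im q.f),
    Subgroup.relIndex_map_map_of_injective _ _ (im_inj q.f)]

lemma mem_map_os (A : Ideal (𝓞 L)) (x : 𝓞 L) : x ∈ A.map q.os ↔ q.os x ∈ A := by
  constructor
  · intro h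
    have : A.map q.os ≤ A.comap q.os := by
      rw [Ideal.map_le_iff_le_comap]
      intro y hy
      rw [Ideal.mem_comap, Ideal.mem_comap, os_os]; exact hy
    exact this h
  · intro h
    have := Ideal.mem_map_of_mem q.os h
    rwa [os_os] at this

lemma map_map_os (A : Ideal (𝓞 L)) : (A.map q.os).map q.os = A := by
  ext x; rw [mem_map_os, mem_map_os, os_os]

/-- Gauss lemma: the norm of an ideal comes from below -/
lemma R1 (A : Ideal (𝓞 L)) (hA : A ≠ ⊥) :
    ∃ C : Ideal (𝓞 F), C ≠ ⊥ ∧ A * A.map q.os = C.map q.of := by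
  set C : Ideal (𝓞 F) := Ideal.span {c | ∃ a ∈ A, q.of c = a * q.os a} with hC
  have hno : ∀ a ∈ A, ∃ c ∈ C, q.of c = a * q.os a := by
    intro a ha
    obtain ⟨c, hc⟩ := q.ofix (a * q.os a) (by rw [map_mul, os_os, mul_comm])
    exact ⟨c, Ideal.subset_span ⟨a, ha, hc⟩, hc⟩
  obtain ⟨a0, ha0, ha00⟩ := Submodule.exists_mem_ne_zero_of_ne_bot hA
  have hC0 : C ≠ ⊥ := by
    obtain ⟨c, hc, hc2⟩ := hno a0 ha0
    intro h
    rw [h, Ideal.mem_bot] at hc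
    rw [hc, map_zero] at hc2
    rcases mul_eq_zero.1 hc2.symm with h | h
    · exact ha00 h
    · apply ha00; rw [← q.os_os a0, h, map_zero]
  refine ⟨C, hC0, ?_⟩
  apply le_antisymm
  · rw [Ideal.mul_le]
    intro a ha b' hb'
    rw [mem_map_os] at hb'
    set b := q.os b' with hb
    have hb'b : b' = q.os b := by rw [hb, os_os]
    rw [hb'b]
    set T := a * q.os b with hT
    set N := C.map q.of with hN
    have hN0 : N ≠ ⊥ := map_ne_bot _ hC0
    set Q := Ideal.span {T} ⊔ N with hQ
    have hTQ : T ∈ Q := Ideal.mem_sup_left (Ideal.mem_span_singleton_self T)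
    have hNQ : N ≤ Q := le_sup_right
    have hQ0 : Q ≠ ⊥ := fun h => hN0 (le_bot_iff.1 (h ▸ hNQ))
    obtain ⟨c1, hc1, e1⟩ := hno a ha
    obtain ⟨c2, hc2, e2⟩ := hno b hb'
    obtain ⟨c3, hc3, e3⟩ := hno (a + b) (A.add_mem ha hb')
    have hTT : T * T ∈ N * Q := by
      have : T * T = q.of (c3 - c1 - c2) * T - q.of c1 * q.of c2 := by
        rw [map_sub, map_sub, e1, e2, e3, hT, map_add]; ring
      rw [this]
      exact Ideal.sub_mem _ (Ideal.mul_mem_mul (Ideal.mem_map_of_mem _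
        (C.sub_mem (C.sub_mem hc3 hc1) hc2)) hTQ)
        (Ideal.mul_mem_mul (Ideal.mem_map_of_mem _ hc1) (hNQ (Ideal.mem_map_of_mem _ hc2)))
    have hQQ : Q * Q ≤ N * Q := by
      have e : Q * Q = (Ideal.span {T} * Ideal.span {T} ⊔ Ideal.span {T} * N) ⊔ N * Q := by
        rw [← Ideal.mul_sup, ← hQ, ← Ideal.sup_mul]
      rw [e]
      apply sup_le _ le_rfl
      apply sup_le
      · rw [Ideal.span_singleton_mul_span_singleton, Ideal.span_singleton_le_iff_mem]
        exact hTT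
      · rw [mul_comm]
        exact Ideal.mul_mono_right (le_sup_left)
    have : N ∣ Q := by
      rw [← Ideal.dvd_iff_le] at hQQ
      exact (mul_dvd_mul_iff_right (by simpa using hQ0)).1 hQQ
    exact Ideal.dvd_iff_le.1 this hTQ
  · rw [Ideal.map_le_iff_le_comap, hC, Ideal.span_le]
    rintro c ⟨a, ha, hca⟩
    show q.of c ∈ A * Ideal.map q.os A
    rw [hca]
    exact Ideal.mul_mem_mul ha (Ideal.mem_map_of_mem _ ha)

lemma mul_ti_mem (a : IG L) : a * q.ti a ∈ q.J := by
  obtain ⟨n, hn, A, hA, h⟩ := exists_ii a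
  have hnJ : dvv L (Units.mk0 (n : L) hn) ∈ q.J := by
    have hn' : (n : F) ≠ 0 := by
      intro h0; apply hn; rw [← map_natCast q.f, h0, map_zero]
    exact ⟨dvv F (Units.mk0 (n : F) hn'), by
      rw [im_dvv]; congr 1; apply Units.ext; exact map_natCast q.f n⟩
  have ha : a = ii A hA / dvv L (Units.mk0 (n : L) hn) := by rw [← h]; simp
  have htn : q.ti (dvv L (Units.mk0 (n : L) hn)) = dvv L (Units.mk0 (n : L) hn) := q.J_le hnJ
  rw [ha, map_div, htn, div_mul_div_comm]
  refine q.J.div_mem ?_ (q.J.mul_mem hnJ hnJ)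
  obtain ⟨C, hC, hAC⟩ := q.R1 A hA
  refine ⟨ii C hC, ?_⟩
  rw [im_ii, im_ii, ← ii_mul hA (map_ne_bot _ hA) (by rw [hAC]; exact map_ne_bot _ hC)]
  rw [ii_inj, hAC]

lemma desc (A : Ideal (𝓞 L)) (hA : A.map q.os = A) (θ x : 𝓞 L) (hx : x ∈ A) :
    (θ - q.os θ) * x ∈ (A.comap q.of).map q.of := by
  have hmem : ∀ y ∈ A, q.os y ∈ A := fun y hy => by
    rw [← q.mem_map_os, hA]; exact hy
  have htr : ∀ y ∈ A, y + q.os y ∈ (A.comap q.of).map q.of := by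
    intro y hy
    obtain ⟨c, hc⟩ := q.ofix (y + q.os y) (by rw [map_add, os_os, add_comm])
    rw [← hc]
    apply Ideal.mem_map_of_mem
    rw [Ideal.mem_comap, hc]
    exact A.add_mem hy (hmem y hy)
  have : (θ - q.os θ) * x = (x * θ + q.os (x * θ)) - (x + q.os x) * q.os θ := by
    rw [map_mul]; ring
  rw [this]
  exact Ideal.sub_mem _ (htr _ (A.mul_mem_right _ hx)) (Ideal.mul_mem_right _ _ (htr _ hx))

lemma prime_inv (P : Ideal (𝓞 L)) [hP : P.IsPrime] (hP0 : P ≠ ⊥) (hs : P.map q.os = P) :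
    (P.comap q.of).map q.of = P ∨
    ((P.comap q.of).map q.of = P * P ∧ ∀ θ, θ - q.os θ ∈ P) := by
  obtain ⟨C, hC, h⟩ := q.R1 P hP0
  rw [hs] at h
  set Q := (P.comap q.of).map q.of with hQ
  have hQP : Q ≤ P := Ideal.map_comap_le
  have hCQ : C.map q.of ≤ Q := by
    apply Ideal.map_mono
    rw [← Ideal.map_le_iff_le_comap, ← h]
    exact Ideal.mul_le_left
  obtain ⟨X, hX⟩ := Ideal.dvd_iff_le.2 hQP
  rw [← h, hX, ← Ideal.dvd_iff_le] at hCQ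
  have hXP : X ∣ P := (mul_dvd_mul_iff_left (by simpa using hP0)).1 hCQ
  have hmax : P.IsMaximal := hP.isMaximal hP0
  rcases (Ideal.isMaximal_def.1 hmax).le_iff.1 (Ideal.dvd_iff_le.1 hXP) with h1 | h1
  · left; rw [hX, h1, Ideal.mul_top]
  · right
    rw [h1] at hX
    refine ⟨hX, fun θ => ?_⟩
    have h2 : Ideal.span {θ - q.os θ} * P ≤ P * P := by
      rw [← hX, Ideal.span_singleton_mul_le_iff]
      intro z hz
      exact q.desc P hs θ z hz
    rw [← Ideal.dvd_iff_le] at h2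
    have h3 := (mul_dvd_mul_iff_right (by simpa using hP0)).1 h2
    exact Ideal.dvd_iff_le.1 h3 (Ideal.mem_span_singleton_self _)

lemma cop_aux (A P : Ideal (𝓞 L)) (hPm : P.IsMaximal) (hPs : P.map q.os ≠ P) (h1 : A ≤ P)
    (h2 : A ≤ P.map q.os) : ∃ B, A = P * P.map q.os * B := by
  have hcop : IsCoprime P (P.map q.os) := by
    rw [Ideal.isCoprime_iff_sup_eq]
    by_contra h
    have h1 : P ⊔ P.map q.os = P := (hPm.eq_of_le h le_sup_left).symm
    have h2 : P.map q.os ≤ P := le_sup_right.trans_eq h1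
    have h3 : P ≤ P.map q.os := by
      have := Ideal.map_mono (f := q.os) h2
      rwa [map_map_os] at this
    exact hPs (le_antisymm h2 h3)
  have h3 := hcop.mul_dvd (Ideal.dvd_iff_le.2 h1) (Ideal.dvd_iff_le.2 h2)
  exact h3

set_option maxHeartbeats 1000000 in
lemma inv_mem (S : Subgroup (IG L)) (hJ : q.J ≤ S)
    (hS : ∀ (P : Ideal (𝓞 L)) (hP0 : P ≠ ⊥), P.IsPrime → P.map q.os = P →
      (P.comap q.of).map q.of = P * P → (∀ θ, θ - q.os θ ∈ P) → ii P hP0 ∈ S) :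
    Fx q.ti ≤ S := by
  have hprime : ∀ (P : Ideal (𝓞 L)) (hP0 : P ≠ ⊥), P.IsPrime → P.map q.os = P → ii P hP0 ∈ S := by
    intro P hP0 hP hs
    rcases q.prime_inv P hP0 hs with h | ⟨h1, h2⟩
    · apply hJ
      have h0 : P.comap q.of ≠ ⊥ := by
        intro h3; rw [h3, Ideal.map_bot] at h; exact hP0 h.symm
      exact ⟨ii (P.comap q.of) h0, by rw [im_ii, ii_inj]; exact h⟩
    · exact hS P hP0 hP hs h1 h2
  have hid : ∀ (A : Ideal (𝓞 L)), ∀ (hA : A ≠ ⊥), A.map q.os = A → ii A hA ∈ S := by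
    intro A
    induction A using WellFoundedGT.induction with
    | ind A ih =>
    intro hA hs
    by_cases hAt : A = ⊤
    · subst hAt; rw [ii_top]; exact S.one_mem
    · obtain ⟨P, hPm, hAP⟩ := Ideal.exists_le_maximal A hAt
      have hP0 : P ≠ ⊥ := fun h => hA (le_bot_iff.1 (h ▸ hAP))
      have hne : ∀ B C : Ideal (𝓞 L), A = C * B → C ≠ ⊤ → A < B := by
        intro B C h hC
        refine lt_of_le_of_ne (Ideal.dvd_iff_le.1 ⟨C, by rw [h, mul_comm]⟩) ?_
        intro h2
        have hB0 : B ≠ ⊥ := h2 ▸ hA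
        rw [h2] at h
        have : C * B = 1 * B := by rw [one_mul]; exact h.symm
        have := mul_right_cancel₀ (by simpa using hB0) this
        exact hC (by rw [this, Ideal.one_eq_top])
      have hne0 : ∀ B C : Ideal (𝓞 L), A = C * B → B ≠ ⊥ := by
        rintro B C h rfl; rw [Ideal.mul_bot] at h; exact hA h
      by_cases hPs : P.map q.os = P
      · obtain ⟨B, hB⟩ := Ideal.dvd_iff_le.2 hAP
        have hB0 := hne0 B P hB
        have hBs : B.map q.os = B := by
          have := hs
          rw [hB, Ideal.map_mul, hPs] at this
          exact mul_left_cancel₀ (by simpa using hP0) this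
        have := ih B (hne B P hB hPm.ne_top) hB0 hBs
        have h3 : ii A hA = ii P hP0 * ii B hB0 := by
          rw [← ii_mul hP0 hB0 (hB ▸ hA), ii_inj]; exact hB
        rw [h3]
        exact S.mul_mem (hprime P hP0 hPm.isPrime hPs) this
      · have hPs0 : P.map q.os ≠ ⊥ := map_ne_bot _ hP0
        have hAP2 : A ≤ P.map q.os := by
          rw [← hs]; exact Ideal.map_mono hAP
        obtain ⟨B, hB⟩ := q.cop_aux A P hPm hPs hAP hAP2
        have hB0 := hne0 B _ hB
        have hPP0 : P * P.map q.os ≠ ⊥ := by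
          rintro h; rw [h, Ideal.bot_mul] at hB; exact hA hB
        have hBs : B.map q.os = B := by
          have := hs
          rw [hB, Ideal.map_mul, Ideal.map_mul, map_map_os, mul_comm (P.map q.os)] at this
          exact mul_left_cancel₀ (by simpa using hPP0) this
        have h4 : P * P.map q.os ≠ ⊤ := by
          intro h
          exact hPm.ne_top (top_le_iff.1 (h.symm.le.trans Ideal.mul_le_left))
        have := ih B (hne B _ hB h4) hB0 hBs
        have h3 : ii A hA = ii _ hPP0 * ii B hB0 := by
          rw [← ii_mul hPP0 hB0 (hB ▸ hA), ii_inj]; exact hB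
        rw [h3]
        refine S.mul_mem (hJ ?_) this
        obtain ⟨C, hC, h⟩ := q.R1 P hP0
        exact ⟨ii C hC, by rw [im_ii, ii_inj, h]⟩
  intro a ha
  obtain ⟨n, hn, A, hA, h⟩ := exists_ii a
  have hnJ : dvv L (Units.mk0 (n : L) hn) ∈ q.J := by
    have hn' : (n : F) ≠ 0 := by
      intro h0; apply hn; rw [← map_natCast q.f, h0, map_zero]
    exact ⟨dvv F (Units.mk0 (n : F) hn'), by
      rw [im_dvv]; congr 1; apply Units.ext; exact map_natCast q.f n⟩
  have h1 : ii A hA ∈ S := by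
    apply hid
    have e : im q.s (ii A hA) = ii A hA := by
      rw [← h, map_mul, show im q.s a = a from ha, show im q.s (dvv L _) = dvv L _ from q.J_le hnJ]
    rw [im_ii] at e
    exact ii_inj.1 e
  rw [← h] at h1
  exact (Subgroup.mul_mem_cancel_right _ (hJ hnJ)).1 h1

end QE
end Q2
end

section
open NumberField nonZeroDivisors
namespace Q2
set_option linter.all false

section units
variable (L : Type*) [Field L] [NumberField L] [IsTotallyReal L]

lemma exists_real_emb : Nonempty (L →+* ℝ) := by
  obtain ⟨φ⟩ : Nonempty (L →+* ℂ) := inferInstance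
  exact ⟨(IsTotallyReal.complexEmbedding_isReal φ).embedding⟩

variable {L}
lemma neg_one_not_sq (x : L) : x ^ 2 ≠ -1 := by
  obtain ⟨ρ⟩ := exists_real_emb L
  intro h
  have := congrArg ρ h
  rw [map_pow, map_neg, map_one] at this
  nlinarith [sq_nonneg (ρ x)]

lemma tor_pm (u : (𝓞 L)ˣ) (h : u ∈ Units.torsion L) : u = 1 ∨ u = -1 := by
  obtain ⟨ρ⟩ := exists_real_emb L
  rw [Units.torsion, CommGroup.mem_torsion, isOfFinOrder_iff_pow_eq_one] at h
  obtain ⟨n, hn, h⟩ := h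
  have h1 : (ρ (u : 𝓞 L)) ^ n = 1 := by
    rw [← map_pow]
    have : (((u : 𝓞 L) : L)) ^ n = 1 := by
      have := congrArg (fun z : (𝓞 L)ˣ => ((z : 𝓞 L) : L)) h
      simpa using this
    rw [this, map_one]
  rcases pow_eq_one_iff_cases.1 h1 with h2 | h2 | h2
  · omega
  · left
    apply Units.ext; apply RingOfIntegers.ext; apply ρ.injective
    simpa using h2
  · right
    apply Units.ext; apply RingOfIntegers.ext; apply ρ.injective
    simpa using h2.1

lemma tor_card : Nat.card (Units.torsion L) = 2 := by
  rw [Nat.card_eq_two_iff]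
  refine ⟨1, ⟨-1, by
    rw [Units.torsion, CommGroup.mem_torsion, isOfFinOrder_iff_pow_eq_one]; exact ⟨2, by norm_num, by simp⟩⟩, ?_, ?_⟩
  · intro h
    have h1 : (1 : (𝓞 L)ˣ) = -1 := congrArg Subtype.val h
    have h2 := congrArg (fun z : (𝓞 L)ˣ => ((z : 𝓞 L) : L)) h1
    simp at h2
    have : (2 : L) = 0 := by linear_combination h2
    norm_num at this
  · ext x
    simp only [Set.mem_insert_iff, Set.mem_singleton_iff, Set.mem_univ, iff_true]
    rcases tor_pm x.1 x.2 with h | h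
    · left; exact Subtype.ext h
    · right; exact Subtype.ext h

lemma sq_Z : (sqh (Multiplicative ℤ)).range.index = 2 := by
  rw [Subgroup.index_eq_two_iff]
  refine ⟨Multiplicative.ofAdd 1, fun b => ?_⟩
  have key : ∀ c : Multiplicative ℤ, c ∈ (sqh (Multiplicative ℤ)).range ↔ Even (Multiplicative.toAdd c) := by
    intro c
    constructor
    · rintro ⟨x, rfl⟩
      exact ⟨Multiplicative.toAdd x, by rw [sqh_apply, toAdd_pow]; simp; ring⟩
    · rintro ⟨r, hr⟩
      refine ⟨Multiplicative.ofAdd r, ?_⟩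
      apply Multiplicative.toAdd.injective
      rw [sqh_apply, toAdd_pow, hr]; simp; ring
  rw [key, key, toAdd_mul, toAdd_ofAdd]
  rw [xor_iff_iff_not, Int.even_add_one]

lemma sq_index : (sqh (𝓞 L)ˣ).range.index = 2 ^ Module.finrank ℚ L := by
  let Ψ : (Units.torsion L) × (Fin (Units.rank L) → Multiplicative ℤ) →* (𝓞 L)ˣ :=
    { toFun := fun z => z.1 * ∏ i, (Units.fundSystem L i) ^ (Multiplicative.toAdd (z.2 i))
      map_one' := by simp
      map_mul' := by
        intro x y
        simp only [Prod.fst_mul, Prod.snd_mul, Pi.mul_apply, toAdd_mul, zpow_add, Finset.prod_mul_distrib,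
          Subgroup.coe_mul]
        exact mul_mul_mul_comm _ _ _ _ }
  have hb : Function.Bijective Ψ := by
    constructor
    · intro x y h
      obtain ⟨z, hz, hz2⟩ := Units.exist_unique_eq_mul_prod L (Ψ x)
      have h1 := hz2 (x.1, fun i => Multiplicative.toAdd (x.2 i)) rfl
      have h2 := hz2 (y.1, fun i => Multiplicative.toAdd (y.2 i)) h
      have h3 := h1.trans h2.symm
      rw [Prod.mk.injEq] at h3
      exact Prod.ext h3.1 h3.2
    · intro u
      obtain ⟨z, hz, hz2⟩ := Units.exist_unique_eq_mul_prod L u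
      exact ⟨(z.1, fun i => Multiplicative.ofAdd (z.2 i)), hz.symm⟩
  have h1 : (sqh (𝓞 L)ˣ).range = (sqh ((Units.torsion L) × (Fin (Units.rank L) → Multiplicative ℤ))).range.map Ψ := by
    ext u
    constructor
    · rintro ⟨x, rfl⟩
      obtain ⟨y, rfl⟩ := hb.2 x
      exact ⟨sqh _ y, ⟨y, rfl⟩, by simp⟩
    · rintro ⟨_, ⟨y, rfl⟩, rfl⟩
      exact ⟨Ψ y, by simp⟩
  have h2 : (sqh ((Units.torsion L) × (Fin (Units.rank L) → Multiplicative ℤ))).range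
      = (⊥ : Subgroup (Units.torsion L)).prod (Subgroup.pi Set.univ (fun _ => (sqh (Multiplicative ℤ)).range)) := by
    ext ⟨a, b⟩
    rw [Subgroup.mem_prod, Subgroup.mem_pi, Subgroup.mem_bot]
    constructor
    · rintro ⟨⟨x, y⟩, h⟩
      rw [sqh_apply, Prod.pow_mk, Prod.mk.injEq] at h
      refine ⟨?_, fun i _ => ⟨y i, by rw [sqh_apply, ← h.2]; rfl⟩⟩
      show a = 1
      rw [← h.1]
      apply Subtype.ext
      rcases tor_pm x.1 x.2 with h | h <;> simp [h]
    · rintro ⟨h, h'⟩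
      have h' : ∀ i, ∃ y : Multiplicative ℤ, sqh _ y = b i := fun i => h' i trivial
      choose y hy using h'
      refine ⟨(1, y), ?_⟩
      have h : a = 1 := h
      rw [sqh_apply, Prod.pow_mk, one_pow, h, Prod.mk.injEq]
      exact ⟨rfl, funext hy⟩
  rw [h1, Subgroup.index_map_of_bijective hb, h2, Subgroup.index_prod, Subgroup.index_pi, Subgroup.index_bot,
    tor_card, sq_Z, Finset.prod_const, Finset.card_univ, Fintype.card_fin, ← pow_succ', IsTotallyReal.finrank]
  congr 1
  have hc := InfinitePlace.card_eq_nrRealPlaces_add_nrComplexPlaces L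
  rw [IsTotallyReal.nrComplexPlaces_eq_zero, add_zero] at hc
  have : 0 < Fintype.card (InfinitePlace L) := Fintype.card_pos
  rw [Units.rank]; omega

end units
section units
variable {L : Type*} [Field L] [NumberField L]

/-- units as subgroup of the multiplicative group -/
noncomputable def ue (L : Type*) [Field L] [NumberField L] : (𝓞 L)ˣ →* Lˣ :=
  Units.map (algebraMap (𝓞 L) L).toMonoidHom

lemma ue_val (u : (𝓞 L)ˣ) : ((ue L u : Lˣ) : L) = ((u : 𝓞 L) : L) := rfl

lemma ue_inj : Function.Injective (ue L) := fun x y h => by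
  apply Units.ext; apply RingOfIntegers.ext
  exact congrArg (fun z : Lˣ => (z : L)) h

lemma ue_range : (ue L).range = (dvv L).ker := by
  ext x
  rw [mem_ker_dvv]
  exact ⟨fun ⟨u, h⟩ => ⟨u, congrArg (fun z : Lˣ => (z : L)) h⟩, fun ⟨u, h⟩ => ⟨u, Units.ext h⟩⟩

lemma sq_ker [IsTotallyReal L] : ((dvv L).ker.map (sqh Lˣ)).relIndex (dvv L).ker = 2 ^ Module.finrank ℚ L := by
  have : ((ue L).range.map (sqh Lˣ)) = (sqh (𝓞 L)ˣ).range.map (ue L) := by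
    ext u
    constructor
    · rintro ⟨_, ⟨y, rfl⟩, rfl⟩
      exact ⟨sqh _ y, ⟨y, rfl⟩, by simp⟩
    · rintro ⟨_, ⟨y, rfl⟩, rfl⟩
      exact ⟨ue L y, ⟨y, rfl⟩, by simp⟩
  rw [← ue_range, this, MonoidHom.range_eq_map (ue L), Subgroup.relIndex_map_map_of_injective _ _ ue_inj,
    Subgroup.relIndex_top_right, sq_index]

end units

namespace QE
variable {F L : Type*} [Field F] [NumberField F] [Field L] [NumberField L] (q : QE F L)

lemma decomp (x : L) : ∃ a b : F, x = q.f a + q.f b * q.r := by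
  have r0 := q.r0
  obtain ⟨a, ha⟩ := q.fix ((x + q.s x) / 2) (by
    rw [map_div₀, map_add, q.ss, map_ofNat, add_comm])
  obtain ⟨b, hb⟩ := q.fix ((x - q.s x) / (2 * q.r)) (by
    rw [map_div₀, map_sub, q.ss, map_mul, map_ofNat, q.sr]
    field_simp; ring)
  refine ⟨a, b, ?_⟩
  rw [ha, hb]; field_simp; ring

lemma r_not (a : F) : q.f a ≠ q.r := by
  intro h
  have h1 := q.sf a
  rw [h, q.sr] at h1
  apply q.r0
  linear_combination (-1/2 : L) * h1

lemma decomp_inj (a b : F) (h : q.f a + q.f b * q.r = 0) : a = 0 ∧ b = 0 := by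
  have hb : b = 0 := by
    by_contra hb
    have hb' : q.f b ≠ 0 := (map_ne_zero q.f).2 hb
    apply q.r_not (-a / b)
    rw [map_div₀, map_neg]
    field_simp
    linear_combination -h
  subst hb
  simpa using h

lemma deg (q : QE F L) : Module.finrank ℚ L = 2 * Module.finrank ℚ F := by
  have hq : ∀ (c : ℚ) (x : F), q.f (c • x) = c • q.f x := fun c x => map_rat_smul q.f c x
  let φ : (F × F) →ₗ[ℚ] L :=
    { toFun := fun z => q.f z.1 + q.f z.2 * q.r
      map_add' := by intro x y; simp; ring
      map_smul' := by intro c x; simp [hq] }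
  have hb : Function.Bijective φ := by
    constructor
    · rw [injective_iff_map_eq_zero]
      intro x hx
      obtain ⟨h1, h2⟩ := q.decomp_inj _ _ hx
      exact Prod.ext h1 h2
    · intro x
      obtain ⟨a, b, h⟩ := q.decomp x
      exact ⟨(a, b), h.symm⟩
  rw [← (LinearEquiv.ofBijective φ hb).finrank_eq, Module.finrank_prod]; ring

/-- field inclusion on units -/
noncomputable abbrev fu : Fˣ →* Lˣ := Units.map q.f.toMonoidHom

lemma fu_inj : Function.Injective q.fu := fun x y h => by
  apply Units.ext; apply q.f.injective
  exact congrArg (fun z : Lˣ => (z : L)) h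

lemma E0_eq : (dvv L).ker ⊓ Fx q.su = (dvv F).ker.map q.fu := by
  ext x
  constructor
  · rintro ⟨h1, h2⟩
    obtain ⟨y, rfl⟩ := q.ufix x h2
    refine ⟨y, ?_, rfl⟩
    have h1 : dvv L (q.fu y) = 1 := h1
    rw [← im_dvv] at h1
    exact im_inj q.f (h1.trans (map_one _).symm)
  · rintro ⟨y, hy, rfl⟩
    have hy : dvv F y = 1 := hy
    refine ⟨?_, (q.mem_Fx_su _).2 ⟨y, rfl⟩⟩
    show dvv L (q.fu y) = 1
    rw [← im_dvv, hy, map_one]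

lemma su_ker (x : Lˣ) (hx : x ∈ (dvv L).ker) : q.su x ∈ (dvv L).ker := by
  have hx : dvv L x = 1 := hx
  show dvv L (q.su x) = 1
  rw [← ti_dvv, hx, map_one]

variable [IsTotallyReal F] [IsTotallyReal L]

lemma hb : ((dvv L).ker.map (Dh q.su)).relIndex (Em (dvv L).ker q.su)
      = 2 * ((dvv L).ker.map (Nh q.su)).relIndex ((dvv L).ker ⊓ Fx q.su) ∧
    ((dvv L).ker.map (Nh q.su)).relIndex ((dvv L).ker ⊓ Fx q.su) ≠ 0 := by
  apply herbrand (dvv L).ker q.su q.su_su q.su_ker (-1)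
  · rw [mem_ker_dvv]; exact ⟨-1, by simp⟩
  · apply Units.ext; simp
  · simp
  · intro u _ h
    have h1 : (u : L) * u = 1 := congrArg (fun z : Lˣ => (z : L)) h
    rcases mul_self_eq_one_iff.1 h1 with h | h
    · left; exact Units.ext h
    · right; exact Units.ext h
  · intro u _ h
    have h1 : (u : L) ^ 2 = -1 := congrArg (fun z : Lˣ => (z : L)) h
    exact neg_one_not_sq _ h1
  · show (2 ^ Module.finrank ℚ F) ≠ 0
    positivity
  · rw [sq_ker, q.deg, two_mul, pow_add]
  · rw [q.E0_eq]
    have : ((dvv F).ker.map q.fu).map (sqh Lˣ) = ((dvv F).ker.map (sqh Fˣ)).map q.fu := by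
      rw [Subgroup.map_map, Subgroup.map_map]; congr 1
      ext x; simp
    rw [this, Subgroup.relIndex_map_map_of_injective _ _ q.fu_inj, sq_ker]

/-- the number of ambiguous classes over below classes, H1 version -/
lemma H1 : ((Fx q.su).map (dvv L)).relIndex ((dvv L).range ⊓ Fx q.ti) =
    2 * ((dvv L).ker.map (Nh q.su)).relIndex ((dvv L).ker ⊓ Fx q.su) := by
  rw [← T2 (dvv L) q.su q.ti q.su_su q.ti_dvv q.h90]
  exact q.hb.1

/-- ambiguous class number formula -/
lemma chv : (dvv L).range.relIndex ((dvv L).range.comap (Dh q.ti)) *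
      (2 * (Wn (dvv L) q.su q.ti).relIndex ((dvv L).ker ⊓ Fx q.su))
      = q.J.relIndex (Fx q.ti) * Nat.card (ClassGroup (𝓞 F)) := by
  rw [← q.card_F]
  exact chev (dvv L) q.su q.ti q.su_su q.ti_ti q.ti_dvv q.h90 q.J q.J_le q.P0_le q.hb.1 q.hb.2

end QE
end Q2
end

section
open NumberField nonZeroDivisors
namespace Q2
set_option linter.all false

section grp
variable {G : Type*} [CommGroup G]

lemma two_dvd_relIndex (H K : Subgroup G) (x : G) (hx : x ∈ K) (hxH : x ∉ H) (hx2 : x ^ 2 ∈ H) :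
    2 ∣ H.relIndex K := by
  let y : K ⧸ (H.subgroupOf K) := QuotientGroup.mk ⟨x, hx⟩
  have h1 : orderOf y = 2 := by
    apply orderOf_eq_prime
    · rw [← QuotientGroup.mk_pow, QuotientGroup.eq_one_iff]; exact hx2
    · rw [Ne, QuotientGroup.eq_one_iff]; exact hxH
  have := orderOf_dvd_natCard y
  rwa [h1] at this

/-- fixed points parity -/
lemma parity (P : Subgroup G) (hP : P.index ≠ 0) (t : G →* G) (ht : ∀ x, t (t x) = x)
    (htP : P ≤ P.comap t) : P.index ≡ P.relIndex (P.comap (Dh t)) [MOD 2] := by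
  let f : G ⧸ P →* G ⧸ P := QuotientGroup.map P P t htP
  have hf : ∀ x, f (f x) = x := by
    intro x
    obtain ⟨x, rfl⟩ := QuotientGroup.mk_surjective x
    show ((t (t x) : G) : G ⧸ P) = x
    rw [ht]
  have : Finite (G ⧸ P) := by
    apply Nat.finite_of_card_ne_zero; exact hP
  have : Fintype (G ⧸ P) := Fintype.ofFinite _
  classical
  have key := Equiv.Perm.card_fixedPoints_modEq (p := 2) (n := 1) (f := (f : G ⧸ P → G ⧸ P)) (by
    funext x; exact hf x)
  rw [← Nat.card_eq_fintype_card, ← Nat.card_eq_fintype_card] at key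
  have e1 : P.relIndex (P.comap (Dh t)) = Nat.card (Function.fixedPoints f) := by
    have h1 : P = (⊥ : Subgroup (G ⧸ P)).comap (QuotientGroup.mk' P) := by
      rw [MonoidHom.comap_bot, QuotientGroup.ker_mk']
    conv_lhs => rw [h1, Subgroup.relIndex_comap, ← h1, Subgroup.relIndex_bot_left]
    apply Nat.card_congr
    apply Equiv.subtypeEquivRight
    intro x
    constructor
    · rintro ⟨y, hy, rfl⟩
      have hy : y / t y ∈ P := hy
      show ((t y : G) : G ⧸ P) = y
      rw [QuotientGroup.eq, mul_comm, ← div_eq_mul_inv]; exact hy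
    · intro h
      obtain ⟨y, rfl⟩ := QuotientGroup.mk_surjective x
      have h : ((t y : G) : G ⧸ P) = y := h
      rw [QuotientGroup.eq, mul_comm, ← div_eq_mul_inv] at h
      exact ⟨y, h, rfl⟩
  rw [e1]
  exact key

lemma four_aux (P : Subgroup G) (hP : P.index ≠ 0) (h4 : 4 ∣ P.index)
    (hc : ∀ a : G, a ^ 4 ∈ P → a ^ 2 ∈ P) : 4 ∣ P.relIndex (P.comap (sqh G)) := by
  have : Finite (G ⧸ P) := by
    apply Nat.finite_of_card_ne_zero; exact hP
  obtain ⟨H, hH⟩ := Sylow.exists_subgroup_card_pow_prime (G := G ⧸ P) 2 (n := 2) (by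
    exact h4)
  have h1 : P = (⊥ : Subgroup (G ⧸ P)).comap (QuotientGroup.mk' P) := by
    rw [MonoidHom.comap_bot, QuotientGroup.ker_mk']
  conv_rhs => arg 1; rw [h1]
  rw [Subgroup.relIndex_comap, Subgroup.relIndex_bot_left]
  have h2 : H ≤ (P.comap (sqh G)).map (QuotientGroup.mk' P) := by
    intro x hx
    obtain ⟨y, rfl⟩ := QuotientGroup.mk_surjective x
    refine ⟨y, ?_, rfl⟩
    have h3 : (⟨(y : G ⧸ P), hx⟩ : H) ^ (Nat.card H) = 1 := pow_card_eq_one'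
    rw [hH] at h3
    have h4 := congrArg Subtype.val h3
    have h4 : ((y ^ 4 : G) : G ⧸ P) = 1 := h4
    rw [QuotientGroup.eq_one_iff] at h4
    exact hc y h4
  have := Subgroup.card_dvd_of_le h2
  rw [hH] at this
  exact this

lemma relIndex_two_pow (J K : Subgroup G) (S : Finset G) (hJK : J ≤ K) (hS : ∀ g ∈ S, g ^ 2 ∈ J)
    (hK : K ≤ J ⊔ Subgroup.closure (S : Set G)) : J.relIndex K ∣ 2 ^ S.card := by
  have h1 : J.relIndex (J ⊔ Subgroup.closure (S : Set G)) ∣ 2 ^ S.card := by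
    clear hK hJK
    classical
    induction S using Finset.induction_on with
    | empty => simp
    | insert a S ha ih =>
      have ih := ih (fun g hg => hS g (Finset.mem_insert_of_mem hg))
      rw [Finset.coe_insert, Finset.card_insert_of_notMem ha, pow_succ, Set.insert_eq, Subgroup.closure_union]
      set T := J ⊔ Subgroup.closure (S : Set G) with hT
      have e : J ⊔ (Subgroup.closure {a} ⊔ Subgroup.closure (S : Set G)) = Subgroup.closure {a} ⊔ T := by
        rw [hT]; ac_rfl
      rw [e, ← Subgroup.relIndex_mul_relIndex J T _ le_sup_left le_sup_right]
      apply mul_dvd_mul ih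
      rw [Subgroup.relIndex_sup_right]
      rw [Subgroup.relIndex_dvd_two_iff]
      have ha2 : a ^ 2 ∈ T := (le_sup_left : J ≤ T) (hS a (Finset.mem_insert_self _ _))
      refine ⟨a, Subgroup.mem_closure_singleton_self a, ?_⟩
      intro b hb
      obtain ⟨n, rfl⟩ := Subgroup.mem_closure_singleton.1 hb
      rcases Int.even_or_odd' n with ⟨m, rfl | rfl⟩
      · right; rw [zpow_mul]; exact T.zpow_mem (by exact_mod_cast ha2) _
      · left
        rw [← zpow_add_one, show (2 * m + 1 + 1 : ℤ) = 2 * (m + 1) by ring, zpow_mul]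
        exact T.zpow_mem (by exact_mod_cast ha2) _
  exact (Dvd.intro _ (Subgroup.relIndex_mul_relIndex J K _ hJK hK)).trans h1
end grp

lemma cl_ne (L : Type*) [Field L] [NumberField L] : (dvv L).range.index ≠ 0 := by
  rw [← card_cl]; exact Nat.card_pos.ne'

namespace QE
variable {F L : Type*} [Field F] [NumberField F] [Field L] [NumberField L] (q : QE F L)

/-- number of ambiguous classes -/
noncomputable def amb : ℕ := (dvv L).range.relIndex ((dvv L).range.comap (Dh q.ti))

lemma ti_range : (dvv L).range ≤ (dvv L).range.comap q.ti := by
  rintro _ ⟨x, rfl⟩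
  exact ⟨q.su x, (q.ti_dvv x).symm⟩

lemma amb_parity : Nat.card (ClassGroup (𝓞 L)) ≡ q.amb [MOD 2] := by
  rw [card_cl]; exact parity _ (cl_ne L) _ q.ti_ti q.ti_range

lemma amb_odd (h : Odd q.amb) : Odd (Nat.card (ClassGroup (𝓞 L))) := by
  have := q.amb_parity
  rw [Nat.odd_iff] at *
  exact Eq.trans this h

lemma W_norm (x : Lˣ) (h : x ∈ Wn (dvv L) q.su q.ti) : ∃ y : Lˣ, x = y * q.su y := by
  obtain ⟨y, _, rfl⟩ := h
  exact ⟨y, rfl⟩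

lemma E0_sq_W (x : Lˣ) (h : x ∈ (dvv L).ker ⊓ Fx q.su) : x ^ 2 ∈ Wn (dvv L) q.su q.ti := by
  obtain ⟨h1, h2⟩ := h
  have h2 : q.su x = x := h2
  have h1 : dvv L x = 1 := h1
  refine ⟨x, ?_, ?_⟩
  · show dvv L x ∈ (Dh q.ti).range
    rw [h1]; exact Subgroup.one_mem _
  · rw [Nh_apply, h2, sq]

/-- existence of a unit which is not a norm makes the index even -/
lemma W_even (e : (𝓞 F)ˣ) (h : ∀ y : L, y * q.s y ≠ q.f e) :
    2 ∣ (Wn (dvv L) q.su q.ti).relIndex ((dvv L).ker ⊓ Fx q.su) := by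
  have he : ue F e ∈ (dvv F).ker := by rw [← ue_range]; exact ⟨e, rfl⟩
  have hm : q.fu (ue F e) ∈ (dvv L).ker ⊓ Fx q.su := by
    rw [q.E0_eq]; exact ⟨_, he, rfl⟩
  apply two_dvd_relIndex _ _ (q.fu (ue F e)) hm
  · intro hW
    obtain ⟨y, hy⟩ := q.W_norm _ hW
    exact h y (congrArg (fun z : Lˣ => (z : L)) hy).symm
  · exact q.E0_sq_W _ hm

lemma unram (θs : Set (𝓞 L)) (h : Ideal.span ((fun θ => θ - q.os θ) '' θs) = ⊤) :
    Fx q.ti ≤ q.J := by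
  apply q.inv_mem q.J le_rfl
  intro P hP0 hP _ _ hθ
  exfalso
  apply hP.ne_top
  rw [← top_le_iff, ← h, Ideal.span_le]
  rintro _ ⟨θ, _, rfl⟩
  exact hθ θ

lemma ram_bound (T : Finset (Ideal (𝓞 F)))
    (hT : ∀ P : Ideal (𝓞 L), P.IsPrime → P ≠ ⊥ → P.map q.os = P →
      (∀ θ, θ - q.os θ ∈ P) → P.comap q.of ∈ T) :
    q.J.relIndex (Fx q.ti) ∣ 2 ^ T.card := by
  classical
  let φ : Ideal (𝓞 F) → IG L := fun Q =>
    if h : ∃ (P : Ideal (𝓞 L)) (hP0 : P ≠ ⊥), Q.map q.of = P * P then ii h.choose h.choose_spec.choose else 1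
  have hφ : ∀ (P : Ideal (𝓞 L)) (hP0 : P ≠ ⊥), (P.comap q.of).map q.of = P * P → φ (P.comap q.of) = ii P hP0 := by
    intro P hP0 h
    have hex : ∃ (P' : Ideal (𝓞 L)) (hP0 : P' ≠ ⊥), (P.comap q.of).map q.of = P' * P' := ⟨P, hP0, h⟩
    have h1 : φ (P.comap q.of) = ii hex.choose hex.choose_spec.choose := dif_pos hex
    rw [h1, ii_inj]
    have h2 := hex.choose_spec.choose_spec
    have h3 : hex.choose ^ 2 = P ^ 2 := by rw [sq, sq, ← h2, h]
    have ha : hex.choose ∣ P := (UniqueFactorizationMonoid.pow_dvd_pow_iff_dvd (two_ne_zero)).1 (dvd_of_eq h3)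
    have hb : P ∣ hex.choose := (UniqueFactorizationMonoid.pow_dvd_pow_iff_dvd (two_ne_zero)).1 (dvd_of_eq h3.symm)
    exact le_antisymm (Ideal.dvd_iff_le.1 hb) (Ideal.dvd_iff_le.1 ha)
  refine (relIndex_two_pow q.J (Fx q.ti) (T.image φ) q.J_le ?_ ?_).trans
    (pow_dvd_pow 2 Finset.card_image_le)
  · intro g hg
    rw [Finset.mem_image] at hg
    obtain ⟨Q, hQ, rfl⟩ := hg
    by_cases h : ∃ (P : Ideal (𝓞 L)) (hP0 : P ≠ ⊥), Q.map q.of = P * P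
    · have h1 : φ Q = ii h.choose h.choose_spec.choose := dif_pos h
      have h2 := h.choose_spec.choose_spec
      have hPP : h.choose * h.choose ≠ ⊥ := by
        rw [Ne, Ideal.mul_eq_bot]; simpa using h.choose_spec.choose
      have hQ0 : Q ≠ ⊥ := by
        rintro h0
        apply hPP; rw [← h2, h0, Ideal.map_bot]
      rw [h1, sq, ← ii_mul _ _ hPP]
      exact ⟨ii Q hQ0, by rw [im_ii, ii_inj]; exact h2⟩
    · have h1 : φ Q = 1 := dif_neg h
      rw [h1, one_pow]; exact q.J.one_mem
  · apply q.inv_mem _ le_sup_left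
    intro P hP0 hP hs hr hθ
    apply (le_sup_right : _ ≤ q.J ⊔ Subgroup.closure _)
    apply Subgroup.subset_closure
    rw [← hφ P hP0 hr, Finset.mem_coe]
    exact Finset.mem_image_of_mem _ (hT P hP hP0 hs hθ)

lemma cap (a : IG F) (h : im q.f a ∈ (dvv L).range) : a ^ 2 ∈ (dvv F).range := by
  obtain ⟨g, hg⟩ := h
  obtain ⟨c, hc⟩ := q.ufix (g * q.su g) (by rw [map_mul, q.su_su, mul_comm])
  refine ⟨c, im_inj q.f ?_⟩
  rw [im_dvv, hc, map_mul, ← ti_dvv, hg, show q.ti (im q.f a) = im q.f a from q.J_le ⟨a, rfl⟩, map_pow, sq]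

/-- odd class number above kills higher torsion below -/
lemma cap4 (q : QE F L) (hL : Odd (Nat.card (ClassGroup (𝓞 L)))) (a : IG F) (h : a ^ 4 ∈ (dvv F).range) :
    a ^ 2 ∈ (dvv F).range := by
  apply q.cap
  have h1 : (im q.f a) ^ 4 ∈ (dvv L).range := by
    obtain ⟨c, hc⟩ := h
    rw [← map_pow, ← hc, im_dvv]; exact ⟨_, rfl⟩
  have h2 : (im q.f a) ^ (Nat.card (ClassGroup (𝓞 L))) ∈ (dvv L).range := by
    rw [card_cl]; exact Subgroup.pow_index_mem _ _
  have hcop : Nat.gcd 4 (Nat.card (ClassGroup (𝓞 L))) = 1 := by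
    rw [show 4 = 2 ^ 2 by norm_num]
    exact Nat.Coprime.pow_left 2 (Nat.coprime_two_left.2 hL)
  have h3 := Nat.gcd_eq_gcd_ab 4 (Nat.card (ClassGroup (𝓞 L)))
  rw [hcop] at h3
  rw [← zpow_one (im q.f a), show (1 : ℤ) = _ from h3, zpow_add, zpow_mul, zpow_mul]
  exact Subgroup.mul_mem _ (Subgroup.zpow_mem _ (by exact_mod_cast h1) _) (Subgroup.zpow_mem _ (by exact_mod_cast h2) _)

/-- two-torsion equals ambiguous classes if the base has class number one -/
lemma amb_one (h1 : Nat.card (ClassGroup (𝓞 F)) = 1) :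
    (dvv L).range.comap (Dh q.ti) = (dvv L).range.comap (sqh (IG L)) := by
  have hF : (dvv F).range = ⊤ := by rw [← Subgroup.index_eq_one, ← card_cl, h1]
  have hJ : q.J ≤ (dvv L).range := by
    rintro _ ⟨a, rfl⟩
    have : a ∈ (dvv F).range := by rw [hF]; trivial
    obtain ⟨c, rfl⟩ := this
    rw [im_dvv]; exact ⟨_, rfl⟩
  ext a
  rw [Subgroup.mem_comap, Subgroup.mem_comap, Dh_apply, sqh_apply]
  have h2 : a ^ 2 = (a / q.ti a) * (a * q.ti a) := by
    rw [sq, div_mul_eq_mul_div, ← mul_assoc, mul_div_assoc, div_self', mul_one]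
  rw [h2, Subgroup.mul_mem_cancel_right _ (hJ (q.mul_ti_mem a))]

variable [IsTotallyReal F] [IsTotallyReal L]

lemma amb_eq : q.amb * (2 * (Wn (dvv L) q.su q.ti).relIndex ((dvv L).ker ⊓ Fx q.su))
      = q.J.relIndex (Fx q.ti) * Nat.card (ClassGroup (𝓞 F)) := q.chv

lemma amb_unram (h : Fx q.ti ≤ q.J) : q.amb * 2 ∣ Nat.card (ClassGroup (𝓞 F)) := by
  have h1 := q.amb_eq
  rw [Subgroup.relIndex_eq_one.2 h, one_mul, ← mul_assoc] at h1
  exact Dvd.intro _ h1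

lemma amb_ram {t : ℕ} (h : q.J.relIndex (Fx q.ti) ∣ 2 ^ (t + 1)) :
    q.amb ∣ 2 ^ t * Nat.card (ClassGroup (𝓞 F)) := by
  have h1 := q.amb_eq
  have h2 : q.amb * 2 ∣ q.J.relIndex (Fx q.ti) * Nat.card (ClassGroup (𝓞 F)) := by
    rw [← h1, ← mul_assoc]; exact dvd_mul_right _ _
  have h3 := h2.trans (mul_dvd_mul_right h _)
  rw [pow_succ, show 2 ^ t * 2 * Nat.card (ClassGroup (𝓞 F)) = (2 ^ t * Nat.card (ClassGroup (𝓞 F))) * 2 by ring] at h3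
  exact Nat.dvd_of_mul_dvd_mul_right (by norm_num) h3

lemma amb_ram' {t : ℕ} (h : q.J.relIndex (Fx q.ti) ∣ 2 ^ (t + 2))
    (he : 2 ∣ (Wn (dvv L) q.su q.ti).relIndex ((dvv L).ker ⊓ Fx q.su)) :
    q.amb ∣ 2 ^ t * Nat.card (ClassGroup (𝓞 F)) := by
  have h1 := q.amb_eq
  obtain ⟨k, hk⟩ := he
  rw [hk] at h1
  have h2 : q.amb * 4 ∣ q.J.relIndex (Fx q.ti) * Nat.card (ClassGroup (𝓞 F)) :=
    Dvd.intro k (by rw [← h1]; ring)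
  have h3 := h2.trans (mul_dvd_mul_right h _)
  rw [pow_add, show 2 ^ t * 2 ^ 2 * Nat.card (ClassGroup (𝓞 F)) = (2 ^ t * Nat.card (ClassGroup (𝓞 F))) * 4 by ring] at h3
  exact Nat.dvd_of_mul_dvd_mul_right (by norm_num) h3

end QE
end Q2
end

section
open NumberField nonZeroDivisors
namespace Q2
set_option linter.all false

section
variable {F : Type*} [Field F] [NumberField F]

lemma NN0 (D : 𝓞 F) (Q : Ideal (𝓞 F)) [hQ : Q.IsPrime] (hD : D ∈ Q) (hD2 : D ∉ Q ^ 2) (e : 𝓞 F) :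
    ∀ (n : ℕ) (x y m : 𝓞 F), e * m ^ 2 = x ^ 2 - D * y ^ 2 → m ∉ Q ^ (n + 1) → ∃ c, e - c ^ 2 ∈ Q := by
  have hD0 : D ≠ 0 := by rintro rfl; exact hD2 (zero_mem _)
  have hQ0 : Q ≠ ⊥ := by rintro h; rw [h, Ideal.mem_bot] at hD; exact hD0 hD
  have hm : Q.IsMaximal := hQ.isMaximal hQ0
  obtain ⟨C, hC⟩ := Ideal.dvd_iff_le.2 ((Ideal.span_singleton_le_iff_mem Q).2 hD)
  have hCQ : ¬ C ≤ Q := by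
    intro h
    apply hD2
    have h1 : Ideal.span {D} ≤ Q ^ 2 := by rw [hC, sq]; exact Ideal.mul_mono_right h
    exact h1 (Ideal.mem_span_singleton_self D)
  obtain ⟨γ, hγC, hγ⟩ := Set.not_subset.1 hCQ
  have hdiv : ∀ z ∈ Q, ∃ z', γ * z = D * z' := by
    intro z hz
    have : z * γ ∈ Ideal.span {D} := by rw [hC]; exact Ideal.mul_mem_mul hz hγC
    obtain ⟨w, hw⟩ := Ideal.mem_span_singleton'.1 this
    exact ⟨w, by rw [mul_comm, ← hw, mul_comm]⟩
  intro n
  have base : ∀ (x y m : 𝓞 F), e * m ^ 2 = x ^ 2 - D * y ^ 2 → m ∉ Q → ∃ c, e - c ^ 2 ∈ Q := by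
    intro x y m h hmQ
    obtain ⟨i, u, hu, hi⟩ := Ideal.IsMaximal.exists_inv hm hmQ
    refine ⟨i * x, ?_⟩
    have : e - (i * x) ^ 2 = e * (1 + i * m) * u - i ^ 2 * (D * y ^ 2) := by
      have h1 : u = 1 - i * m := by rw [← hi]; ring
      rw [h1]
      linear_combination (i ^ 2) * h
    rw [this]
    exact Q.sub_mem (Q.mul_mem_left _ hu) (Q.mul_mem_left _ (Q.mul_mem_right _ hD))
  induction n with
  | zero => intro x y m h hmQ; rw [zero_add, pow_one] at hmQ; exact base x y m h hmQ
  | succ n ih =>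
    intro x y m h hmn
    by_cases hmQ : m ∈ Q
    · have hx : x ∈ Q := by
        apply hQ.mem_of_pow_mem 2
        have : x ^ 2 = e * m ^ 2 + D * y ^ 2 := by linear_combination -h
        rw [this]
        exact Q.add_mem (Q.mul_mem_left _ (Ideal.pow_mem_of_mem _ hmQ _ (by norm_num))) (Q.mul_mem_right _ hD)
      have hy : y ∈ Q := by
        have h1 : D * y ^ 2 ∈ Q * Q := by
          have : D * y ^ 2 = x * x - e * (m * m) := by linear_combination h
          rw [this]
          exact Ideal.sub_mem _ (Ideal.mul_mem_mul hx hx) (Ideal.mul_mem_left _ _ (Ideal.mul_mem_mul hmQ hmQ))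
        have h2 : Q * (C * Ideal.span {y ^ 2}) ≤ Q * Q := by
          rw [← mul_assoc, ← hC, Ideal.span_singleton_mul_span_singleton, Ideal.span_singleton_le_iff_mem]
          exact h1
        rw [← Ideal.dvd_iff_le] at h2
        have h3 := Ideal.dvd_iff_le.1 ((mul_dvd_mul_iff_left (by simpa using hQ0)).1 h2)
        have h4 : γ * y ^ 2 ∈ Q := h3 (Ideal.mul_mem_mul hγC (Ideal.mem_span_singleton_self _))
        exact hQ.mem_of_pow_mem 2 ((hQ.mem_or_mem h4).resolve_left hγ)
      obtain ⟨x', hx'⟩ := hdiv x hx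
      obtain ⟨y', hy'⟩ := hdiv y hy
      obtain ⟨m', hm'⟩ := hdiv m hmQ
      apply ih x' y' m'
      · apply mul_left_cancel₀ (pow_ne_zero 2 hD0)
        have e1 : D ^ 2 * (e * m' ^ 2) = e * (D * m') ^ 2 := by ring
        rw [e1, ← hm']
        have e2 : D ^ 2 * (x' ^ 2 - D * y' ^ 2) = (D * x') ^ 2 - D * (D * y') ^ 2 := by ring
        rw [e2, ← hx', ← hy']
        linear_combination γ ^ 2 * h
      · intro h1
        apply hmn
        have h2 : γ * m ∈ Q ^ (n + 1 + 1) := by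
          rw [hm', pow_succ']; exact Ideal.mul_mem_mul hD h1
        exact (Ideal.IsPrime.mul_mem_pow Q h2).resolve_left hγ
    · exact base x y m h hmQ

lemma NN1 (D : 𝓞 F) (Q : Ideal (𝓞 F)) [hQ : Q.IsPrime] (hD : D ∈ Q) (hD2 : D ∉ Q ^ 2) (e : 𝓞 F)
    (a b : F) (h : (e : F) = a ^ 2 - D * b ^ 2) : ∃ c, e - c ^ 2 ∈ Q := by
  classical
  obtain ⟨m, hm⟩ := IsLocalization.exist_integer_multiples_of_finset (𝓞 F)⁰ ({a, b} : Finset F)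
  obtain ⟨x, hx⟩ := hm a (by simp)
  obtain ⟨y, hy⟩ := hm b (by simp)
  have hm0 : (m : 𝓞 F) ≠ 0 := nonZeroDivisors.coe_ne_zero m
  have hn : ∃ n, (m : 𝓞 F) ∉ Q ^ (n + 1) := by
    by_contra hcon
    push Not at hcon
    apply hm0
    have := Ideal.iInf_pow_eq_bot_of_isDomain Q hQ.ne_top
    rw [← Ideal.mem_bot, ← this, Ideal.mem_iInf]
    intro n
    exact Ideal.pow_le_pow_right (Nat.le_succ n) (hcon n)
  obtain ⟨n, hn⟩ := hn
  refine NN0 D Q hD hD2 e n x y m ?_ hn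
  apply RingOfIntegers.ext
  simp only [Algebra.smul_def] at hx hy
  simp only [map_mul, map_pow, map_sub]
  have h' : algebraMap (𝓞 F) F e = a ^ 2 - algebraMap (𝓞 F) F D * b ^ 2 := h
  rw [hx, hy, h']; ring
end

namespace QE
variable {F L : Type*} [Field F] [NumberField F] [Field L] [NumberField L] (q : QE F L)

lemma NN (D : 𝓞 F) (hr : q.r ^ 2 = q.f D) (Q : Ideal (𝓞 F)) [hQ : Q.IsPrime] (hD : D ∈ Q)
    (hD2 : D ∉ Q ^ 2) (e : 𝓞 F) (y : L) (h : y * q.s y = q.f e) : ∃ c, e - c ^ 2 ∈ Q := by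
  obtain ⟨a, b, rfl⟩ := q.decomp y
  apply NN1 D Q hD hD2 e a b
  apply q.f.injective
  rw [← h, map_add, map_mul, q.sf, q.sf, q.sr, map_sub, map_mul, map_pow, map_pow, ← hr]
  ring
end QE
end Q2
end

section
open NumberField nonZeroDivisors
namespace Q2
set_option linter.all false

section
variable {F : Type*} [Field F] [NumberField F]

lemma IG_prime_ind (S : Subgroup (IG F))
    (h : ∀ (P : Ideal (𝓞 F)) (hP : P ≠ ⊥), P.IsPrime → ii P hP ∈ S) (a : IG F) : a ∈ S := by
  have hid : ∀ (A : Ideal (𝓞 F)) (hA : A ≠ ⊥), ii A hA ∈ S := by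
    intro A
    induction A using UniqueFactorizationMonoid.induction_on_prime with
    | h₁ => intro hA; exact absurd rfl hA
    | h₂ A hA =>
      intro h0
      have : A = ⊤ := Ideal.isUnit_iff.1 hA
      subst this
      rw [ii_top]; exact S.one_mem
    | h₃ A P hA hP ih =>
      intro h0
      have hA : A ≠ ⊥ := hA
      have hP0 : P ≠ ⊥ := hP.ne_zero
      rw [ii_mul hP0 hA]
      exact S.mul_mem (h P hP0 (Ideal.isPrime_of_prime hP)) (ih hA)
  obtain ⟨n, hn, A, hA, h1⟩ := exists_ii a
  have h2 : dvv F (Units.mk0 (n : F) hn) ∈ S := by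
    have hn' : ((n : 𝓞 F) : F) ≠ 0 := by simpa using hn
    have hn2 : (n : 𝓞 F) ≠ 0 := by intro h; apply hn'; rw [h]; simp
    have := ii_span (n : 𝓞 F) hn2 (by simpa using hn2) hn'
    have e : Units.mk0 (n : F) hn = Units.mk0 ((n : 𝓞 F) : F) hn' := by
      apply Units.ext; simp
    rw [e, ← this]; exact hid _ _
  rw [← Subgroup.mul_mem_cancel_right S h2, h1]
  exact hid _ _

lemma sq_or (Q : Ideal (𝓞 F)) [hQ : Q.IsPrime] (hQ0 : Q ≠ ⊥) (h2 : (2 : 𝓞 F) ∉ Q) (a b : 𝓞 F) :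
    ∃ z, z ^ 2 - a ∈ Q ∨ z ^ 2 - b ∈ Q ∨ z ^ 2 - a * b ∈ Q := by
  have hm : Q.IsMaximal := hQ.isMaximal hQ0
  letI := Ideal.Quotient.field Q
  have : Finite (𝓞 F ⧸ Q) := Ideal.finiteQuotientOfFreeOfNeBot Q hQ0
  letI : Fintype (𝓞 F ⧸ Q) := Fintype.ofFinite _
  classical
  have hch : ringChar (𝓞 F ⧸ Q) ≠ 2 := by
    intro h
    apply h2
    rw [← Ideal.Quotient.eq_zero_iff_mem]
    have := ringChar.Nat.cast_ringChar (R := 𝓞 F ⧸ Q)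
    rw [h] at this
    exact_mod_cast this
  have key : IsSquare (Ideal.Quotient.mk Q a) ∨ IsSquare (Ideal.Quotient.mk Q b) ∨
      IsSquare (Ideal.Quotient.mk Q a * Ideal.Quotient.mk Q b) := by
    by_contra hcon
    push Not at hcon
    obtain ⟨ha, hb, hab⟩ := hcon
    have ha0 : Ideal.Quotient.mk Q a ≠ 0 := fun h => ha (h ▸ ⟨0, by simp⟩)
    have hb0 : Ideal.Quotient.mk Q b ≠ 0 := fun h => hb (h ▸ ⟨0, by simp⟩)
    rw [← quadraticChar_one_iff_isSquare (mul_ne_zero ha0 hb0)] at hab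
    rw [← quadraticChar_neg_one_iff_not_isSquare] at ha hb
    apply hab
    rw [map_mul, ha, hb]; norm_num
  have lift : ∀ c : 𝓞 F, IsSquare (Ideal.Quotient.mk Q c) → ∃ z, z ^ 2 - c ∈ Q := by
    rintro c ⟨y, hy⟩
    obtain ⟨z, rfl⟩ := Ideal.Quotient.mk_surjective y
    refine ⟨z, ?_⟩
    rw [← Ideal.Quotient.eq, map_pow, sq, ← hy]
  rcases key with h | h | h
  · obtain ⟨z, hz⟩ := lift _ h; exact ⟨z, Or.inl hz⟩
  · obtain ⟨z, hz⟩ := lift _ h; exact ⟨z, Or.inr (Or.inl hz)⟩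
  · rw [← map_mul] at h
    obtain ⟨z, hz⟩ := lift _ h; exact ⟨z, Or.inr (Or.inr hz)⟩
end

namespace QE
variable {F L : Type*} [Field F] [NumberField F] [Field L] [NumberField L] (q : QE F L)

lemma comap_ne_bot (P : Ideal (𝓞 L)) (hP : P ≠ ⊥) : P.comap q.of ≠ ⊥ := by
  obtain ⟨C, hC, h⟩ := q.R1 P hP
  intro h0
  apply hC
  rw [← le_bot_iff, ← h0, ← Ideal.map_le_iff_le_comap, ← h]
  exact Ideal.mul_le_left

lemma norm_ideal_le (P : Ideal (𝓞 L)) (hP : P ≠ ⊥) :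
    P * P.map q.os ≤ (P.comap q.of).map q.of := by
  obtain ⟨C, hC, h⟩ := q.R1 P hP
  rw [h]
  apply Ideal.map_mono
  rw [← Ideal.map_le_iff_le_comap, ← h]
  exact Ideal.mul_le_left

lemma os_prime (P : Ideal (𝓞 L)) (hP : P.IsPrime) : (P.map q.os).IsPrime := by
  have : P.map q.os = P.comap q.os := by
    ext x; rw [mem_map_os, Ideal.mem_comap]
  rw [this]; exact Ideal.comap_isPrime _ _

/-- primes with the same restriction are conjugate -/
lemma conj_prime (P Q : Ideal (𝓞 L)) (hP : P.IsPrime) (hQ : Q.IsPrime) (hP0 : P ≠ ⊥)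
    (h : P.comap q.of = Q.comap q.of) : Q = P ∨ Q = P.map q.os := by
  have h1 : P * P.map q.os ≤ Q := (q.norm_ideal_le P hP0).trans (by rw [h]; exact Ideal.map_comap_le)
  have hos := q.os_prime P hP
  rcases (hQ.mul_le).1 h1 with h | h
  · left; exact ((hP.isMaximal hP0).eq_of_le hQ.ne_top h).symm
  · right; exact ((hos.isMaximal (map_ne_bot _ hP0)).eq_of_le hQ.ne_top h).symm

lemma exists_over (b : Ideal (𝓞 F)) [hb : b.IsPrime] (hb0 : b ≠ ⊥) :
    ∃ P : Ideal (𝓞 L), P.IsPrime ∧ P ≠ ⊥ ∧ P.comap q.of = b := by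
  have hbt : b.map q.of ≠ ⊤ := by
    intro h
    letI := q.of.toAlgebra
    have hInt : (algebraMap (𝓞 F) (𝓞 L)).IsIntegral := by
      intro x
      obtain ⟨c1, h1⟩ := q.ofix (x + q.os x) (by rw [map_add, os_os, add_comm])
      obtain ⟨c2, h2⟩ := q.ofix (x * q.os x) (by rw [map_mul, os_os, mul_comm])
      refine ⟨Polynomial.X ^ 2 - Polynomial.C c1 * Polynomial.X + Polynomial.C c2, ?_, ?_⟩
      · monicity!
      · simp only [Polynomial.eval₂_add, Polynomial.eval₂_sub, Polynomial.eval₂_mul, Polynomial.eval₂_pow,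
          Polynomial.eval₂_X, Polynomial.eval₂_C]
        show x ^ 2 - q.of c1 * x + q.of c2 = 0
        rw [h1, h2]; ring
    haveI : Algebra.IsIntegral (𝓞 F) (𝓞 L) := ⟨hInt⟩
    obtain ⟨Q, hQ, hQ2⟩ := Ideal.exists_ideal_over_prime_of_isIntegral b (⊥ : Ideal (𝓞 L)) (by
      intro x hx
      have : q.of x = 0 := hx
      rw [om_inj q.f (this.trans (map_zero _).symm)]; exact b.zero_mem)
    apply hQ2.1.ne_top
    rw [← top_le_iff, ← h, Ideal.map_le_iff_le_comap]
    exact hQ2.2.ge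
  obtain ⟨P, hP, hPb⟩ := Ideal.exists_le_maximal _ hbt
  have hb2 : b = P.comap q.of := (hb.isMaximal hb0).eq_of_le (Ideal.comap_ne_top _ hP.ne_top)
    (Ideal.map_le_iff_le_comap.1 hPb)
  refine ⟨P, hP.isPrime, ?_, hb2.symm⟩
  rintro rfl
  exact map_ne_bot q.f hb0 (le_bot_iff.1 hPb)

/-- splitting trichotomy -/
lemma trich (b : Ideal (𝓞 F)) [hb : b.IsPrime] (hb0 : b ≠ ⊥) :
    ∃ P : Ideal (𝓞 L), P.IsPrime ∧ P ≠ ⊥ ∧ P.comap q.of = b ∧ (b.map q.of = P ∨ b.map q.of = P * P.map q.os) := by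
  obtain ⟨P, hP, hP0, hPb⟩ := q.exists_over b hb0
  refine ⟨P, hP, hP0, hPb, ?_⟩
  have hle : b.map q.of ≤ P := by rw [← hPb]; exact Ideal.map_comap_le
  by_cases hs : P.map q.os = P
  · rcases q.prime_inv P hP0 hs with h | h
    · left; rw [hPb] at h; exact h
    · right; rw [hPb] at h; rw [hs]; exact h.1
  · right
    have hle2 : b.map q.of ≤ P.map q.os := by
      have := Ideal.map_mono (f := q.os) hle
      rw [Ideal.map_map] at this
      have e : (q.os).comp q.of = q.of := RingHom.ext q.os_of
      rwa [e] at this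
    obtain ⟨B, hB⟩ := q.cop_aux _ P (hP.isMaximal hP0) hs hle hle2
    have h1 := q.norm_ideal_le P hP0
    rw [hPb] at h1
    apply le_antisymm _ h1
    rw [hB]; exact Ideal.dvd_iff_le.1 ⟨B, rfl⟩

lemma two_sqrt_aux (P : Ideal (𝓞 L)) (b : Ideal (𝓞 F)) (hP : P.IsPrime) (hPb : b.map q.of = P) (hcm : P.comap q.of = b)
    (z g : 𝓞 F) (hz : z ^ 2 - g ∈ b) (δ : 𝓞 L) (hδ : δ ^ 2 = q.of g) (hs : q.os δ = -δ) : 4 * g ∈ b := by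
  have hst : ∀ x ∈ P, q.os x ∈ P := by
    intro x hx
    rw [← mem_map_os, ← hPb, Ideal.map_map]
    have e : (q.os).comp q.of = q.of := RingHom.ext q.os_of
    rw [e, hPb]; exact hx
  have h1 : (q.of z - δ) * (q.of z + δ) ∈ P := by
    have : (q.of z - δ) * (q.of z + δ) = q.of (z ^ 2 - g) := by
      rw [map_sub, map_pow, ← hδ]; ring
    rw [this, ← hPb]; exact Ideal.mem_map_of_mem _ hz
  have h2 : 2 * δ ∈ P := by
    rcases hP.mem_or_mem h1 with h | h
    · have h' := hst _ h
      rw [map_sub, hs, os_of] at h'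
      have := P.sub_mem h' h
      convert this using 1; ring
    · have h' := hst _ h
      rw [map_add, hs, os_of] at h'
      have := P.sub_mem h h'
      convert this using 1; ring
  rw [← hcm, Ideal.mem_comap, map_mul, ← hδ, map_ofNat]
  have := P.mul_mem_left (2 * δ) h2
  convert this using 1; ring

/-- in a biquadratic tower no prime is inert throughout -/
lemma tower {k K L : Type*} [Field k] [NumberField k] [Field K] [NumberField K] [Field L] [NumberField L]
    (q1 : QE k K) (q2 : QE K L) (α β : 𝓞 k) (δ1 : 𝓞 K) (δ2 : 𝓞 L) (h1 : δ1 ^ 2 = q1.of α) (h2 : δ2 ^ 2 = q2.of (q1.of β))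
    (s1 : q1.os δ1 = -δ1) (s2 : q2.os δ2 = -δ2) (b : Ideal (𝓞 k)) [hb : b.IsPrime] (hb0 : b ≠ ⊥)
    (hn : 4 * α * β ∉ b) :
    (∃ P : Ideal (𝓞 K), P ≠ ⊥ ∧ b.map q1.of = P * P.map q1.os) ∨
    (∃ Q : Ideal (𝓞 L), Q ≠ ⊥ ∧ (b.map q1.of).map q2.of = Q * Q.map q2.os) := by
  obtain ⟨P, hP, hP0, hPb, h | h⟩ := q1.trich b hb0
  swap
  · exact Or.inl ⟨P, hP0, h⟩
  obtain ⟨Q, hQ, hQ0, hQb, h' | h'⟩ := q2.trich P hP0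
  swap
  · right; rw [h]; exact ⟨Q, hQ0, h'⟩
  exfalso
  have h4 : (2 : 𝓞 k) ∉ b := fun h => hn (by
    have : 4 * α * β = (2 * α * β) * 2 := by ring
    rw [this]; exact b.mul_mem_left _ h)
  obtain ⟨z, hz | hz | hz⟩ := sq_or b hb0 h4 α β
  · have := q1.two_sqrt_aux P b hP h hPb z α hz δ1 h1 s1
    exact hn (b.mul_mem_right _ this)
  · have := q2.two_sqrt_aux Q P hQ h' hQb (q1.of z) (q1.of β) (by
      rw [← map_pow, ← map_sub, ← h]; exact Ideal.mem_map_of_mem _ hz) δ2 h2 s2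
    have h5 : 4 * β ∈ b := by
      rw [← hPb, Ideal.mem_comap, map_mul, map_ofNat]; exact this
    apply hn
    have : 4 * α * β = α * (4 * β) := by ring
    rw [this]; exact b.mul_mem_left _ h5
  · have := q2.two_sqrt_aux Q P hQ h' hQb (q1.of z) (q1.of (α * β)) (by
      rw [← map_pow, ← map_sub, ← h]; exact Ideal.mem_map_of_mem _ hz) (q2.of δ1 * δ2) (by
      rw [mul_pow, h2, ← map_pow, h1, map_mul, map_mul]) (by rw [map_mul, s2, os_of]; ring)
    have h5 : 4 * (α * β) ∈ b := by
      rw [← hPb, Ideal.mem_comap, map_mul, map_ofNat]; exact this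
    apply hn
    rw [mul_assoc]; exact h5
end QE
end Q2
end

section
open NumberField nonZeroDivisors
namespace Q2
set_option linter.all false

lemma int_quad {L : Type*} [Field L] (x : L) (a b : ℤ) (h : x ^ 2 = a * x + b) : IsIntegral ℤ x := by
  refine ⟨Polynomial.X ^ 2 - (Polynomial.C a * Polynomial.X + Polynomial.C b), ?_, ?_⟩
  · apply Polynomial.monic_X_pow_sub
    refine lt_of_le_of_lt (b := 1) ?_ (by norm_num)
    compute_degree
  · rw [Polynomial.eval₂_sub, Polynomial.eval₂_add, Polynomial.eval₂_mul, Polynomial.eval₂_C, Polynomial.eval₂_C]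
    simp [h]

lemma hQ1 : Nat.card (ClassGroup (𝓞 ℚ)) = 1 := by
  have := Rat.classNumber_eq
  rw [NumberField.classNumber] at this
  rw [Nat.card_eq_fintype_card, this]

lemma OQ_int (x : 𝓞 ℚ) : ∃ n : ℤ, x = n := by
  refine ⟨Rat.ringOfIntegersEquiv x, ?_⟩
  apply Rat.ringOfIntegersEquiv.injective
  simp

section
variable {L : Type*} [Field L] [NumberField L]

lemma int_mem (I : Ideal (𝓞 L)) {x y : 𝓞 L} (n : ℤ) (h : y = n * x) (hx : x ∈ I) : y ∈ I := by
  rw [h]; exact I.mul_mem_left _ hx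

lemma not_cop (P : Ideal (𝓞 L)) (hP : P ≠ ⊤) (m n : ℤ) (h : IsCoprime m n) (hm : (m : 𝓞 L) ∈ P) (hn : (n : 𝓞 L) ∈ P) : False := by
  obtain ⟨a, b, hab⟩ := h
  apply hP
  rw [Ideal.eq_top_iff_one]
  have : (1 : 𝓞 L) = a * m + b * n := by exact_mod_cast hab.symm
  rw [this]
  exact P.add_mem (P.mul_mem_left _ hm) (P.mul_mem_left _ hn)

lemma int_dvd_of_mem (P : Ideal (𝓞 L)) (hP : P ≠ ⊤) (p : ℕ) (hp : p.Prime) (h : (p : 𝓞 L) ∈ P) (n : ℤ)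
    (hn : (n : 𝓞 L) ∈ P) : (p : ℤ) ∣ n := by
  by_contra hc
  exact not_cop P hP p n ((Nat.prime_iff_prime_int.mp hp).coprime_iff_not_dvd.mpr hc) (by exact_mod_cast h) hn

end

lemma OQ_prime (P : Ideal (𝓞 ℚ)) (hP : P ≠ ⊤) (p : ℕ) (hp : p.Prime) (h : (p : 𝓞 ℚ) ∈ P) : P = Ideal.span {(p : 𝓞 ℚ)} := by
  apply le_antisymm
  · intro x hx
    obtain ⟨n, rfl⟩ := OQ_int x
    obtain ⟨k, rfl⟩ := int_dvd_of_mem P hP p hp h n hx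
    rw [Ideal.mem_span_singleton]
    exact ⟨k, by push_cast; ring⟩
  · rw [Ideal.span_singleton_le_iff_mem]; exact h

namespace QE
section
variable {F L : Type*} [Field F] [NumberField F] [Field L] [NumberField L] (q : QE F L)

lemma of_int (n : ℤ) : q.of (n : 𝓞 F) = n := map_intCast _ _
lemma of_val (x : 𝓞 F) : ((q.of x : 𝓞 L) : L) = q.f x := rfl
lemma os_val (x : 𝓞 L) : ((q.os x : 𝓞 L) : L) = q.s x := rfl

lemma theta (m : ℤ) (D : ℤ) (hD : D = 4 * m + 1) (x : 𝓞 L) (hx : x ^ 2 = D) (hs : q.os x = -x) :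
    ∃ θ : 𝓞 L, 2 * θ = 1 + x ∧ θ - q.os θ = x := by
  have h2 : (2 : L) ≠ 0 := two_ne_zero
  have hx' : (x : L) ^ 2 = D := by
    have := congrArg (fun z : 𝓞 L => (z : L)) hx
    simpa using this
  have hs' : q.s (x : L) = - x := by
    have := congrArg (fun z : 𝓞 L => (z : L)) hs
    simpa using this
  have hi : IsIntegral ℤ ((1 + (x : L)) / 2) := by
    apply int_quad _ 1 m
    field_simp
    rw [hD] at hx'
    push_cast at hx' ⊢
    linear_combination hx'
  refine ⟨⟨_, hi⟩, ?_, ?_⟩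
  · apply RingOfIntegers.ext
    show 2 * ((1 + (x : L)) / 2) = 1 + x
    field_simp
  · apply RingOfIntegers.ext
    show ((1 + (x : L)) / 2) - q.s ((1 + (x : L)) / 2) = x
    rw [map_div₀, map_add, hs']
    simp only [map_one, map_ofNat]
    field_simp; ring

end

section
variable {k : Type*} [Field k] [NumberField k] (q : QE ℚ k)

lemma of_surj_int (x : 𝓞 k) (h : q.os x = x) : ∃ n : ℤ, x = n := by
  obtain ⟨y, hy⟩ := q.ofix x h
  obtain ⟨n, rfl⟩ := OQ_int y
  exact ⟨n, by rw [← hy, q.of_int]⟩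

lemma tr_int (x : 𝓞 k) : ∃ n : ℤ, x + q.os x = n :=
  q.of_surj_int _ (by rw [map_add, q.os_os, add_comm])
lemma nm_int (x : 𝓞 k) : ∃ n : ℤ, x * q.os x = n :=
  q.of_surj_int _ (by rw [map_mul, q.os_os, mul_comm])

lemma sqf_int (D : ℤ) (hD : Squarefree D) (b : ℚ) (m : ℤ) (h : b ^ 2 * D = m) : ∃ n : ℤ, b = n := by
  have hb : (b.num : ℚ) / b.den = b := Rat.num_div_den b
  have hd : (b.den : ℚ) ≠ 0 := by exact_mod_cast b.den_ne_zero
  have h1 : (b.num : ℚ) ^ 2 * D = m * b.den ^ 2 := by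
    rw [← hb] at h; field_simp at h; linarith
  have h2 : b.num ^ 2 * D = m * (b.den : ℤ) ^ 2 := by exact_mod_cast h1
  have hc : IsCoprime ((b.den : ℤ) ^ 2) (b.num ^ 2) := by
    apply IsCoprime.pow
    rw [Int.isCoprime_iff_gcd_eq_one]
    have := b.reduced
    rw [Int.gcd, Nat.gcd_comm]; simpa using this
  have h3 : (b.den : ℤ) ^ 2 ∣ D := hc.dvd_of_dvd_mul_left ⟨m, by rw [h2]; ring⟩
  have h4 : IsUnit (b.den : ℤ) := hD _ (by rw [← sq]; exact h3)
  have h5 : b.den = 1 := by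
    rw [Int.isUnit_iff] at h4; omega
  exact ⟨b.num, by rw [← hb, h5]; simp⟩

lemma qint (ρ : 𝓞 k) (hρ : (ρ : k) = q.r) (D : ℤ) (hD : ρ ^ 2 = D) (hsf : Squarefree D) (y : 𝓞 k) :
    ∃ a b n : ℤ, 2 * y = a + b * ρ ∧ 2 * q.os y = a - b * ρ ∧ y * q.os y = n ∧ 4 * n = a ^ 2 - D * b ^ 2 := by
  obtain ⟨a, ha⟩ := q.tr_int y
  obtain ⟨n, hn⟩ := q.nm_int y
  obtain ⟨c, b, hcb⟩ := q.decomp (y - q.os y : 𝓞 k)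
  have hs : q.s ((y - q.os y : 𝓞 k) : k) = - ((y - q.os y : 𝓞 k) : k) := by
    rw [← q.os_val, map_sub, q.os_os]; push_cast; ring
  have hc0 : c = 0 := by
    have h1 : q.f c + q.f b * q.r = 0 + q.f b * q.r := by
      have h2 := hs
      rw [hcb, map_add, map_mul, q.sf, q.sf, q.sr] at h2
      have h3 : (2 : k) ≠ 0 := two_ne_zero
      have : 2 * q.f c = 0 := by linear_combination h2
      have := (mul_eq_zero.mp this).resolve_left h3
      rw [this]
    have h4 : q.f c = 0 := by linear_combination h1
    exact (map_eq_zero q.f).1 h4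
  rw [hc0, map_zero, zero_add] at hcb
  have hD' : (q.r) ^ 2 = (D : k) := by
    have := congrArg (fun z : 𝓞 k => (z : k)) hD
    rw [← hρ]; simpa using this
  have hm : ((y - q.os y : 𝓞 k) : k) ^ 2 = ((a ^ 2 - 4 * n : ℤ) : k) := by
    have : (y - q.os y) ^ 2 = ((a ^ 2 - 4 * n : ℤ) : 𝓞 k) := by
      push_cast; rw [← ha, ← hn]; ring
    have := congrArg (algebraMap (𝓞 k) k) this
    rw [map_pow, map_intCast] at this
    exact this
  have hbQ : b ^ 2 * D = ((a ^ 2 - 4 * n : ℤ) : ℚ) := by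
    apply q.f.injective
    rw [map_intCast, ← hm, hcb, map_mul, map_pow, map_intCast, mul_pow, hD']
  obtain ⟨b', rfl⟩ := sqf_int D hsf b _ hbQ
  have hy : y - q.os y = b' * ρ := by
    apply RingOfIntegers.ext
    rw [hcb]
    show _ = algebraMap (𝓞 k) k (b' * ρ)
    rw [map_mul, map_intCast, map_intCast, ← hρ]
  refine ⟨a, b', n, by linear_combination ha + hy, by linear_combination ha - hy, hn, ?_⟩
  have : b' ^ 2 * D = a ^ 2 - 4 * n := by exact_mod_cast hbQ
  linarith

end

section
variable {F L : Type*} [Field F] [NumberField F] [Field L] [NumberField L] (q : QE F L)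
variable [IsTotallyReal F] [IsTotallyReal L]

lemma neg_one_norm (h1 : Nat.card (ClassGroup (𝓞 F)) = 1) (h : q.J.relIndex (Fx q.ti) ∣ 2) :
    ∃ u : (𝓞 L)ˣ, (u : 𝓞 L) * q.os u = -1 := by
  have hc := q.card_F
  rw [h1, Subgroup.relIndex_eq_one] at hc
  have hJ : (Fx q.su).map (dvv L) = q.J := le_antisymm q.P0_le hc
  have hH := q.H1
  have hle : q.J ≤ (dvv L).range ⊓ Fx q.ti := by
    apply le_inf
    · rw [← hJ]; rintro _ ⟨x, -, rfl⟩; exact ⟨x, rfl⟩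
    · exact q.J_le
  have hm := Subgroup.relIndex_mul_relIndex _ _ _ hle inf_le_right
  rw [hJ] at hH
  have h2 : 2 * ((dvv L).ker.map (Nh q.su)).relIndex ((dvv L).ker ⊓ Fx q.su) ∣ 2 := by
    rw [← hH]; exact (Dvd.intro _ hm).trans h
  have h3 : ((dvv L).ker.map (Nh q.su)).relIndex ((dvv L).ker ⊓ Fx q.su) = 1 := by
    have := Nat.le_of_dvd (by norm_num) h2
    have h0 : 2 * ((dvv L).ker.map (Nh q.su)).relIndex ((dvv L).ker ⊓ Fx q.su) ≠ 0 := fun h0 => by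
      rw [h0] at h2; simp at h2
    omega
  rw [Subgroup.relIndex_eq_one] at h3
  have h4 : (-1 : Lˣ) ∈ (dvv L).ker ⊓ Fx q.su := by
    refine ⟨?_, ?_⟩
    · show (-1 : Lˣ) ∈ (dvv L).ker
      rw [mem_ker_dvv]; exact ⟨-1, by simp⟩
    · show (-1 : Lˣ) ∈ Fx q.su
      rw [mem_Fx]; apply Units.ext
      show q.s ((-1 : Lˣ) : L) = _
      simp
  obtain ⟨x, hx, hxe⟩ := h3 h4
  obtain ⟨u, hu⟩ := (mem_ker_dvv x).1 hx
  refine ⟨u, ?_⟩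
  apply RingOfIntegers.ext
  have := congrArg (fun z : Lˣ => (z : L)) hxe
  have h5 : (x : L) * q.s x = -1 := by simpa [Nh_apply] using this
  show algebraMap (𝓞 L) L (u * q.os u) = algebraMap (𝓞 L) L (-1)
  rw [map_mul, map_neg, map_one]
  show ((u : 𝓞 L) : L) * q.s ((u : 𝓞 L) : L) = -1
  rw [hu, h5]
end

section
variable {k : Type*} [Field k] [NumberField k] [IsTotallyReal k] (q : QE ℚ k)

lemma ramQ (ρ : 𝓞 k) (D : ℤ) (hD : ρ ^ 2 = D) (hs : q.os ρ = -ρ) (m : ℤ) (hm : D = 4 * m + 1)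
    (P : Ideal (𝓞 k)) (hP : ∀ θ, θ - q.os θ ∈ P) : (D : 𝓞 k) ∈ P := by
  obtain ⟨θ, -, h⟩ := q.theta m D hm ρ hD hs
  have := hP θ
  rw [h] at this
  rw [← hD, sq]; exact P.mul_mem_left _ this

lemma QB (p : ℕ) (hp : p.Prime) (hp4 : p % 4 = 1) (ρ : 𝓞 k) (hρ : ρ ^ 2 = (p : 𝓞 k)) (hs : q.os ρ = -ρ) :
    Odd (Nat.card (ClassGroup (𝓞 k))) ∧ ∃ u : (𝓞 k)ˣ, (u : 𝓞 k) * q.os u = -1 := by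
  have hb : q.J.relIndex (Fx q.ti) ∣ 2 ^ (0 + 1) := by
    have := q.ram_bound {Ideal.span {(p : 𝓞 ℚ)}} (by
      intro P hP hP0 hPs hθ
      rw [Finset.mem_singleton]
      apply OQ_prime _ (Ideal.IsPrime.ne_top (hP.comap _)) p hp
      rw [Ideal.mem_comap, map_natCast]
      have := q.ramQ ρ p (by push_cast; exact hρ) hs (p / 4) (by omega) P hθ
      exact_mod_cast this)
    simpa using this
  constructor
  · apply q.amb_odd
    have := q.amb_ram hb
    rw [hQ1] at this
    have : q.amb = 1 := by simpa using this
    rw [this]; exact odd_one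
  · exact q.neg_one_norm hQ1 (by simpa using hb)

lemma Qk1 (p d : ℕ) (hp : p.Prime) (hd : d.Prime) (hp4 : p % 4 = 1) (hd4 : d % 4 = 1) (ρ : 𝓞 k) (hρ : ρ ^ 2 = (p * d : 𝓞 k)) (hs : q.os ρ = -ρ) :
    (dvv k).range.relIndex ((dvv k).range.comap (sqh (IG k))) ∣ 2 := by
  classical
  have hb : q.J.relIndex (Fx q.ti) ∣ 2 ^ (1 + 1) := by
    have := q.ram_bound {Ideal.span {(p : 𝓞 ℚ)}, Ideal.span {(d : 𝓞 ℚ)}} (by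
      intro P hP hP0 hPs hθ
      rw [Finset.mem_insert, Finset.mem_singleton]
      have h4 : (p * d) % 4 = 1 := by rw [Nat.mul_mod, hp4, hd4]
      have := q.ramQ ρ ((p * d : ℕ) : ℤ) (by push_cast; exact hρ) hs ((p * d / 4 : ℕ) : ℤ) (by omega) P hθ
      push_cast at this
      rcases hP.mem_or_mem this with h | h
      · left
        apply OQ_prime _ (Ideal.IsPrime.ne_top (hP.comap _)) p hp
        rw [Ideal.mem_comap, map_natCast]; exact h
      · right
        apply OQ_prime _ (Ideal.IsPrime.ne_top (hP.comap _)) d hd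
        rw [Ideal.mem_comap, map_natCast]; exact h)
    exact this.trans (pow_dvd_pow _ Finset.card_le_two)
  have := q.amb_ram hb
  rw [hQ1, amb, q.amb_one hQ1] at this
  simpa using this
end
end QE
end Q2
end

section
open NumberField nonZeroDivisors
namespace Q2
set_option linter.all false
open scoped NumberTheorySymbols

lemma j_two_one (n : ℕ) (h : n % 8 = 1) : J(2 | n) = 1 := by
  rw [jacobiSym.at_two (Nat.odd_iff.2 (by omega)), ZMod.χ₈_nat_eq_if_mod_eight]
  simp [h]; omega

lemma j_two_five (n : ℕ) (h : n % 8 = 5) : J(2 | n) = -1 := by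
  rw [jacobiSym.at_two (Nat.odd_iff.2 (by omega)), ZMod.χ₈_nat_eq_if_mod_eight]
  simp [h]; omega

lemma j_rec (n : ℕ) (hn : n % 4 = 1) (x : ℤ) (hx : x ≠ 0) :
    ∃ e y : ℕ, Odd y ∧ x.natAbs = 2 ^ e * y ∧ J(x | n) = J(2 | n) ^ e * J(n | y) := by
  obtain ⟨e, y, hy, hxy⟩ := Nat.exists_eq_two_pow_mul_odd (n := x.natAbs) (by simpa using hx)
  refine ⟨e, y, hy, hxy, ?_⟩
  have ho : Odd n := Nat.odd_iff.2 (by omega)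
  have h1 : J(x | n) = J((x.natAbs : ℤ) | n) := by
    rcases Int.natAbs_eq x with h | h
    · rw [← h]
    · conv_lhs => rw [h]
      rw [← neg_one_mul, jacobiSym.mul_left, jacobiSym.at_neg_one ho, ZMod.χ₄_nat_one_mod_four hn, one_mul]
  rw [h1, hxy]
  push_cast
  rw [jacobiSym.mul_left, jacobiSym.pow_left, jacobiSym.quadratic_reciprocity_one_mod_four hn hy]

lemma pow_odd_eq {m : ℕ} (hm : Odd m) {x : ℤ} (hx : x = 0 ∨ x = 1 ∨ x = -1) : x ^ m = x := by
  rcases hx with rfl | rfl | rfl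
  · exact zero_pow (by rintro rfl; simp at hm)
  · simp
  · exact hm.neg_one_pow

lemma d_pow_mod8 (d m : ℕ) (hd : d % 2 = 1) (hm : Odd m) : (d : ℤ) ^ m % 8 = d % 8 := by
  obtain ⟨k, rfl⟩ := hm
  have h : (d : ℤ) ^ 2 % 8 = 1 := by
    have : (d : ℤ) % 8 = 1 ∨ (d : ℤ) % 8 = 3 ∨ (d : ℤ) % 8 = 5 ∨ (d : ℤ) % 8 = 7 := by omega
    rcases this with h | h | h | h <;> simp [pow_two, Int.mul_emod, h]
  rw [pow_succ, pow_mul, Int.mul_emod]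
  have : ((d : ℤ) ^ 2) ^ k % 8 = 1 := by
    have h3 : (d : ℤ) ^ 2 ≡ 1 [ZMOD 8] := h
    have := h3.pow k
    rw [one_pow] at this
    exact this
  rw [this]; simp

/-- x even of exact power -/
lemma sq_mod8 (x : ℤ) (e y : ℕ) (hy : Odd y) (h : x.natAbs = 2 ^ e * y) :
    (e = 0 → x ^ 2 % 8 = 1) ∧ (e = 1 → x ^ 2 % 8 = 4) ∧ (2 ≤ e → x ^ 2 % 8 = 0) := by
  have h1 : x ^ 2 = (2 ^ e * (y : ℤ)) ^ 2 := by
    rw [← Int.natAbs_sq, h]; push_cast; ring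
  have hy2 : (y : ℤ) ^ 2 % 8 = 1 := by
    obtain ⟨k, rfl⟩ := hy
    have : (2 * k + 1) % 8 = 1 ∨ (2 * k + 1) % 8 = 3 ∨ (2 * k + 1) % 8 = 5 ∨ (2 * k + 1) % 8 = 7 := by omega
    have h2 : (2 * k + 1) ^ 2 % 8 = 1 := by
      rcases this with h | h | h | h <;> simp [pow_two, Nat.mul_mod, h]
    exact_mod_cast h2
  refine ⟨?_, ?_, ?_⟩
  · rintro rfl; rw [h1]; simpa using hy2
  · rintro rfl; rw [h1, mul_pow]; omega
  · intro h2
    obtain ⟨k, rfl⟩ := Nat.exists_eq_add_of_le h2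
    rw [h1]
    have : (2 ^ (2 + k) * (y : ℤ)) ^ 2 = 8 * (2 * (2 ^ k * y) ^ 2) := by ring
    rw [this]; simp

lemma legendre_jac (p : ℕ) (hp : p.Prime) (hp2 : 2 < p) (a : ℤ) : ((J(a | p) : ℤ) : ZMod p) = (a : ZMod p) ^ ((p - 1) / 2) := by
  haveI := Fact.mk hp
  rw [← jacobiSym.legendreSym.to_jacobiSym, legendreSym.eq_pow]
  rcases hp.eq_two_or_odd with h | h
  · omega
  · congr 1; omega

lemma cast_pm (p : ℕ) (hp : 2 < p) (x y : ℤ) (hx : x = 1 ∨ x = -1) (hy : y = 1 ∨ y = -1) (h : (x : ZMod p) = y) : x = y := by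
  rw [ZMod.intCast_eq_intCast_iff_dvd_sub] at h
  rcases hx with rfl | rfl <;> rcases hy with rfl | rfl <;> first | rfl | (exfalso; norm_num at h; have := Int.le_of_dvd (by norm_num) h; omega)

lemma qs (n a : ℕ) (hn : 2 < n) (s : ℤ) (hs : s = 1 ∨ s = -1) (h : (a : ZMod n) ^ ((n - 1) / 4) = (s : ZMod n)) :
    quarticSym n a = s := by
  unfold quarticSym
  rw [h]
  split_ifs with h1
  · exact (cast_pm n hn s 1 hs (Or.inl rfl) (by simpa using h1)).symm
  · rcases hs with rfl | rfl
    · simp at h1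
    · rfl

lemma gcd_one (d : ℕ) (hd : d.Prime) (m : ℕ) (x y : ℤ) (n : ℤ) (hy : ¬ (d : ℤ) ∣ y)
    (h : ∀ ℓ : ℤ, Prime ℓ → ℓ ∣ x → ℓ ∣ n → ℓ ∣ d ^ m) (hn : n ∣ y) : x.gcd n = 1 := by
  by_contra hc
  obtain ⟨ℓ, hℓ, h1⟩ := Nat.exists_prime_and_dvd hc
  have h2 : (ℓ : ℤ) ∣ x.gcd n := by exact_mod_cast h1
  have h3 := h2.trans (Int.gcd_dvd_left ..)
  have h4 := h2.trans (Int.gcd_dvd_right ..)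
  have h5 := (Nat.prime_iff_prime_int.1 hℓ).dvd_of_dvd_pow (h _ (Nat.prime_iff_prime_int.1 hℓ) h3 h4)
  have h6 : ℓ = d := (Nat.prime_dvd_prime_iff_eq hℓ hd).1 (by exact_mod_cast h5)
  subst h6
  exact hy (h4.trans hn)

theorem scholz (p d : ℕ) (hp : p.Prime) (hd : d.Prime) (hpd : p ≠ d) (hp4 : p % 4 = 1) (hd4 : d % 4 = 1)
    (m : ℕ) (hm : Odd m) (z w z1 w1 : ℤ) (h : z ^ 2 - p * w ^ 2 = d ^ m) (h1 : z1 ^ 2 - p * w1 ^ 2 = - d ^ m)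
    (hw : ¬ (d : ℤ) ∣ w) (hw1 : ¬ (d : ℤ) ∣ w1) (hww : J(w * w1 | d) = 1) : quarticSym d p = quarticSym p d := by
  haveI := Fact.mk hp
  haveI := Fact.mk hd
  have hp2 : 2 < p := by have := hp.two_le; omega
  have hd2 : 2 < d := by have := hd.two_le; omega
  have hdi := Nat.prime_iff_prime_int.1 hd
  have hpi := Nat.prime_iff_prime_int.1 hp
  have hm0 : m ≠ 0 := by rintro rfl; simp at hm
  have hd8 := d_pow_mod8 d m (by omega) hm
  have hw0 : w ≠ 0 := by rintro rfl; simp at hw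
  have hpnd : ¬ (d : ℤ) ∣ p := fun hh => hpd ((Nat.prime_dvd_prime_iff_eq hd hp).1 (by exact_mod_cast hh)).symm
  have hdnp : ¬ (p : ℤ) ∣ d := fun hh => hpd ((Nat.prime_dvd_prime_iff_eq hp hd).1 (by exact_mod_cast hh))
  have hddm : (d : ℤ) ∣ d ^ m := dvd_pow_self _ hm0
  have hdz1 : ¬ (d : ℤ) ∣ z1 := by
    intro hh
    have : (d : ℤ) ∣ p * w1 ^ 2 := by
      have e : (p : ℤ) * w1 ^ 2 = z1 * z1 + d ^ m := by linear_combination -h1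
      rw [e]; exact dvd_add (hh.mul_right _) hddm
    rcases hdi.dvd_or_dvd this with h2 | h2
    · exact hpnd h2
    · exact hw1 (hdi.dvd_of_dvd_pow h2)
  have hpz1 : ¬ (p : ℤ) ∣ z1 := by
    intro hh
    have : (p : ℤ) ∣ d ^ m := by
      have e : (d : ℤ) ^ m = p * w1 ^ 2 - z1 * z1 := by linear_combination h1
      rw [e]; exact dvd_sub (Dvd.intro _ rfl) (hh.mul_right _)
    exact hdnp (hpi.dvd_of_dvd_pow this)
  have hz10 : z1 ≠ 0 := by rintro rfl; simp at hdz1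
  -- (w/d) = (2/d)
  have A : J(w | d) = J(2 | d) := by
    obtain ⟨e, y, hy, hxy, hj⟩ := j_rec d hd4 w hw0
    have hyw : (y : ℤ) ∣ w := by
      rw [← Int.dvd_natAbs, hxy]; push_cast; exact Dvd.intro_left _ rfl
    have hg : z.gcd y = 1 := gcd_one d hd m z w y hw (by
      intro ℓ hℓ a b
      rw [← h]
      exact dvd_sub (dvd_pow a (by norm_num)) ((dvd_pow (b.trans hyw) (by norm_num)).mul_left _)) hyw
    have h3 : J(d | y) = 1 := by
      rw [← pow_odd_eq hm (jacobiSym.trichotomy (d : ℤ) y), ← jacobiSym.pow_left, ← jacobiSym.sq_one' hg]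
      apply jacobiSym.mod_left'
      rw [← h]
      apply Int.ModEq.symm
      rw [Int.modEq_iff_dvd]
      have : (y : ℤ) ∣ p * w ^ 2 := (dvd_pow hyw (by norm_num)).mul_left _
      have e : z ^ 2 - p * w ^ 2 - z ^ 2 = - (p * w ^ 2) := by ring
      rw [e]; exact (dvd_neg).2 this
    rw [hj, h3, mul_one]
    rcases (by omega : d % 8 = 1 ∨ d % 8 = 5) with h8 | h8
    · rw [j_two_one d h8, one_pow]
    · obtain ⟨s0, s1, s2⟩ := sq_mod8 w e y hy hxy
      have he : e = 1 := by
        have hz := Int.emod_emod_of_dvd (z^2) (by norm_num : (4 : ℤ) ∣ 8)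
        have hzm : z ^ 2 % 8 = 0 ∨ z ^ 2 % 8 = 1 ∨ z ^ 2 % 8 = 4 := by
          have : z % 8 = 0 ∨ z % 8 = 1 ∨ z % 8 = 2 ∨ z % 8 = 3 ∨ z % 8 = 4 ∨ z % 8 = 5 ∨ z % 8 = 6 ∨ z % 8 = 7 := by omega
          rcases this with h | h | h | h | h | h | h | h <;> simp [pow_two, Int.mul_emod, h]
        have hpw : ((p : ℤ) * w ^ 2) % 8 = ((p : ℤ) % 8 * (w ^ 2 % 8)) % 8 := Int.mul_emod _ _ _
        have hp8 : (p : ℤ) % 8 = 1 ∨ (p : ℤ) % 8 = 5 := by omega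
        rcases (by omega : e = 0 ∨ e = 1 ∨ 2 ≤ e) with h' | h' | h'
        · rw [s0 h'] at hpw
          rcases hp8 with h9 | h9 <;> rw [h9] at hpw <;> omega
        · exact h'
        · rw [s2 h'] at hpw
          rcases hp8 with h9 | h9 <;> rw [h9] at hpw <;> omega
      rw [he, pow_one]
  -- (z1 / pd) = (2/pd)
  have hpd4 : (p * d) % 4 = 1 := by rw [Nat.mul_mod, hp4, hd4]
  have B : J(z1 | p * d) = J(2 | p * d) := by
    obtain ⟨e, y, hy, hxy, hj⟩ := j_rec (p * d) hpd4 z1 hz10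
    have hyw : (y : ℤ) ∣ z1 := by
      rw [← Int.dvd_natAbs, hxy]; push_cast; exact Dvd.intro_left _ rfl
    have hg : w1.gcd y = 1 := gcd_one d hd m w1 z1 y hdz1 (by
      intro ℓ hℓ a b
      have : (d : ℤ) ^ m = p * w1 ^ 2 - z1 ^ 2 := by linear_combination h1
      rw [this]
      exact dvd_sub ((dvd_pow a (by norm_num)).mul_left _) (dvd_pow (b.trans hyw) (by norm_num))) hyw
    have hgd : (d : ℤ).gcd y = 1 := gcd_one d hd 1 d z1 y hdz1 (by
      intro ℓ hℓ a b; simpa using a) hyw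
    have h4 : J(p | y) = J(d | y) := by
      rw [← pow_odd_eq hm (jacobiSym.trichotomy (d : ℤ) y), ← jacobiSym.pow_left]
      have : J(p | y) = J(p * w1 ^ 2 | y) := by rw [jacobiSym.mul_left, jacobiSym.sq_one' hg, mul_one]
      rw [this]
      apply jacobiSym.mod_left'
      apply Int.ModEq.symm
      show _ ≡ _ [ZMOD _]
      rw [Int.modEq_iff_dvd]
      have e : (p : ℤ) * w1 ^ 2 - d ^ m = z1 ^ 2 := by linear_combination -h1
      rw [e]; exact dvd_pow hyw (by norm_num)
    have h3 : J((p * d : ℕ) | y) = 1 := by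
      push_cast
      rw [jacobiSym.mul_left, h4, ← sq, jacobiSym.sq_one hgd]
    rw [hj, h3, mul_one]
    rcases (by omega : p * d % 8 = 1 ∨ p * d % 8 = 5) with h8 | h8
    · rw [j_two_one _ h8, one_pow]
    · obtain ⟨s0, s1, s2⟩ := sq_mod8 z1 e y hy hxy
      have he : e = 1 := by
        have hzm : w1 ^ 2 % 8 = 0 ∨ w1 ^ 2 % 8 = 1 ∨ w1 ^ 2 % 8 = 4 := by
          have : w1 % 8 = 0 ∨ w1 % 8 = 1 ∨ w1 % 8 = 2 ∨ w1 % 8 = 3 ∨ w1 % 8 = 4 ∨ w1 % 8 = 5 ∨ w1 % 8 = 6 ∨ w1 % 8 = 7 := by omega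
          rcases this with h | h | h | h | h | h | h | h <;> simp [pow_two, Int.mul_emod, h]
        have hpw : ((p : ℤ) * w1 ^ 2) % 8 = ((p : ℤ) % 8 * (w1 ^ 2 % 8)) % 8 := Int.mul_emod _ _ _
        have hpd8 : (p * d) % 8 = ((p % 8) * (d % 8)) % 8 := Nat.mul_mod _ _ _
        have hp8 : p % 8 = 1 ∨ p % 8 = 5 := by omega
        have hd8' : d % 8 = 1 ∨ d % 8 = 5 := by omega
        rcases (by omega : e = 0 ∨ e = 1 ∨ 2 ≤ e) with h' | h' | h'
        · have := s0 h'
          rcases hp8 with h9 | h9 <;> rcases hd8' with h10 | h10 <;> rw [h9, h10] at hpd8 <;> rcases hzm with h11 | h11 | h11 <;>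
            rw [h11, show (p : ℤ) % 8 = ((p % 8 : ℕ) : ℤ) by push_cast; rfl, h9] at hpw <;> push_cast at hpw <;> omega
        · exact h'
        · have := s2 h'
          rcases hp8 with h9 | h9 <;> rcases hd8' with h10 | h10 <;> rw [h9, h10] at hpd8 <;> rcases hzm with h11 | h11 | h11 <;>
            rw [h11, show (p : ℤ) % 8 = ((p % 8 : ℕ) : ℤ) by push_cast; rfl, h9] at hpw <;> push_cast at hpw <;> omega
      rw [he, pow_one]
  rw [jacobiSym.mul_right, jacobiSym.mul_right] at B
  rw [jacobiSym.mul_left] at hww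
  have pm : ∀ (x : ℤ) (n : ℕ), n.Prime → ¬ (n : ℤ) ∣ x → J(x | n) = 1 ∨ J(x | n) = -1 := by
    intro x n hn hx
    apply jacobiSym.eq_one_or_neg_one
    rw [Int.gcd_comm, ← Int.isCoprime_iff_gcd_eq_one]
    exact (Nat.prime_iff_prime_int.1 hn).coprime_iff_not_dvd.2 hx
  have hz1d := pm z1 d hd hdz1
  have hz1p := pm z1 p hp hpz1
  have hwd := pm w d hd hw
  have hw1d := pm w1 d hd hw1
  have h2p : J(2 | p) = (-1) ^ ((p - 1) / 4) := by
    rcases (by omega : p % 8 = 1 ∨ p % 8 = 5) with h8 | h8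
    · rw [j_two_one p h8, Even.neg_one_pow]; rw [Nat.even_iff]; omega
    · rw [j_two_five p h8, Odd.neg_one_pow]; rw [Nat.odd_iff]; omega
  have h2p' : J(2 | p) = 1 ∨ J(2 | p) = -1 := by
    rw [h2p]; exact neg_one_pow_eq_or _ _
  have C : quarticSym d p = J(z1 | d) * J(w1 | d) := by
    apply qs d p hd2
    · rcases hz1d with a | a <;> rcases hw1d with b | b <;> simp [a, b]
    · push_cast
      have e1 : (z1 : ZMod d) ^ 2 = p * w1 ^ 2 := by
        have := congrArg (fun t : ℤ => (t : ZMod d)) h1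
        push_cast at this
        rw [ZMod.natCast_self, zero_pow hm0] at this
        linear_combination this
      have e2 : (z1 : ZMod d) ^ ((d - 1) / 2) = (p : ZMod d) ^ ((d - 1) / 4) * w1 ^ ((d - 1) / 2) := by
        have : (d - 1) / 2 = 2 * ((d - 1) / 4) := by omega
        rw [this, pow_mul, pow_mul, e1, mul_pow]
      rw [← legendre_jac d hd hd2, ← legendre_jac d hd hd2] at e2
      rw [e2, mul_assoc]
      rcases hw1d with b | b <;> simp [b]
  have Dd : quarticSym p d = J(z1 | p) * J(2 | p) := by
    apply qs p d hp2
    · rcases hz1p with a | a <;> rcases h2p' with b | b <;> simp [a, b]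
    · have e1 : (z1 : ZMod p) ^ 2 = (-1) * d ^ m := by
        have := congrArg (fun t : ℤ => (t : ZMod p)) h1
        push_cast at this
        rw [ZMod.natCast_self] at this
        linear_combination this
      have e0 : (z : ZMod p) ^ 2 = d ^ m := by
        have := congrArg (fun t : ℤ => (t : ZMod p)) h
        push_cast at this
        rw [ZMod.natCast_self] at this
        linear_combination this
      have e2 : (z1 : ZMod p) ^ ((p - 1) / 2) = (-1) ^ ((p - 1) / 4) * ((d : ZMod p) ^ ((p - 1) / 4)) ^ m := by
        have : (p - 1) / 2 = 2 * ((p - 1) / 4) := by omega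
        rw [this, pow_mul, e1, mul_pow, ← pow_mul, ← pow_mul, mul_comm m]
      have hpz : ¬ (p : ℤ) ∣ z := by
        intro hh
        have : (p : ℤ) ∣ d ^ m := by
          rw [← h]; exact dvd_sub (dvd_pow hh (by norm_num)) (Dvd.intro _ rfl)
        exact hdnp (hpi.dvd_of_dvd_pow this)
      have hQ : ((d : ZMod p) ^ ((p - 1) / 4)) ^ m = (d : ZMod p) ^ ((p - 1) / 4) := by
        have a1 : ((d : ZMod p) ^ ((p - 1) / 4)) ^ 2 = 1 := by
          have a2 : (((d : ZMod p) ^ ((p - 1) / 4)) ^ 2) = ((J(d | p) : ℤ) : ZMod p) := by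
            rw [legendre_jac p hp hp2, ← pow_mul]; push_cast
            congr 1; omega
          rw [a2, ← pow_odd_eq hm (jacobiSym.trichotomy (d : ℤ) p), ← jacobiSym.pow_left]
          have : J((d : ℤ) ^ m | p) = 1 := by
            rw [← h]
            have : J(z ^ 2 - p * w ^ 2 | p) = J(z ^ 2 | p) := by
              apply jacobiSym.mod_left'
              show _ ≡ _ [ZMOD _]
              rw [Int.modEq_iff_dvd]
              exact ⟨w ^ 2, by ring⟩
            rw [this, jacobiSym.pow_left]
            rcases pm z p hp hpz with a | a <;> simp [a]
          rw [this]; simp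
        obtain ⟨k, rfl⟩ := hm
        rw [pow_succ, pow_mul, a1, one_pow, one_mul]
      rw [hQ, ← legendre_jac p hp hp2] at e2
      push_cast
      rw [e2, h2p]
      push_cast
      rcases neg_one_pow_eq_or (ZMod p) ((p - 1) / 4) with b | b <;> simp [b]
  rw [C, Dd]
  rw [A] at hww hwd
  rcases hz1d with a1 | a1 <;> rcases hz1p with a2 | a2 <;> rcases hwd with a3 | a3 <;> rcases hw1d with a4 | a4 <;>
    rcases h2p' with a5 | a5 <;> rw [a1, a2, a3, a5] at B <;> rw [a3, a4] at hww <;> rw [a1, a2, a4, a5] <;> simp at B hww ⊢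
end Q2
end

section
open NumberField nonZeroDivisors
namespace Q2
set_option linter.all false
open scoped NumberTheorySymbols

lemma icast_inj {L : Type*} [Field L] [NumberField L] {a b : ℤ} (h : (a : 𝓞 L) = b) : a = b := by
  exact_mod_cast h

namespace QE
section
variable {k : Type*} [Field k] [NumberField k] (q : QE ℚ k)

lemma ne_bot_of_mem (P : Ideal (𝓞 k)) (l : ℕ) (hl : l ≠ 0) (h : (l : 𝓞 k) ∈ P) : P ≠ ⊥ := by
  rintro rfl
  rw [Ideal.mem_bot] at h
  exact hl (by exact_mod_cast h)

lemma conjQ (P Q : Ideal (𝓞 k)) (hP : P.IsPrime) (hQ : Q.IsPrime) (l : ℕ) (hl : l.Prime)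
    (h1 : (l : 𝓞 k) ∈ P) (h2 : (l : 𝓞 k) ∈ Q) : Q = P ∨ Q = P.map q.os := by
  apply q.conj_prime P Q hP hQ (ne_bot_of_mem P l hl.ne_zero h1)
  rw [OQ_prime _ (hP.comap _).ne_top l hl (by rw [Ideal.mem_comap, map_natCast]; exact h1),
    OQ_prime _ (hQ.comap _).ne_top l hl (by rw [Ideal.mem_comap, map_natCast]; exact h2)]

lemma inertQ (ρ : 𝓞 k) (hρ : (ρ : k) = q.r) (D : ℤ) (hD : ρ ^ 2 = D) (hsf : Squarefree D) (l : ℕ) (hl : l.Prime) (hl2 : l % 2 = 1)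
    (hi : ∀ a b : ℤ, (l : ℤ) ∣ a ^ 2 - D * b ^ 2 → (l : ℤ) ∣ a ∧ (l : ℤ) ∣ b)
    (P : Ideal (𝓞 k)) (hP : P.IsPrime) (h1 : (l : 𝓞 k) ∈ P) : P.map q.os = P := by
  have key : ∀ x, x ∈ P → q.os x ∈ P := by
    intro x hx
    obtain ⟨a, b, n, e1, e2, e3, e4⟩ := q.qint ρ hρ D hD hsf x
    have hn : (l : ℤ) ∣ n := by
      apply int_dvd_of_mem P hP.ne_top l hl h1
      rw [← e3]; exact P.mul_mem_right _ hx
    obtain ⟨ha, hb⟩ := hi a b (by rw [← e4]; exact hn.mul_left _)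
    have h3 : 2 * q.os x ∈ P := by
      rw [e2]
      obtain ⟨a', rfl⟩ := ha
      obtain ⟨b', rfl⟩ := hb
      have : ((l * a' : ℤ) : 𝓞 k) - ((l * b' : ℤ) : 𝓞 k) * ρ = (a' - b' * ρ) * l := by push_cast; ring
      rw [this]; exact P.mul_mem_left _ h1
    rcases hP.mem_or_mem h3 with h4 | h4
    · exfalso
      exact not_cop P hP.ne_top 2 l (Int.isCoprime_iff_gcd_eq_one.2 (by
        show Nat.gcd 2 l = 1
        rw [← Nat.coprime_iff_gcd_eq_one, Nat.coprime_two_left, Nat.odd_iff]; exact hl2)) (by exact_mod_cast h4) (by exact_mod_cast h1)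
    · exact h4
  ext x
  rw [q.mem_map_os]
  exact ⟨fun h => by have := key _ h; rwa [q.os_os] at this, key x⟩

lemma comap_map (P : Ideal (𝓞 k)) (hP : P.IsPrime) (l : ℕ) (hl : l.Prime) (h1 : (l : 𝓞 k) ∈ P) :
    (P.comap q.of).map q.of = Ideal.span {(l : 𝓞 k)} := by
  rw [OQ_prime _ (hP.comap _).ne_top l hl (by rw [Ideal.mem_comap, map_natCast]; exact h1), Ideal.map_span, Set.image_singleton, map_natCast]

lemma not_le_sq (P : Ideal (𝓞 k)) (hP : P ≠ ⊤) (hP0 : P ≠ ⊥) : ¬ P ≤ P ^ 2 := by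
  intro h
  apply hP
  have h1 : P * ⊤ = P * P := le_antisymm (by rw [Ideal.mul_top, ← sq]; exact h) (Ideal.mul_mono_right le_top)
  exact (mul_left_cancel₀ hP0 h1).symm

lemma notsq (P : Ideal (𝓞 k)) (hP : P.IsPrime) (l : ℕ) (hl : l.Prime) (h1 : (l : 𝓞 k) ∈ P) (θ : 𝓞 k) (hθ : θ - q.os θ ∉ P) :
    (l : 𝓞 k) ∉ P ^ 2 := by
  intro h2
  have hP0 := ne_bot_of_mem P l hl.ne_zero h1
  have h3 := q.norm_ideal_le P hP0
  rw [q.comap_map P hP l hl h1] at h3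
  have h4 : Ideal.span {(l : 𝓞 k)} ≤ P ^ 2 := (Ideal.span_singleton_le_iff_mem _).2 h2
  have h5 : P * P ∣ P * P.map q.os := by
    rw [Ideal.dvd_iff_le, ← sq]; exact h3.trans h4
  have h6 := (mul_dvd_mul_iff_left hP0).1 h5
  rw [Ideal.dvd_iff_le] at h6
  have hm : (P.map q.os).IsMaximal := (q.os_prime P hP).isMaximal (map_ne_bot _ hP0)
  have h7 : P.map q.os = P := hm.eq_of_le hP.ne_top h6
  haveI := hP
  rcases q.prime_inv P hP0 h7 with h8 | h8
  · rw [q.comap_map P hP l hl h1] at h8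
    rw [h8] at h4
    exact not_le_sq P hP.ne_top hP0 h4
  · exact hθ (h8.2 θ)

lemma cube (ρ : 𝓞 k) (hρ : (ρ : k) = q.r) (D : ℤ) (hD : ρ ^ 2 = D) (hsf : Squarefree D) (hD4 : D % 4 = 1) (hs : q.os ρ = -ρ)
    (y : 𝓞 k) (n : ℤ) (hn : y * q.os y = n) (hno : n % 2 = 1) :
    ∃ z w : ℤ, y ^ 3 = z + w * ρ ∧ z ^ 2 - D * w ^ 2 = n ^ 3 := by
  obtain ⟨a, b, n', e1, e2, e3, e4⟩ := q.qint ρ hρ D hD hsf y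
  have : n' = n := icast_inj (L := k) (by rw [← e3, hn])
  subst this
  have hpar : a % 2 = b % 2 := by
    have h1 : (a ^ 2 - D * b ^ 2) % 2 = 0 := by omega
    have h2 : D % 2 = 1 := by omega
    rcases Int.emod_two_eq_zero_or_one a with h | h <;> rcases Int.emod_two_eq_zero_or_one b with h' | h' <;>
      simp [pow_two, Int.sub_emod, Int.mul_emod, h, h', h2] at h1 ⊢
  have hDb : (D * b ^ 2) % 2 = b % 2 := by
    have h2 : D % 2 = 1 := by omega
    rcases Int.emod_two_eq_zero_or_one b with h' | h' <;> simp [pow_two, Int.mul_emod, h', h2]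
  have d1 : ∃ z, 2 * z = a * (n' + D * b ^ 2) := by
    rcases Int.emod_two_eq_zero_or_one b with h' | h'
    · exact ⟨(a / 2) * (n' + D * b ^ 2), by rw [← mul_assoc]; congr 1; omega⟩
    · exact ⟨a * ((n' + D * b ^ 2) / 2), by rw [mul_left_comm]; congr 1; omega⟩
  have d2 : ∃ w, 2 * w = b * (3 * n' + D * b ^ 2) := by
    rcases Int.emod_two_eq_zero_or_one b with h' | h'
    · exact ⟨(b / 2) * (3 * n' + D * b ^ 2), by rw [← mul_assoc]; congr 1; omega⟩
    · exact ⟨b * ((3 * n' + D * b ^ 2) / 2), by rw [mul_left_comm]; congr 1; omega⟩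
  obtain ⟨z, hz⟩ := d1
  obtain ⟨w, hw⟩ := d2
  have h8 : (8 : 𝓞 k) ≠ 0 := by norm_num
  have hz' : (2 * z : 𝓞 k) = a * (n' + D * b ^ 2) := by exact_mod_cast hz
  have hw' : (2 * w : 𝓞 k) = b * (3 * n' + D * b ^ 2) := by exact_mod_cast hw
  have e4' : (4 * n' : 𝓞 k) = a ^ 2 - D * b ^ 2 := by exact_mod_cast e4
  have hy3 : y ^ 3 = z + w * ρ := by
    apply mul_left_cancel₀ h8
    have : 8 * y ^ 3 = (2 * y) ^ 3 := by ring
    rw [this, e1]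
    linear_combination (3 * a * b ^ 2 + b ^ 3 * ρ) * hD - 4 * hz' - 4 * hw' * ρ - (a + 3 * b * ρ) * e4'
  refine ⟨z, w, hy3, ?_⟩
  apply icast_inj (L := k)
  push_cast
  rw [← hn]
  have h9 : q.os y ^ 3 = z - w * ρ := by
    rw [← map_pow, hy3]; simp only [map_add, map_mul, map_intCast, hs]; ring
  rw [mul_pow, h9, hy3]
  linear_combination w ^ 2 * hD

end

section
variable {B F : Type*} [Field B] [NumberField B] [Field F] [NumberField F] [IsTotallyReal B] [IsTotallyReal F]
  (q : QE ℚ B) (q' : QE B F)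

lemma leg_inert (p d : ℕ) [Fact d.Prime] (h : legendreSym d p = -1) (a b : ℤ) (hab : (d : ℤ) ∣ a ^ 2 - p * b ^ 2) :
    (d : ℤ) ∣ a ∧ (d : ℤ) ∣ b := by
  apply legendreSym.prime_dvd_of_eq_neg_one h hab

lemma ramF (d : ℕ) (hd : d.Prime) (hd4 : d % 4 = 1) (δ : 𝓞 F) (hδ : δ ^ 2 = (d : 𝓞 F)) (hs : q'.os δ = -δ)
    (P : Ideal (𝓞 F)) (hθ : ∀ θ, θ - q'.os θ ∈ P) : (d : 𝓞 B) ∈ P.comap q'.of := by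
  obtain ⟨θ, -, h⟩ := q'.theta ((d / 4 : ℕ) : ℤ) d (by omega) δ (by exact_mod_cast hδ) hs
  have := hθ θ
  rw [h] at this
  rw [Ideal.mem_comap, map_natCast, ← hδ, sq]
  exact P.mul_mem_left _ this

lemma F_inert (p d : ℕ) (hp : p.Prime) (hd : d.Prime) (hd4 : d % 4 = 1) (hB : Odd (Nat.card (ClassGroup (𝓞 B))))
    (ρ : 𝓞 B) (hρr : (ρ : B) = q.r) (hρ : ρ ^ 2 = (p : 𝓞 B)) (δ : 𝓞 F) (hδ : δ ^ 2 = (d : 𝓞 F)) (hs : q'.os δ = -δ)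
    (h : @legendreSym d ⟨hd⟩ p = -1) : Odd (Nat.card (ClassGroup (𝓞 F))) := by
  haveI := Fact.mk hd
  have key : ∃ Q0 : Ideal (𝓞 B), ∀ Q : Ideal (𝓞 B), Q.IsPrime → (d : 𝓞 B) ∈ Q → Q = Q0 := by
    by_cases hex : ∃ Q : Ideal (𝓞 B), Q.IsPrime ∧ (d : 𝓞 B) ∈ Q
    · obtain ⟨Q0, h1, h2⟩ := hex
      refine ⟨Q0, fun Q h3 h4 => ?_⟩
      have hi := q.inertQ ρ hρr p (by exact_mod_cast hρ) (Nat.prime_iff_prime_int.1 hp).squarefree d hd (by omega)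
        (leg_inert p d h) Q0 h1 h2
      rcases q.conjQ Q0 Q h1 h3 d hd h2 h4 with h5 | h5
      · exact h5
      · rw [h5, hi]
    · push Not at hex
      exact ⟨⊤, fun Q h1 h2 => absurd h2 (hex Q h1)⟩
  obtain ⟨Q0, hQ0⟩ := key
  have hb : q'.J.relIndex (Fx q'.ti) ∣ 2 ^ (0 + 1) := by
    have := q'.ram_bound {Q0} (by
      intro P hP hP0 hPs hθ
      rw [Finset.mem_singleton]
      exact hQ0 _ (hP.comap _) (q'.ramF d hd hd4 δ hδ hs P hθ))
    simpa using this
  apply q'.amb_odd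
  have := q'.amb_ram hb
  rw [pow_zero, one_mul] at this
  exact Odd.of_dvd_nat hB this

lemma F_split (p d : ℕ) (hp : p.Prime) (hd : d.Prime) (hpd : p ≠ d) (hp4 : p % 4 = 1) (hd4 : d % 4 = 1) (hB : Odd (Nat.card (ClassGroup (𝓞 B))))
    (e : (𝓞 B)ˣ) (he : (e : 𝓞 B) * q.os e = -1)
    (ρ : 𝓞 B) (hρr : (ρ : B) = q.r) (hρ : ρ ^ 2 = (p : 𝓞 B)) (hρs : q.os ρ = -ρ) (δ : 𝓞 F) (hδr : (δ : F) = q'.r) (hδ : δ ^ 2 = (d : 𝓞 F)) (hs : q'.os δ = -δ)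
    (h : @legendreSym d ⟨hd⟩ p = 1) (hq : quarticSym d p ≠ quarticSym p d) : Odd (Nat.card (ClassGroup (𝓞 F))) := by
  classical
  haveI := Fact.mk hd
  have hdi := Nat.prime_iff_prime_int.1 hd
  have hpi := Nat.prime_iff_prime_int.1 hp
  have hpnd : ¬ (d : ℤ) ∣ p := fun hh => hpd ((Nat.prime_dvd_prime_iff_eq hd hp).1 (by exact_mod_cast hh)).symm
  have hρ' : ρ ^ 2 = ((p : ℤ) : 𝓞 B) := by exact_mod_cast hρ
  -- the prime Q
  haveI hsp : (Ideal.span {(d : 𝓞 ℚ)}).IsPrime := by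
    rw [Ideal.span_singleton_prime (by exact_mod_cast hd.ne_zero)]
    have := (MulEquiv.prime_iff (Rat.ringOfIntegersEquiv.toMulEquiv.symm : ℤ ≃* 𝓞 ℚ) (p := (d : ℤ))).2 hdi
    simpa using this
  obtain ⟨Q, hQ, hQ0, hQc, hQm⟩ := q.trich (Ideal.span {(d : 𝓞 ℚ)}) (by
    rw [Ne, Ideal.span_singleton_eq_bot]; exact_mod_cast hd.ne_zero)
  rw [Ideal.map_span, Set.image_singleton, map_natCast] at hQm
  have hdQ : (d : 𝓞 B) ∈ Q := by
    have : (d : 𝓞 ℚ) ∈ Q.comap q.of := by rw [hQc]; exact Ideal.mem_span_singleton_self _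
    rw [Ideal.mem_comap, map_natCast] at this
    exact this
  have h2Q : (2 : 𝓞 B) ∉ Q := fun h2 => not_cop Q hQ.ne_top 2 d (Int.isCoprime_iff_gcd_eq_one.2 (by
        show Nat.gcd 2 d = 1
        rw [← Nat.coprime_iff_gcd_eq_one, Nat.coprime_two_left, Nat.odd_iff]; omega)) (by exact_mod_cast h2) (by exact_mod_cast hdQ)
  have hρQ : ρ ∉ Q := fun h2 => by
    apply hpnd
    apply int_dvd_of_mem Q hQ.ne_top d hd hdQ
    rw [← hρ', sq]; exact Q.mul_mem_left _ h2
  have h2ρQ : ρ - q.os ρ ∉ Q := by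
    rw [hρs, sub_neg_eq_add, ← two_mul]
    intro h2
    rcases hQ.mem_or_mem h2 with h3 | h3
    · exact h2Q h3
    · exact hρQ h3
  have hQsplit : Ideal.span {(d : 𝓞 B)} = Q * Q.map q.os := by
    rcases hQm with h1 | h1
    · exfalso
      have hsq : IsSquare ((p : ℤ) : ZMod d) := by
        rw [← legendreSym.eq_one_iff d (by
          intro h0; rw [ZMod.intCast_zmod_eq_zero_iff_dvd] at h0; exact hpnd h0)]; exact h
      obtain ⟨x, hx⟩ := hsq
      obtain ⟨x, rfl⟩ := ZMod.intCast_surjective x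
      have hx' : (d : ℤ) ∣ x * x - p := by
        rw [← ZMod.intCast_zmod_eq_zero_iff_dvd]; push_cast; rw [← hx]; push_cast; ring
      obtain ⟨t, ht⟩ := hx'
      have ht' : (x * x - p : 𝓞 B) = d * t := by exact_mod_cast ht
      have h3 : (x - ρ) * (x + ρ) ∈ Q := by
        have : (x - ρ) * (x + ρ) = t * d := by linear_combination ht' - hρ
        rw [this]; exact Q.mul_mem_left _ hdQ
      have hQs : Q.map q.os = Q := by
        rw [← h1, Ideal.map_span, Set.image_singleton, map_natCast]
      have h4 : ∀ y, y ∈ Q → q.os y ∈ Q := fun y hy => by rw [← q.mem_map_os, hQs]; exact hy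
      have h5 : x - ρ ∈ Q ∧ x + ρ ∈ Q := by
        rcases hQ.mem_or_mem h3 with h6 | h6
        · refine ⟨h6, ?_⟩; have := h4 _ h6; rw [map_sub, map_intCast, hρs, sub_neg_eq_add] at this; exact this
        · refine ⟨?_, h6⟩; have := h4 _ h6; rw [map_add, map_intCast, hρs, ← sub_eq_add_neg] at this; exact this
      apply h2ρQ
      rw [hρs]
      have : ρ - -ρ = (x + ρ) - (x - ρ) := by ring
      rw [this]; exact Q.sub_mem h5.2 h5.1
    · exact h1
  have hQne : Q.map q.os ≠ Q := by
    intro hQs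
    rw [hQs] at hQsplit
    exact q.notsq Q hQ d hd hdQ ρ h2ρQ (by rw [sq, ← hQsplit]; exact Ideal.mem_span_singleton_self _)
  -- generator
  obtain ⟨γ, hγ0, hγ⟩ : ∃ γ : 𝓞 B, γ ≠ 0 ∧ Q ^ (Nat.card (ClassGroup (𝓞 B))) = Ideal.span {γ} := by
    have h1 : Q ^ (Nat.card (ClassGroup (𝓞 B))) ≠ ⊥ := pow_ne_zero _ hQ0
    have h2 : (ClassGroup.mk0 ⟨Q, mem_nonZeroDivisors_of_ne_zero hQ0⟩) ^ (Nat.card (ClassGroup (𝓞 B))) = 1 := by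
      rw [Nat.card_eq_fintype_card]; exact pow_card_eq_one
    rw [← map_pow, ClassGroup.mk0_eq_one_iff] at h2
    obtain ⟨γ, hγ⟩ := h2.principal
    refine ⟨γ, ?_, ?_⟩
    · rintro rfl
      apply h1
      simpa using hγ
    · simpa using hγ
  set hh := Nat.card (ClassGroup (𝓞 B)) with hhdef
  have hh0 : hh ≠ 0 := by rintro h0; rw [h0] at hB; simp at hB
  have hγQ : γ ∈ Q := by
    have : γ ∈ Q ^ hh := by rw [hγ]; exact Ideal.mem_span_singleton_self _
    exact Ideal.pow_le_self hh0 this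
  have hγQ' : γ ∉ Q.map q.os := by
    intro h1
    have h2 : Q ^ hh ≤ Q.map q.os := by rw [hγ, Ideal.span_singleton_le_iff_mem]; exact h1
    have h3 := (q.os_prime Q hQ).le_of_pow_le h2
    exact hQne ((hQ.isMaximal hQ0).eq_of_le (q.os_prime Q hQ).ne_top h3).symm
  have hγn : Ideal.span {γ * q.os γ} = Ideal.span {(d : 𝓞 B) ^ hh} := by
    have h1 : Ideal.span {q.os γ} = (Q.map q.os) ^ hh := by
      rw [← Ideal.map_pow, hγ, Ideal.map_span, Set.image_singleton]
    rw [← Ideal.span_singleton_mul_span_singleton, h1, ← hγ, ← mul_pow, ← hQsplit, Ideal.span_singleton_pow]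
  obtain ⟨n, hn⟩ := q.nm_int γ
  have hn' : n = d ^ hh ∨ n = - d ^ hh := by
    rw [hn, Ideal.span_singleton_eq_span_singleton] at hγn
    obtain ⟨u, hu⟩ := hγn
    have hu' := congrArg (fun z => z * q.os z) hu
    simp only [map_mul, map_intCast, map_natCast, map_pow] at hu'
    obtain ⟨v, hv⟩ := q.nm_int (u : 𝓞 B)
    have hvu : IsUnit v := by
      obtain ⟨v', hv'⟩ := q.nm_int (u⁻¹ : (𝓞 B)ˣ)
      have h1 : (v : 𝓞 B) * v' = 1 := by
        rw [← hv, ← hv']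
        have : (u : 𝓞 B) * q.os u * ((u⁻¹ : (𝓞 B)ˣ) * q.os (u⁻¹ : (𝓞 B)ˣ)) = (u * (u⁻¹ : (𝓞 B)ˣ)) * q.os (u * (u⁻¹ : (𝓞 B)ˣ)) := by
          rw [map_mul]; ring
        rw [this, Units.mul_inv]; simp
      exact IsUnit.of_mul_eq_one v' (icast_inj (L := B) (by push_cast; exact h1))
    have h2 : n ^ 2 * v = (d ^ hh) ^ 2 := by
      apply icast_inj (L := B)
      push_cast
      rw [← hv]; linear_combination hu'
    have hv1 : v = 1 := by
      rcases Int.isUnit_iff.1 hvu with h3 | h3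
      · exact h3
      · exfalso
        rw [h3] at h2
        have : (0 : ℤ) < (d ^ hh) ^ 2 := by have := hd.pos; positivity
        nlinarith [sq_nonneg n]
    rw [hv1, mul_one] at h2
    exact sq_eq_sq_iff_eq_or_eq_neg.1 h2
  -- normalised generator
  obtain ⟨g, hgn, hgQ, hgQ'⟩ : ∃ g : 𝓞 B, g * q.os g = ((d ^ hh : ℤ) : 𝓞 B) ∧ g ∈ Q ∧ g ∉ Q.map q.os := by
    rcases hn' with h1 | h1
    · exact ⟨γ, by rw [hn, h1], hγQ, hγQ'⟩
    · refine ⟨γ * e, ?_, Q.mul_mem_right _ hγQ, ?_⟩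
      · rw [map_mul]
        have : γ * e * (q.os γ * q.os e) = (γ * q.os γ) * (e * q.os e) := by ring
        rw [this, hn, he, h1]; push_cast; ring
      · rwa [Ideal.mul_unit_mem_iff_mem _ e.isUnit]
  have hsf : Squarefree (p : ℤ) := hpi.squarefree
  have hdo : ((d : ℤ) ^ hh) % 2 = 1 := by
    have := d_pow_mod8 d hh (by omega) hB
    omega
  obtain ⟨z, w, hzw, hzwn⟩ := q.cube ρ hρr p hρ' hsf (by omega) hρs g _ hgn hdo
  obtain ⟨e1, e2, hee, heen⟩ := q.cube ρ hρr p hρ' hsf (by omega) hρs e (-1) (by rw [he]; simp) (by norm_num)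
  have hzwQ : (z + w * ρ : 𝓞 B) ∈ Q := by rw [← hzw]; exact Q.pow_mem_of_mem hgQ 3 (by norm_num)
  have hzwQ' : (z + w * ρ : 𝓞 B) ∉ Q.map q.os := by
    rw [← hzw]; exact fun hc => hgQ' ((q.os_prime Q hQ).mem_of_pow_mem _ hc)
  have hdQ' : (d : 𝓞 B) ∈ Q.map q.os := by rw [q.mem_map_os, map_natCast]; exact hdQ
  have hdz : (d : ℤ) ∣ w → False := by
    intro hw
    have hz : (d : ℤ) ∣ z := by
      apply hdi.dvd_of_dvd_pow (n := 2)
      have : z ^ 2 = (d ^ hh) ^ 3 + p * w ^ 2 := by linear_combination hzwn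
      rw [this]
      exact dvd_add (dvd_pow (dvd_pow_self _ hh0) (by norm_num)) ((dvd_pow hw (by norm_num)).mul_left _)
    obtain ⟨w', rfl⟩ := hw
    obtain ⟨z', rfl⟩ := hz
    apply hzwQ'
    have : (((d * z' : ℤ) : 𝓞 B) + ((d * w' : ℤ) : 𝓞 B) * ρ) = (z' + w' * ρ) * d := by push_cast; ring
    rw [this]; exact Ideal.mul_mem_left _ _ hdQ'
  have hwQ : (w : 𝓞 B) ∉ Q := fun h1 => hdz (int_dvd_of_mem Q hQ.ne_top d hd hdQ w h1)
  -- bound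
  have hb : q'.J.relIndex (Fx q'.ti) ∣ 2 ^ (0 + 2) := by
    have := q'.ram_bound {Q, Q.map q.os} (by
      intro P hP hP0 hPs hθ
      rw [Finset.mem_insert, Finset.mem_singleton]
      exact q.conjQ Q _ hQ (hP.comap _) d hd hdQ (q'.ramF d hd hd4 δ hδ hs P hθ))
    exact this.trans (pow_dvd_pow _ Finset.card_le_two)
  apply q'.amb_odd
  have hev : 2 ∣ (Wn (dvv F) q'.su q'.ti).relIndex ((dvv F).ker ⊓ Fx q'.su) := by
    apply q'.W_even (e ^ 3)
    intro y hy
    obtain ⟨c, hc⟩ := q'.NN (d : 𝓞 B) (by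
      have := congrArg (algebraMap (𝓞 F) F) hδ
      rw [map_pow, map_natCast] at this
      rw [← hδr]
      refine this.trans ?_
      have h2 : ((d : 𝓞 B) : B) = (d : B) := map_natCast (algebraMap (𝓞 B) B) d
      rw [h2, map_natCast]) Q hdQ (q.notsq Q hQ d hd hdQ ρ h2ρQ) ((e ^ 3 : (𝓞 B)ˣ) : 𝓞 B) y hy
    rw [Units.val_pow_eq_pow_val, hee] at hc
    obtain ⟨c1, c2, _, hc1, _, _, _⟩ := q.qint ρ hρr p hρ' hsf c
    -- w1 = w e1 - z e2
    have hw1 : ((w * (w * e1 - z * e2) - 0 : ℤ) : 𝓞 B) - (w * c) ^ 2 ∈ Q := by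
      have : ((w * (w * e1 - z * e2) - 0 : ℤ) : 𝓞 B) - (w * c) ^ 2 = w ^ 2 * (e1 + e2 * ρ - c ^ 2) - w * e2 * (z + w * ρ) := by
        push_cast; ring
      rw [this]
      exact Q.sub_mem (Q.mul_mem_left _ hc) (Q.mul_mem_left _ hzwQ)
    have hg : ((4 * (w * (w * e1 - z * e2)) - (w * c1 - z * c2) ^ 2 : ℤ) : 𝓞 B) ∈ Q := by
      have h1 : ((w * c1 - z * c2 : ℤ) : 𝓞 B) - 2 * w * c ∈ Q := by
        have : ((w * c1 - z * c2 : ℤ) : 𝓞 B) - 2 * w * c = - c2 * (z + w * ρ) := by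
          push_cast; linear_combination -w * hc1
        rw [this]; exact Q.mul_mem_left _ hzwQ
      have : ((4 * (w * (w * e1 - z * e2)) - (w * c1 - z * c2) ^ 2 : ℤ) : 𝓞 B) = 4 * (((w * (w * e1 - z * e2) - 0 : ℤ) : 𝓞 B) - (w * c) ^ 2)
          - (((w * c1 - z * c2 : ℤ) : 𝓞 B) + 2 * w * c) * (((w * c1 - z * c2 : ℤ) : 𝓞 B) - 2 * w * c) := by
        push_cast; ring
      rw [this]
      exact Q.sub_mem (Q.mul_mem_left _ hw1) (Q.mul_mem_left _ h1)
    have hgd := int_dvd_of_mem Q hQ.ne_top d hd hdQ _ hg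
    -- d does not divide w1
    have hdw1 : ¬ (d : ℤ) ∣ w * e1 - z * e2 := by
      intro h1
      have h2 : ((w * e1 - z * e2 : ℤ) : 𝓞 B) ∈ Q := by
        obtain ⟨t, ht⟩ := h1
        rw [ht]; push_cast; exact Q.mul_mem_right _ hdQ
      have h3 : (w : 𝓞 B) * (e : 𝓞 B) ^ 3 ∈ Q := by
        have : (w : 𝓞 B) * (e : 𝓞 B) ^ 3 = ((w * e1 - z * e2 : ℤ) : 𝓞 B) + e2 * (z + w * ρ) := by
          rw [hee]; push_cast; ring
        rw [this]; exact Q.add_mem h2 (Q.mul_mem_left _ hzwQ)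
      rw [Ideal.mul_unit_mem_iff_mem _ (e.isUnit.pow 3)] at h3
      exact hwQ h3
    apply hq
    apply scholz p d hp hd hpd hp4 hd4 (hh * 3) (hB.mul (by decide)) z w (z * e1 - p * w * e2) (w * e1 - z * e2)
      (by rw [hzwn, pow_mul]) _ hdz hdw1
    · -- Jacobi
      have h2 : J(4 * (w * (w * e1 - z * e2)) | d) = 1 := by
        rw [show (4 * (w * (w * e1 - z * e2)) : ℤ) = (4 * (w * (w * e1 - z * e2)) - (w * c1 - z * c2) ^ 2) + (w * c1 - z * c2) ^ 2 by ring]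
        obtain ⟨t, ht⟩ := hgd
        rw [ht]
        have : J((d : ℤ) * t + (w * c1 - z * c2) ^ 2 | d) = J((w * c1 - z * c2) ^ 2 | d) := by
          apply jacobiSym.mod_left'
          simp
        rw [this]
        apply jacobiSym.sq_one'
        rw [Int.gcd_comm, ← Int.isCoprime_iff_gcd_eq_one, hdi.coprime_iff_not_dvd]
        intro h3
        have h4 : (d : ℤ) ∣ 4 * (w * (w * e1 - z * e2)) := by
          have : 4 * (w * (w * e1 - z * e2)) = d * t + (w * c1 - z * c2) ^ 2 := by linear_combination ht
          rw [this]; exact dvd_add (Dvd.intro _ rfl) (dvd_pow h3 (by norm_num))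
        rcases hdi.dvd_or_dvd h4 with h5 | h5
        · have := Int.le_of_dvd (by norm_num) h5
          have := hd.two_le
          omega
        · rcases hdi.dvd_or_dvd h5 with h6 | h6
          · exact hdz h6
          · exact hdw1 h6
      rw [jacobiSym.mul_left, jacobiSym.at_four (Nat.odd_iff.2 (by omega)), one_mul] at h2
      exact h2
    · rw [pow_mul, ← hzwn]
      linear_combination (z ^ 2 - p * w ^ 2) * heen
  have := q'.amb_ram' hb hev
  rw [pow_zero, one_mul] at this
  exact Odd.of_dvd_nat hB this
end
end QE
end Q2
end

section
open NumberField nonZeroDivisors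
namespace Q2
set_option linter.all false

namespace QE
section
variable {F L : Type*} [Field F] [NumberField F] [Field L] [NumberField L] (q : QE F L)

lemma unram_two (θ θ' x y : 𝓞 L) (h1 : θ - q.os θ = x) (h2 : θ' - q.os θ' = y) (m n : ℤ) (hmn : IsCoprime m n)
    (hm : (m : 𝓞 L) ∈ Ideal.span {x, y}) (hn : (n : 𝓞 L) ∈ Ideal.span {x, y}) : Fx q.ti ≤ q.J := by
  apply q.unram {θ, θ'}
  rw [Set.image_pair, h1, h2]
  by_contra hc
  exact not_cop _ hc m n hmn hm hn

lemma unram_sq (θ θ' x y : 𝓞 L) (h1 : θ - q.os θ = x) (h2 : θ' - q.os θ' = y) (m n : ℤ) (hmn : IsCoprime m n)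
    (hm : x ^ 2 = m) (hn : y ^ 2 = n) : Fx q.ti ≤ q.J := by
  apply q.unram_two θ θ' x y h1 h2 m n hmn
  · rw [← hm, sq]; exact Ideal.mul_mem_left _ _ (Ideal.subset_span (by simp))
  · rw [← hn, sq]; exact Ideal.mul_mem_left _ _ (Ideal.subset_span (by simp))

lemma unram_pd (p d : ℕ) (hp : p.Prime) (hd : d.Prime) (hpd : p ≠ d) (hp4 : p % 4 = 1) (hd4 : d % 4 = 1)
    (x y : 𝓞 L) (hx : x ^ 2 = (p : 𝓞 L)) (hy : y ^ 2 = (d : 𝓞 L)) (hsx : q.os x = -x) (hsy : q.os y = -y) : Fx q.ti ≤ q.J := by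
  obtain ⟨θ, -, h⟩ := q.theta ((p / 4 : ℕ) : ℤ) p (by omega) x (by exact_mod_cast hx) hsx
  obtain ⟨θ', -, h'⟩ := q.theta ((d / 4 : ℕ) : ℤ) d (by omega) y (by exact_mod_cast hy) hsy
  apply q.unram_sq θ θ' x y h h' p d _ (by exact_mod_cast hx) (by exact_mod_cast hy)
  rw [Nat.isCoprime_iff_coprime]
  exact (Nat.coprime_primes hp hd).2 hpd

variable [IsTotallyReal F] [IsTotallyReal L]
lemma two_part (h : Fx q.ti ≤ q.J) (hL : Odd (Nat.card (ClassGroup (𝓞 L))))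
    (hK : (dvv F).range.relIndex ((dvv F).range.comap (sqh (IG F))) ∣ 2) :
    2 ∣ Nat.card (ClassGroup (𝓞 F)) ∧ ¬ 4 ∣ Nat.card (ClassGroup (𝓞 F)) := by
  refine ⟨(Dvd.intro_left _ rfl).trans (q.amb_unram h), fun h4 => ?_⟩
  rw [card_cl] at h4
  have := four_aux (dvv F).range (cl_ne F) h4 (fun a ha => q.cap4 hL a ha)
  have := this.trans hK
  omega

end

section
variable {k : Type*} [Field k] [NumberField k] (q : QE ℚ k)

lemma int_of_two (r : 𝓞 k) (hr : (r : k) = q.r) (h2 : r ^ 2 = 2) (y : 𝓞 k) : ∃ a b : ℤ, y = a + b * r := by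
  obtain ⟨a, b, n, e1, -, -, e4⟩ := q.qint r hr 2 (by exact_mod_cast h2) Int.prime_two.squarefree y
  have ha : a % 2 = 0 := by
    rcases Int.emod_two_eq_zero_or_one a with h | h
    · exact h
    · have : (a ^ 2) % 2 = 1 := by simp [pow_two, Int.mul_emod, h]
      omega
  obtain ⟨a', rfl⟩ := Int.dvd_of_emod_eq_zero ha
  have hb : b % 2 = 0 := by
    rcases Int.emod_two_eq_zero_or_one b with h | h
    · exact h
    · have : (b ^ 2) % 2 = 1 := by simp [pow_two, Int.mul_emod, h]
      have h3 : (2 * a') ^ 2 = 4 * a' ^ 2 := by ring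
      omega
  obtain ⟨b', rfl⟩ := Int.dvd_of_emod_eq_zero hb
  refine ⟨a', b', ?_⟩
  have : (2 : 𝓞 k) ≠ 0 := two_ne_zero
  apply mul_left_cancel₀ this
  rw [e1]; push_cast; ring

lemma bal (a n : ℤ) (hn : n ≠ 0) : ∃ A : ℤ, 4 * (a - A * n) ^ 2 ≤ n ^ 2 := by
  refine ⟨round ((a : ℚ) / n), ?_⟩
  have h := abs_sub_round ((a : ℚ) / n)
  have hn' : (n : ℚ) ≠ 0 := by exact_mod_cast hn
  have h2 : ((a : ℚ) / n - round ((a : ℚ) / n)) ^ 2 ≤ (1 / 2) ^ 2 := by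
    rw [sq_le_sq, abs_of_pos (by norm_num : (0 : ℚ) < 1 / 2)]; exact h
  have h3 : (a : ℚ) - round ((a : ℚ) / n) * n = n * ((a : ℚ) / n - round ((a : ℚ) / n)) := by field_simp
  have h4 : 4 * ((a : ℚ) - round ((a : ℚ) / n) * n) ^ 2 ≤ (n : ℚ) ^ 2 := by
    rw [h3, mul_pow]
    nlinarith [sq_nonneg (n : ℚ)]
  exact_mod_cast h4

lemma os_inj {F L : Type*} [Field F] [NumberField F] [Field L] [NumberField L] (q : QE F L) : Function.Injective q.os := om_inj _

lemma nm_ne (x : 𝓞 k) (hx : x ≠ 0) : x * q.os x ≠ 0 := by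
  apply mul_ne_zero hx
  intro h; apply hx; apply q.os_inj; rw [h, map_zero]

lemma add_eq {r : 𝓞 k} (hrs : q.os r = -r) (hr0 : r ≠ 0) {a b c d : ℤ} (h : (a + b * r : 𝓞 k) = c + d * r) : a = c ∧ b = d := by
  have h' := congrArg q.os h
  simp only [map_add, map_mul, map_intCast, hrs] at h'
  have h2 : (2 : 𝓞 k) ≠ 0 := two_ne_zero
  have h3 : (a : 𝓞 k) = c := by
    apply mul_left_cancel₀ h2
    linear_combination h + h'
  refine ⟨icast_inj h3, ?_⟩
  rw [h3] at h
  have := mul_right_cancel₀ hr0 (add_left_cancel h)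
  exact icast_inj this

lemma pid_two (r : 𝓞 k) (hr : (r : k) = q.r) (h2 : r ^ 2 = 2) (hrs : q.os r = -r) : IsPrincipalIdealRing (𝓞 k) := by
  classical
  choose N hN using q.nm_int
  constructor
  intro I
  by_cases hI : I = ⊥
  · rw [hI]; exact bot_isPrincipal
  obtain ⟨x0, hx0, hx00⟩ := Submodule.exists_mem_ne_zero_of_ne_bot hI
  have hex : ∃ m : ℕ, ∃ x ∈ I, x ≠ 0 ∧ (N x).natAbs = m := ⟨_, x0, hx0, hx00, rfl⟩
  obtain ⟨x, hxI, hx0, hxm⟩ := Nat.find_spec hex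
  refine ⟨x, ?_⟩
  apply le_antisymm
  · intro y hy
    obtain ⟨a, b, hab⟩ := q.int_of_two r hr h2 (y * q.os x)
    have hn : N x ≠ 0 := fun h0 => q.nm_ne x hx0 (by rw [hN, h0]; simp)
    obtain ⟨A, hA⟩ := bal a (N x) hn
    obtain ⟨B, hB⟩ := bal b (N x) hn
    set t := y - (A + B * r) * x with ht
    have htI : t ∈ I := I.sub_mem hy (I.mul_mem_left _ hxI)
    have ht0 : t = 0 := by
      by_contra hne
      have hmin := Nat.find_min' hex ⟨t, htI, hne, rfl⟩
      rw [← hxm] at hmin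
      have e1 : t * q.os x = ((a - A * N x : ℤ) : 𝓞 k) + ((b - B * N x : ℤ) : 𝓞 k) * r := by
        push_cast; rw [ht, ← hN]; linear_combination hab
      have e2 : N t * N x = (a - A * N x) ^ 2 - 2 * (b - B * N x) ^ 2 := by
        apply icast_inj (L := k)
        have e3 := congrArg q.os e1
        simp only [map_add, map_mul, map_intCast, hrs, q.os_os] at e3
        have : ((N t * N x : ℤ) : 𝓞 k) = (t * q.os x) * (q.os t * x) := by
          push_cast; rw [← hN, ← hN]; ring
        rw [this, e1, e3]
        push_cast
        linear_combination (-(b - B * N x : 𝓞 k) ^ 2) * h2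
      have e4 : 2 * |N t * N x| ≤ (N x) ^ 2 := by
        rw [e2]
        have := sq_nonneg (a - A * N x)
        have := sq_nonneg (b - B * N x)
        have : |(a - A * N x) ^ 2 - 2 * (b - B * N x) ^ 2| * 2 ≤ (N x) ^ 2 := by
          rw [← abs_two, ← abs_mul, abs_le, abs_two]; constructor <;> nlinarith
        linarith
      rw [abs_mul, ← sq_abs (N x)] at e4
      have hpos : 0 < |N x| := abs_pos.2 hn
      have : |N x| ≤ |N t| := by
        rw [Int.abs_eq_natAbs, Int.abs_eq_natAbs]; exact_mod_cast hmin
      nlinarith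
    rw [ht, sub_eq_zero] at ht0
    show y ∈ Ideal.span {x}
    rw [ht0]; exact Ideal.mul_mem_left _ _ (Ideal.mem_span_singleton_self _)
  · show Ideal.span {x} ≤ I
    rw [Ideal.span_singleton_le_iff_mem]; exact hxI

lemma h_two (r : 𝓞 k) (hr : (r : k) = q.r) (h2 : r ^ 2 = 2) (hrs : q.os r = -r) : Nat.card (ClassGroup (𝓞 k)) = 1 := by
  rw [Nat.card_eq_fintype_card]
  exact classNumber_eq_one_iff.2 (q.pid_two r hr h2 hrs)

lemma nm_unit (x : 𝓞 k) (n : ℤ) (h : x * q.os x = n) (hn : IsUnit n) : IsUnit x := by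
  have : IsUnit (x * q.os x) := by rw [h]; exact hn.map (Int.castRingHom (𝓞 k))
  exact isUnit_of_mul_isUnit_left this

lemma nm_of_unit (u : (𝓞 k)ˣ) (n : ℤ) (h : (u : 𝓞 k) * q.os u = n) : IsUnit n := by
  obtain ⟨v', hv'⟩ := q.nm_int (u⁻¹ : (𝓞 k)ˣ)
  have h1 : (n : 𝓞 k) * v' = 1 := by
    rw [← h, ← hv']
    have : (u : 𝓞 k) * q.os u * ((u⁻¹ : (𝓞 k)ˣ) * q.os (u⁻¹ : (𝓞 k)ˣ)) = (u * (u⁻¹ : (𝓞 k)ˣ)) * q.os (u * (u⁻¹ : (𝓞 k)ˣ)) := by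
      rw [map_mul]; ring
    rw [this, Units.mul_inv]; simp
  exact IsUnit.of_mul_eq_one v' (icast_inj (L := k) (by push_cast; exact h1))

lemma rep_two (r : 𝓞 k) (hr : (r : k) = q.r) (h2 : r ^ 2 = 2) (hrs : q.os r = -r) (p : ℕ) (hp : p.Prime) (hp8 : p % 8 = 1) :
    ∃ u v : ℤ, u ^ 2 - 2 * v ^ 2 = p ∧ 0 < u := by
  haveI := q.pid_two r hr h2 hrs
  haveI := Fact.mk hp
  have hpi := Nat.prime_iff_prime_int.1 hp
  have hr0 : r ≠ 0 := by rintro rfl; norm_num at h2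
  obtain ⟨x, hx⟩ := (ZMod.exists_sq_eq_two_iff (p := p) (by rintro rfl; omega)).2 (Or.inl hp8)
  obtain ⟨z, rfl⟩ := ZMod.intCast_surjective x
  have hz : (p : ℤ) ∣ z * z - 2 := by
    rw [← ZMod.intCast_zmod_eq_zero_iff_dvd]; push_cast; rw [← hx]; ring
  obtain ⟨t, ht⟩ := hz
  have ht' : (z * z - 2 : 𝓞 k) = p * t := by exact_mod_cast ht
  have hp0 : (p : 𝓞 k) ≠ 0 := by exact_mod_cast hp.ne_zero
  have hnd : ∀ s : ℤ, IsUnit s → ¬ (p : 𝓞 k) ∣ z + s * r := by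
    rintro s hs ⟨c, hc⟩
    obtain ⟨a, b, rfl⟩ := q.int_of_two r hr h2 c
    have : (z + s * r : 𝓞 k) = ((p * a : ℤ) : 𝓞 k) + ((p * b : ℤ) : 𝓞 k) * r := by
      rw [hc]; push_cast; ring
    have h3 := (q.add_eq hrs hr0 this).2
    exact hpi.not_unit (isUnit_of_dvd_unit ⟨b, h3⟩ hs)
  have hnp : ¬ Prime (p : 𝓞 k) := by
    intro hP
    have : (p : 𝓞 k) ∣ (z + (1 : ℤ) * r) * (z + (-1 : ℤ) * r) := ⟨t, by push_cast; linear_combination ht' - h2⟩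
    rcases hP.dvd_or_dvd this with h | h
    · exact hnd 1 isUnit_one h
    · exact hnd (-1) isUnit_one.neg h
  rw [← irreducible_iff_prime, irreducible_iff] at hnp
  push Not at hnp
  have hpu : ¬ IsUnit (p : 𝓞 k) := by
    intro hu
    have := q.nm_of_unit hu.unit (p * p) (by push_cast; simp)
    exact hpi.not_unit (isUnit_of_mul_isUnit_left this)
  obtain ⟨α, β, hαβ, hα, hβ⟩ := hnp hpu
  obtain ⟨m, hm⟩ := q.nm_int α
  obtain ⟨n, hn⟩ := q.nm_int β
  have hmn : m * n = p ^ 2 := by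
    apply icast_inj (L := k)
    push_cast
    rw [← hm, ← hn, sq]
    have h5 : q.os α * q.os β = p := by rw [← map_mul, ← hαβ, map_natCast]
    rw [show α * q.os α * (β * q.os β) = (α * β) * (q.os α * q.os β) by ring, h5, ← hαβ]
  have hmu : ¬ IsUnit m := fun h => hα (q.nm_unit α m hm h)
  have hnu : ¬ IsUnit n := fun h => hβ (q.nm_unit β n hn h)
  have hm' : m.natAbs = p := by
    have h1 : m.natAbs * n.natAbs = p ^ 2 := by rw [← Int.natAbs_mul, hmn]; simp [Int.natAbs_pow]
    obtain ⟨i, hi, hi'⟩ := (Nat.dvd_prime_pow hp).1 (Dvd.intro _ h1)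
    rw [Int.isUnit_iff_natAbs_eq] at hmu hnu
    interval_cases i
    · simp at hi'; omega
    · simpa using hi'
    · exfalso
      rw [hi'] at h1
      have : 0 < p ^ 2 := by have := hp.pos; positivity
      exact hnu (Nat.eq_of_mul_eq_mul_left this (by omega))
  obtain ⟨a, b, rfl⟩ := q.int_of_two r hr h2 α
  have hm2 : m = a ^ 2 - 2 * b ^ 2 := by
    apply icast_inj (L := k)
    rw [← hm]
    simp only [map_add, map_mul, map_intCast, hrs]
    push_cast; linear_combination -b ^ 2 * h2
  have fin : ∃ u v : ℤ, u ^ 2 - 2 * v ^ 2 = p := by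
    rcases Int.natAbs_eq m with h | h
    · exact ⟨a, b, by rw [← hm2, h, hm']⟩
    · refine ⟨a + 2 * b, a + b, ?_⟩
      have : m = -p := by rw [h, hm']
      linear_combination -this + hm2
  obtain ⟨u, v, huv⟩ := fin
  have hu0 : u ≠ 0 := by
    rintro rfl
    have : (0 : ℤ) < p := by exact_mod_cast hp.pos
    nlinarith [sq_nonneg v]
  exact ⟨|u|, v, by rw [sq_abs]; exact huv, abs_pos.2 hu0⟩

end
end QE
end Q2
end

section
open NumberField nonZeroDivisors
namespace Q2
set_option linter.all false

/-- biquadratic data: `K` over `ℚ` with its three quadratic subfields -/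
structure BQ (k0 k1 k2 K : Type*) [Field k0] [NumberField k0] [Field k1] [NumberField k1]
    [Field k2] [NumberField k2] [Field K] [NumberField K] (p d : ℕ) where
  Q0 : QE ℚ k0
  Q1 : QE ℚ k1
  Q2 : QE ℚ k2
  q0 : QE k0 K
  q1 : QE k1 K
  q2 : QE k2 K
  r0 : 𝓞 k0
  r1 : 𝓞 k1
  r2 : 𝓞 k2
  hr0 : (r0 : k0) = Q0.r
  hr1 : (r1 : k1) = Q1.r
  hr2 : (r2 : k2) = Q2.r
  s0 : r0 ^ 2 = 2
  s1 : r1 ^ 2 = (p : 𝓞 k1) * d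
  s2 : r2 ^ 2 = 2 * (p : 𝓞 k2) * d
  m : q2.of r2 = q0.of r0 * q1.of r1
  e0 : q0.r = (q1.of r1 : 𝓞 K)
  e1 : q1.r = (q0.of r0 : 𝓞 K)
  e2 : q2.r = (q0.of r0 : 𝓞 K)

lemma QE.comm {k K : Type*} [Field k] [NumberField k] [Field K] [NumberField K] (q : QE ℚ k)
    (f : k →+* K) (s : K →+* K) (h : s (f q.r) = - f q.r) (x : k) : s (f x) = f (q.s x) := by
  obtain ⟨a, b, rfl⟩ := q.decomp x
  have h1 : ∀ a : ℚ, s (f (q.f a)) = f (q.f a) := fun a => by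
    have : (s.comp (f.comp q.f)) = f.comp q.f := Subsingleton.elim _ _
    exact congrArg (fun g : ℚ →+* K => g a) this
  simp only [map_add, map_mul, h, h1, q.sf, q.sr, map_neg]

lemma QE.os_r {k K : Type*} [Field k] [NumberField k] [Field K] [NumberField K] (q : QE k K) (r : 𝓞 K) (h : (r : K) = q.r) :
    q.os r = -r := by
  apply RingOfIntegers.ext
  show q.s r = -(r : K)
  rw [h, q.sr]

namespace BQ
variable {k0 k1 k2 K : Type*} [Field k0] [NumberField k0] [Field k1] [NumberField k1]
    [Field k2] [NumberField k2] [Field K] [NumberField K] {p d : ℕ} (S : BQ k0 k1 k2 K p d)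

/-- root of two in K -/
noncomputable def a : 𝓞 K := S.q0.of S.r0
/-- root of pd in K -/
noncomputable def b : 𝓞 K := S.q1.of S.r1

lemma a2 : S.a ^ 2 = 2 := by unfold a; rw [← map_pow, S.s0]; exact map_ofNat _ 2
lemma b2 : S.b ^ 2 = (p : 𝓞 K) * d := by unfold b; rw [← map_pow, S.s1, map_mul, map_natCast, map_natCast]
lemma a0 : S.a ≠ 0 := by
  intro h
  have := S.a2
  rw [h] at this; norm_num at this
lemma sa0 : S.q0.os S.a = S.a := S.q0.os_of _
lemma sb1 : S.q1.os S.b = S.b := S.q1.os_of _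
lemma sb0 : S.q0.os S.b = -S.b := S.q0.os_r _ S.e0.symm
lemma sa1 : S.q1.os S.a = -S.a := S.q1.os_r _ S.e1.symm
lemma sa2 : S.q2.os S.a = -S.a := S.q2.os_r _ S.e2.symm
lemma sb2 : S.q2.os S.b = -S.b := by
  have h1 : S.q2.os (S.a * S.b) = S.a * S.b := by
    unfold a b; rw [← S.m]; exact S.q2.os_of _
  rw [map_mul, S.sa2] at h1
  apply mul_left_cancel₀ S.a0
  linear_combination -h1
lemma Qs0 : S.Q0.os S.r0 = -S.r0 := S.Q0.os_r _ S.hr0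
lemma Qs1 : S.Q1.os S.r1 = -S.r1 := S.Q1.os_r _ S.hr1
lemma Qs2 : S.Q2.os S.r2 = -S.r2 := S.Q2.os_r _ S.hr2

lemma cv {x y : 𝓞 K} (h : x = y) : (x : K) = y := by rw [h]

lemma c01 (x : k1) : S.q0.s (S.q1.f x) = S.q1.f (S.Q1.s x) := by
  apply S.Q1.comm; rw [← S.hr1]; exact cv S.sb0
lemma c21 (x : k1) : S.q2.s (S.q1.f x) = S.q1.f (S.Q1.s x) := by
  apply S.Q1.comm; rw [← S.hr1]; exact cv S.sb2
lemma c10 (x : k0) : S.q1.s (S.q0.f x) = S.q0.f (S.Q0.s x) := by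
  apply S.Q0.comm; rw [← S.hr0]; exact cv S.sa1
lemma c20 (x : k0) : S.q2.s (S.q0.f x) = S.q0.f (S.Q0.s x) := by
  apply S.Q0.comm; rw [← S.hr0]; exact cv S.sa2
lemma c02 (x : k2) : S.q0.s (S.q2.f x) = S.q2.f (S.Q2.s x) := by
  apply S.Q2.comm; rw [← S.hr2]
  have : S.q0.os (S.q2.of S.r2) = - S.q2.of S.r2 := by
    rw [S.m, map_mul]
    rw [show S.q0.os (S.q0.of S.r0) = S.q0.of S.r0 from S.sa0, show S.q0.os (S.q1.of S.r1) = -S.q1.of S.r1 from S.sb0]; ring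
  exact cv this
lemma c12 (x : k2) : S.q1.s (S.q2.f x) = S.q2.f (S.Q2.s x) := by
  apply S.Q2.comm; rw [← S.hr2]
  have : S.q1.os (S.q2.of S.r2) = - S.q2.of S.r2 := by
    rw [S.m, map_mul]
    rw [show S.q1.os (S.q0.of S.r0) = -S.q0.of S.r0 from S.sa1, show S.q1.os (S.q1.of S.r1) = S.q1.of S.r1 from S.sb1]; ring
  exact cv this

lemma s2_eq (x : K) : S.q2.s x = S.q0.s (S.q1.s x) := by
  obtain ⟨u, v, rfl⟩ := S.q2.decomp x
  have h0 := cv S.sa0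
  have h1 := cv S.sa1
  have h2 := cv S.sa2
  have h0 : S.q0.s (S.a : K) = S.a := h0
  have h1 : S.q1.s (S.a : K) = -S.a := h1
  have h2 : S.q2.s (S.a : K) = -S.a := h2
  rw [show S.q2.r = (S.a : K) from S.e2]
  simp only [map_add, map_mul, S.c12, S.c02, S.q2.sf, S.Q2.ss, h0, h1, h2, map_neg]

lemma s01 (x : K) : S.q0.s (S.q1.s x) = S.q1.s (S.q0.s x) := by
  have h1 := S.q2.ss x
  rw [S.s2_eq, S.s2_eq] at h1
  have h2 := congrArg S.q0.s h1
  rw [S.q0.ss] at h2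
  have h3 := congrArg S.q1.s h2
  rw [S.q1.ss] at h3
  exact h3

lemma ti2 (x : IG K) : S.q2.ti x = S.q0.ti (S.q1.ti x) := by
  rw [im_comp, ← (RingHom.ext S.s2_eq : S.q2.s = S.q0.s.comp S.q1.s)]

lemma ti01 (x : IG K) : S.q0.ti (S.q1.ti x) = S.q1.ti (S.q0.ti x) := by
  rw [im_comp, im_comp, (RingHom.ext S.s01 : S.q0.s.comp S.q1.s = S.q1.s.comp S.q0.s)]

lemma h0 (S : BQ k0 k1 k2 K p d) : Nat.card (ClassGroup (𝓞 k0)) = 1 := S.Q0.h_two S.r0 S.hr0 S.s0 S.Qs0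

lemma J0 (x : IG K) : x * S.q0.ti x ∈ (dvv K).range := by
  obtain ⟨y, hy⟩ := S.q0.mul_ti_mem x
  have hF : (dvv k0).range = ⊤ := by rw [← Subgroup.index_eq_one, ← card_cl, S.h0]
  have : y ∈ (dvv k0).range := by rw [hF]; trivial
  obtain ⟨c, rfl⟩ := this
  rw [← hy, im_dvv]; exact ⟨_, rfl⟩

lemma ker_eq : (dvv K).range.comap (Nh S.q1.ti) = (dvv K).range.comap (Dh S.q2.ti) := by
  ext x
  rw [Subgroup.mem_comap, Subgroup.mem_comap, Nh_apply, Dh_apply, S.ti2]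
  have := S.J0 (S.q1.ti x)
  rw [← Subgroup.mul_mem_cancel_right (y := x / _) _ this, show x / S.q0.ti (S.q1.ti x) * (S.q1.ti x * S.q0.ti (S.q1.ti x)) = x * S.q1.ti x by
    rw [div_eq_mul_inv]; rw [mul_comm (S.q1.ti x), ← mul_assoc, inv_mul_cancel_right]]

lemma unram2 (hp4 : p % 4 = 1) (hd4 : d % 4 = 1) : Fx S.q2.ti ≤ S.q2.J := by
  have hD : ((p * d : ℕ) : ℤ) = 4 * ((p * d / 4 : ℕ) : ℤ) + 1 := by
    have : p * d % 4 = 1 := by rw [Nat.mul_mod, hp4, hd4]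
    omega
  obtain ⟨θ, hθ, hθ'⟩ := S.q2.theta (p * d / 4 : ℕ) (p * d : ℕ) hD S.b (by rw [S.b2]; push_cast; rfl) S.sb2
  apply S.q2.unram_sq θ S.a S.b (2 * S.a) hθ' (by rw [S.sa2]; ring) (p * d : ℕ) 8
  · apply Int.isCoprime_iff_gcd_eq_one.2
    have : (p * d) % 2 = 1 := by
      have : p * d % 4 = 1 := by rw [Nat.mul_mod, hp4, hd4]
      omega
    show Nat.Coprime (p * d) 8
    rw [show 8 = 2 ^ 3 by norm_num]
    apply Nat.Coprime.pow_right
    rw [Nat.coprime_comm, Nat.coprime_two_left]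
    exact Nat.odd_iff.2 this
  · rw [S.b2]; push_cast; rfl
  · push_cast; linear_combination 4 * S.a2

end BQ
end Q2
end

section
open NumberField nonZeroDivisors
namespace Q2
set_option linter.all false

section
variable (F : Type*) [Field F] [NumberField F]

/-- plus or minus squares of units -/
noncomputable def pmS : Subgroup Fˣ := (dvv F).ker.map (sqh Fˣ) ⊔ Subgroup.closure {(-1 : Fˣ)}

lemma neg_one_ker : (-1 : Fˣ) ∈ (dvv F).ker := by
  rw [mem_ker_dvv]; exact ⟨-1, by simp⟩

lemma pmS_le : pmS F ≤ (dvv F).ker := by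
  refine sup_le ?_ ?_
  · rintro _ ⟨x, hx, rfl⟩
    rw [sqh_apply]; exact Subgroup.pow_mem _ hx 2
  · rw [Subgroup.closure_le, Set.singleton_subset_iff]; exact neg_one_ker F

variable {F}
lemma mem_pmS (x : Fˣ) : x ∈ pmS F ↔ ∃ v ∈ (dvv F).ker, x = v ^ 2 ∨ x = - v ^ 2 := by
  constructor
  · intro h
    obtain ⟨y, ⟨v, hv, rfl⟩, z, hz, rfl⟩ := Subgroup.mem_sup.1 h
    obtain ⟨n, rfl⟩ := Subgroup.mem_closure_singleton.1 hz
    refine ⟨v, hv, ?_⟩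
    rw [sqh_apply]
    rcases Int.even_or_odd n with hn | hn
    · left; rw [hn.neg_one_zpow, mul_one]
    · right; rw [hn.neg_one_zpow, mul_neg_one]
  · rintro ⟨v, hv, rfl | rfl⟩
    · exact Subgroup.mem_sup_left ⟨v, hv, by rw [sqh_apply]⟩
    · rw [← mul_neg_one]
      exact Subgroup.mul_mem_sup ⟨v, hv, by rw [sqh_apply]⟩ (Subgroup.subset_closure rfl)

lemma pm_idx [IsTotallyReal F] (hF : Module.finrank ℚ F = 2) : (pmS F).relIndex (dvv F).ker = 2 := by
  have h1 := Subgroup.relIndex_mul_relIndex ((dvv F).ker.map (sqh Fˣ)) (pmS F) (dvv F).ker le_sup_left (pmS_le F)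
  rw [sq_ker, hF] at h1
  have h2 : ((dvv F).ker.map (sqh Fˣ)).relIndex (pmS F) ∣ 2 ^ 1 := by
    have := relIndex_two_pow ((dvv F).ker.map (sqh Fˣ)) (pmS F) {(-1 : Fˣ)} le_sup_left
      (by intro g hg; rw [Finset.mem_singleton] at hg; subst hg; rw [neg_one_sq]; exact Subgroup.one_mem _) (by rw [Finset.coe_singleton]; exact le_rfl)
    rw [Finset.card_singleton] at this; exact this
  have h3 : 2 ∣ ((dvv F).ker.map (sqh Fˣ)).relIndex (pmS F) := by
    have hm : (-1 : Fˣ) ∈ pmS F := (mem_pmS _).2 ⟨1, Subgroup.one_mem _, Or.inr (by rw [one_pow])⟩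
    refine two_dvd_relIndex _ _ (-1 : Fˣ) hm ?_ ?_
    · rintro ⟨x, _, hx⟩
      have := congrArg (fun z : Fˣ => (z : F)) hx
      rw [sqh_apply] at this
      exact neg_one_not_sq (x : F) (by simpa using this)
    · rw [neg_one_sq]; exact Subgroup.one_mem _
  have h4 := Nat.dvd_antisymm (by rw [pow_one] at h2; exact h2) h3
  rw [h4] at h1; omega
end

namespace QE
variable {F L : Type*} [Field F] [NumberField F] [Field L] [NumberField L] (q : QE F L)
variable [IsTotallyReal F]

lemma nm_le : (dvv L).ker.map (Nh q.su) ≤ (dvv F).ker.map q.fu := by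
  rw [← q.E0_eq]
  rintro _ ⟨x, hx, rfl⟩
  refine ⟨?_, ?_⟩
  · show Nh q.su x ∈ (dvv L).ker
    rw [Nh_apply]; exact Subgroup.mul_mem _ hx (q.su_ker _ hx)
  · show Nh q.su x ∈ Fx q.su
    rw [mem_Fx, Nh_apply, map_mul, q.su_su, mul_comm]

lemma nm_sub (hF : Module.finrank ℚ F = 2)
    (h : ∀ η : (𝓞 L)ˣ, ∃ v : (𝓞 F)ˣ, (η : 𝓞 L) * q.os η = q.of (v ^ 2 : (𝓞 F)ˣ) ∨ (η : 𝓞 L) * q.os η = - q.of (v ^ 2 : (𝓞 F)ˣ)) :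
    2 ∣ ((dvv L).ker.map (Nh q.su)).relIndex ((dvv L).ker ⊓ Fx q.su) := by
  have h1 : (dvv L).ker.map (Nh q.su) ≤ (pmS F).map q.fu := by
    rintro _ ⟨x, hx, rfl⟩
    obtain ⟨η, hη⟩ := (mem_ker_dvv x).1 hx
    obtain ⟨v, hv⟩ := h η
    have hvk : ue F v ∈ (dvv F).ker := by rw [← ue_range]; exact ⟨v, rfl⟩
    rcases hv with hv | hv
    · refine ⟨(ue F v) ^ 2, (mem_pmS _).2 ⟨_, hvk, Or.inl rfl⟩, ?_⟩
      apply Units.ext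
      have := congrArg (fun z : 𝓞 L => (z : L)) hv
      rw [Nh_apply]
      show q.f (((ue F v) ^ 2 : Fˣ) : F) = x * q.s x
      rw [← hη]
      exact this.symm
    · refine ⟨-(ue F v) ^ 2, (mem_pmS _).2 ⟨_, hvk, Or.inr rfl⟩, ?_⟩
      apply Units.ext
      have := congrArg (fun z : 𝓞 L => (z : L)) hv
      rw [Nh_apply]
      show q.f ((-(ue F v) ^ 2 : Fˣ) : F) = x * q.s x
      rw [← hη, Units.val_neg, map_neg]
      exact this.symm
  rw [q.E0_eq]
  have h2 : (pmS F).map q.fu ≤ (dvv F).ker.map q.fu := Subgroup.map_mono (pmS_le F)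
  rw [← Subgroup.relIndex_mul_relIndex _ _ _ h1 h2, Subgroup.relIndex_map_map_of_injective _ _ q.fu_inj, pm_idx hF]
  exact dvd_mul_left _ _

lemma pm_le_nm (h : ∃ η : (𝓞 L)ˣ, (η : 𝓞 L) * q.os η = -1) : (pmS F).map q.fu ≤ (dvv L).ker.map (Nh q.su) := by
  rintro _ ⟨x, hx, rfl⟩
  obtain ⟨v, hv, hx⟩ := (mem_pmS x).1 hx
  have hv1 : q.fu v ∈ (dvv L).ker := (q.E0_eq ▸ (⟨v, hv, rfl⟩ : q.fu v ∈ (dvv F).ker.map q.fu) : q.fu v ∈ (dvv L).ker ⊓ Fx q.su).1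
  have hs : Nh q.su (q.fu v) = q.fu (v ^ 2) := by
    rw [Nh_apply, map_pow, sq]; congr 1
    apply Units.ext; exact q.sf v
  rcases hx with rfl | rfl
  · exact ⟨_, hv1, hs⟩
  · obtain ⟨η, hη⟩ := h
    refine ⟨q.fu v * ue L η, Subgroup.mul_mem _ hv1 (by rw [← ue_range]; exact ⟨η, rfl⟩), ?_⟩
    rw [map_mul, hs]
    have : Nh q.su (ue L η) = -1 := by
      rw [Nh_apply]; apply Units.ext
      have := congrArg (fun z : 𝓞 L => (z : L)) hη
      simp only [map_neg, map_one] at this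
      exact this
    rw [this]
    apply Units.ext
    simp

lemma nm_dvd (hF : Module.finrank ℚ F = 2) (h : ∃ η : (𝓞 L)ˣ, (η : 𝓞 L) * q.os η = -1) :
    ((dvv L).ker.map (Nh q.su)).relIndex ((dvv L).ker ⊓ Fx q.su) ∣ 2 := by
  rw [q.E0_eq]
  have := Subgroup.relIndex_mul_relIndex _ _ _ (q.pm_le_nm h) q.nm_le
  rw [Subgroup.relIndex_map_map_of_injective _ _ q.fu_inj, pm_idx hF] at this
  exact Dvd.intro_left _ this

lemma nm_sup (hF : Module.finrank ℚ F = 2) (h : ∃ η : (𝓞 L)ˣ, (η : 𝓞 L) * q.os η = -1)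
    (h2 : 2 ∣ ((dvv L).ker.map (Nh q.su)).relIndex ((dvv L).ker ⊓ Fx q.su)) (η : (𝓞 L)ˣ) :
    ∃ v : (𝓞 F)ˣ, (η : 𝓞 L) * q.os η = q.of (v ^ 2 : (𝓞 F)ˣ) ∨ (η : 𝓞 L) * q.os η = - q.of (v ^ 2 : (𝓞 F)ˣ) := by
  rw [q.E0_eq] at h2
  have := Subgroup.relIndex_mul_relIndex _ _ _ (q.pm_le_nm h) q.nm_le
  rw [Subgroup.relIndex_map_map_of_injective _ _ q.fu_inj, pm_idx hF] at this
  have h3 : ((pmS F).map q.fu).relIndex ((dvv L).ker.map (Nh q.su)) = 1 := by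
    obtain ⟨c, hc⟩ := h2
    rw [hc] at this
    have h5 : ((pmS F).map q.fu).relIndex ((dvv L).ker.map (Nh q.su)) ∣ 1 := ⟨c, by linarith⟩
    exact Nat.dvd_one.1 h5
  rw [Subgroup.relIndex_eq_one] at h3
  have hη : ue L η ∈ (dvv L).ker := by rw [← ue_range]; exact ⟨η, rfl⟩
  obtain ⟨x, hx, he⟩ := h3 ⟨_, hη, rfl⟩
  obtain ⟨v, hv, hx⟩ := (mem_pmS x).1 hx
  rw [← ue_range] at hv
  obtain ⟨w, rfl⟩ := hv
  refine ⟨w, ?_⟩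
  have he2 : q.f x = (η : 𝓞 L) * q.s (η : 𝓞 L) := by
    have := congrArg (fun z : Lˣ => (z : L)) he
    rw [Nh_apply] at this
    exact this
  rcases hx with rfl | rfl
  · left
    apply RingOfIntegers.ext; exact he2.symm
  · right
    apply RingOfIntegers.ext
    rw [Units.val_neg, map_neg] at he2
    have he3 := he2.symm
    exact he3

end QE
end Q2
end

section
open NumberField nonZeroDivisors
namespace Q2
set_option linter.all false

lemma sq_cancel {L : Type*} [Field L] [NumberField L] {A B : Ideal (𝓞 L)} (h : A * A = B * B) : A = B := by
  have h3 : A ^ 2 = B ^ 2 := by rw [sq, sq, h]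
  have ha : A ∣ B := (UniqueFactorizationMonoid.pow_dvd_pow_iff_dvd (two_ne_zero)).1 (dvd_of_eq h3)
  have hb : B ∣ A := (UniqueFactorizationMonoid.pow_dvd_pow_iff_dvd (two_ne_zero)).1 (dvd_of_eq h3.symm)
  exact le_antisymm (Ideal.dvd_iff_le.1 hb) (Ideal.dvd_iff_le.1 ha)

/-- ideals coming from ℚ -/
noncomputable def Rt (K : Type*) [Field K] [NumberField K] : Subgroup (IG K) := (im (algebraMap ℚ K)).range

lemma Rt_dvv {K : Type*} [Field K] [NumberField K] (x : Kˣ) (c : ℚ) (h : (x : K) = algebraMap ℚ K c) : dvv K x ∈ Rt K := by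
  have hc : c ≠ 0 := by rintro rfl; rw [map_zero] at h; exact x.ne_zero h
  refine ⟨dvv ℚ (Units.mk0 c hc), ?_⟩
  rw [im_dvv]; congr 1
  exact Units.ext h.symm

lemma int_pm {n : ℤ} (h : IsUnit n) : n = 1 ∨ n = -1 := Int.isUnit_iff.1 h

namespace BQ
variable {k0 k1 k2 K : Type*} [Field k0] [NumberField k0] [Field k1] [NumberField k1]
    [Field k2] [NumberField k2] [Field K] [NumberField K] {p d : ℕ} (S : BQ k0 k1 k2 K p d)

/-- unit index one -/
def UI (S : BQ k0 k1 k2 K p d) : Prop := ∀ η : (𝓞 K)ˣ, ∃ (u0 : (𝓞 k0)ˣ) (u1 : (𝓞 k1)ˣ) (u2 : (𝓞 k2)ˣ),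
  (η : 𝓞 K) = S.q0.of u0 * S.q1.of u1 * S.q2.of u2

lemma nmu {k : Type*} [Field k] [NumberField k] (q : QE ℚ k) (u : (𝓞 k)ˣ) (f : k →+* K) (s : K →+* K)
    (h : ∀ x, s (f x) = f (q.s x)) :
    ∃ n : ℤ, (n = 1 ∨ n = -1) ∧ (u : 𝓞 k) * q.os u = n ∧ f (u : 𝓞 k) * s (f (u : 𝓞 k)) = n := by
  obtain ⟨n, hn⟩ := q.nm_int u
  refine ⟨n, int_pm (q.nm_of_unit u n hn), hn, ?_⟩
  rw [h, ← map_mul]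
  have := congrArg (algebraMap (𝓞 k) k) hn
  rw [map_mul, map_intCast] at this
  have h2 : ((u : 𝓞 k) : k) * q.s (u : 𝓞 k) = n := this
  rw [h2, map_intCast]

lemma rat_of_fix (R : K) (h0 : S.q0.s R = R) (h1 : S.q1.s R = R) : ∃ c : ℚ, R = algebraMap ℚ K c := by
  obtain ⟨y, rfl⟩ := S.q0.fix R h0
  rw [S.c10] at h1
  obtain ⟨c, rfl⟩ := S.Q0.fix y (S.q0.f.injective h1)
  refine ⟨c, ?_⟩
  have : S.q0.f.comp S.Q0.f = algebraMap ℚ K := Subsingleton.elim _ _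
  exact congrArg (fun g : ℚ →+* K => g c) this

lemma amb_rat [IsTotallyReal K] (hq : S.UI) (x : IG K) (hx : x ∈ (dvv K).range) (hf : x ∈ Fx S.q1.ti) :
    x * S.q0.ti x ∈ Rt K := by
  obtain ⟨γ, rfl⟩ := hx
  rw [mem_Fx, S.q1.ti_dvv] at hf
  have hk : S.q1.su γ / γ ∈ (dvv K).ker := by rw [MonoidHom.mem_ker, map_div, hf, div_self']
  obtain ⟨η, hη⟩ := (mem_ker_dvv _).1 hk
  obtain ⟨u0, u1, u2, hu⟩ := hq η
  have hg : S.q1.s (γ : K) = γ * ((η : 𝓞 K) : K) := by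
    rw [hη, Units.val_div_eq_div_val]
    field_simp
    rfl
  set U0 : K := S.q0.f (u0 : 𝓞 k0) with hU0
  set U1 : K := S.q1.f (u1 : 𝓞 k1) with hU1
  set U2 : K := S.q2.f (u2 : 𝓞 k2) with hU2
  have hu' : ((η : 𝓞 K) : K) = U0 * U1 * U2 := by rw [hu]; rfl
  rw [hu'] at hg
  obtain ⟨n0, hn0, -, h01⟩ := nmu S.Q0 u0 S.q0.f S.q1.s S.c10
  obtain ⟨n1, hn1, hn1', h10⟩ := nmu S.Q1 u1 S.q1.f S.q0.s S.c01
  obtain ⟨n2, hn2, hn2', h20⟩ := nmu S.Q2 u2 S.q2.f S.q0.s S.c02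
  obtain ⟨n2', _, hn2'', h21⟩ := nmu S.Q2 u2 S.q2.f S.q1.s S.c12
  have : n2' = n2 := icast_inj (L := k2) (by rw [← hn2', hn2''])
  subst this
  have h00 : S.q0.s U0 = U0 := S.q0.sf _
  have h11 : S.q1.s U1 = U1 := S.q1.sf _
  rw [← hU0] at h01
  rw [← hU1] at h10
  rw [← hU2] at h20 h21
  have hγ0 : (γ : K) ≠ 0 := γ.ne_zero
  have e1 : U1 ^ 2 * (n0 * n2') = 1 := by
    have h := S.q1.ss (γ : K)
    rw [hg, map_mul, hg, map_mul, map_mul, h11] at h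
    apply mul_left_cancel₀ hγ0
    linear_combination h - γ * U1 ^ 2 * (U2 * S.q1.s U2) * h01 - γ * U1 ^ 2 * n0 * h21
  have e2 : n0 = n2' ∧ (n2' : K) ^ 2 = 1 := by
    have hneg : U1 ^ 2 ≠ -1 := neg_one_not_sq U1
    rcases hn0 with rfl | rfl <;> rcases hn2 with rfl | rfl
    · simp
    · exfalso; apply hneg; push_cast at e1; linear_combination -e1
    · exfalso; apply hneg; push_cast at e1; linear_combination -e1
    · simp
  obtain ⟨rfl, e3⟩ := e2
  have e4 : U1 = 1 ∨ U1 = -1 := by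
    exact mul_self_eq_one_iff.1 (by linear_combination e1 - U1 ^ 2 * e3)
  have e5 : (n1 : K) = 1 := by
    rcases e4 with h | h <;> rw [h] at h10 <;> simp at h10 <;> exact_mod_cast h10.symm
  have hR0 : S.q0.s (γ * S.q0.s γ * U0) = γ * S.q0.s γ * U0 := by
    rw [map_mul, map_mul, S.q0.ss, h00]; ring
  have hR1 : S.q1.s (γ * S.q0.s γ * U0) = γ * S.q0.s γ * U0 := by
    rw [map_mul, map_mul, ← S.s01, hg, map_mul, map_mul, map_mul, h00]
    linear_combination γ * S.q0.s γ * (U1 * S.q0.s U1 * (U2 * S.q0.s U2)) * U0 * h01 +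
      γ * S.q0.s γ * (U1 * S.q0.s U1) * U0 * n0 * h20 + γ * S.q0.s γ * U0 * n0 ^ 2 * (h10 + e5) + γ * S.q0.s γ * U0 * e3
  obtain ⟨c, hc⟩ := S.rat_of_fix _ hR0 hR1
  rw [S.q0.ti_dvv, ← map_mul]
  have : dvv K (γ * S.q0.su γ) = dvv K (γ * S.q0.su γ * S.q0.fu (ue k0 u0)) := by
    rw [map_mul _ _ (S.q0.fu _)]
    have h1 : S.q0.fu (ue k0 u0) ∈ (dvv K).ker := by
      rw [mem_ker_dvv]
      exact ⟨Units.map S.q0.of.toMonoidHom u0, rfl⟩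
    rw [MonoidHom.mem_ker.1 h1, mul_one]
  rw [this]
  exact Rt_dvv _ c hc

lemma av2 : (S.a : K) ^ 2 = 2 := by
  have := congrArg (algebraMap (𝓞 K) K) S.a2
  rw [map_pow, map_ofNat] at this; exact this

/-- the ideal of root two -/
noncomputable def tw : IG K := dvv K (Units.mk0 (S.a : K) (by
  have := S.a0; intro h; apply this; exact RingOfIntegers.ext h))

lemma tw_ii (h) : ii (Ideal.span {S.a}) h = S.tw := ii_span _ S.a0 _ _

lemma tw_sq : S.tw ^ 2 ∈ Rt K := by
  unfold tw
  rw [← map_pow]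
  refine Rt_dvv _ 2 ?_
  have h2 := S.av2
  simpa using h2

lemma tw_not : S.tw ∉ Rt K := by
  rintro ⟨z, hz⟩
  have hF : (dvv ℚ).range = ⊤ := by rw [← Subgroup.index_eq_one, ← card_cl, hQ1]
  have : z ∈ (dvv ℚ).range := by rw [hF]; trivial
  obtain ⟨c, rfl⟩ := this
  rw [im_dvv, tw] at hz
  set cc := Units.map (algebraMap ℚ K).toMonoidHom c with hcc
  have hk : (Units.mk0 (S.a : K) (by have := S.a0; intro h; apply this; exact RingOfIntegers.ext h)) / cc ∈ (dvv K).ker := by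
    rw [MonoidHom.mem_ker, map_div, hz, div_self']
  obtain ⟨η, hη⟩ := (mem_ker_dvv _).1 hk
  have hc0 : (algebraMap ℚ K c) ≠ 0 := by simp
  have h1 : ((η : 𝓞 K) : K) = (S.a : K) / algebraMap ℚ K c := by
    rw [hη, Units.val_div_eq_div_val]; rfl
  have ha2 : (S.a : K) ^ 2 = 2 := S.av2
  have h2 : (algebraMap ℚ K) ((c : ℚ) ^ 2 * 1) * (((η : 𝓞 K) : K)) ^ 2 = 2 := by
    rw [h1, mul_one, map_pow, div_pow, ha2]; field_simp
  -- the square of η is rational, an integer, and a unit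
  have h3 : (((η : 𝓞 K) : K)) ^ 2 = algebraMap ℚ K (2 / (c : ℚ) ^ 2) := by
    rw [h1, div_pow, ha2, map_div₀, map_pow, map_ofNat]
  have hInt : ∃ n : ℤ, (2 / (c : ℚ) ^ 2) = n := by
    have : IsIntegral ℤ (algebraMap ℚ K (2 / (c : ℚ) ^ 2)) := by
      rw [← h3]; exact (η : 𝓞 K).2.pow 2
    have h4 := (isIntegral_algebraMap_iff (algebraMap ℚ K).injective).1 this
    obtain ⟨n, hn⟩ := IsIntegrallyClosed.isIntegral_iff.1 h4
    exact ⟨n, by simpa using hn.symm⟩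
  have hInt' : ∃ n : ℤ, ((c : ℚ) ^ 2 / 2) = n := by
    have : IsIntegral ℤ (algebraMap ℚ K ((c : ℚ) ^ 2 / 2)) := by
      have h5 : (((η⁻¹ : (𝓞 K)ˣ) : 𝓞 K) : K) ^ 2 = algebraMap ℚ K ((c : ℚ) ^ 2 / 2) := by
        have h6 : (((η⁻¹ : (𝓞 K)ˣ) : 𝓞 K) : K) * ((η : 𝓞 K) : K) = 1 := by
          rw [← map_mul, Units.inv_mul, map_one]
        rw [← inv_div, map_inv₀, ← h3]
        rw [eq_inv_of_mul_eq_one_left h6, inv_pow]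
      rw [← h5]; exact ((η⁻¹ : (𝓞 K)ˣ) : 𝓞 K).2.pow 2
    have h4 := (isIntegral_algebraMap_iff (algebraMap ℚ K).injective).1 this
    obtain ⟨n, hn⟩ := IsIntegrallyClosed.isIntegral_iff.1 h4
    exact ⟨n, by simpa using hn.symm⟩
  obtain ⟨n, hn⟩ := hInt
  obtain ⟨m, hm⟩ := hInt'
  have hcq : (c : ℚ) ≠ 0 := c.ne_zero
  have hnm : m * n = 1 := by
    have : (m : ℚ) * n = 1 := by rw [← hn, ← hm]; field_simp
    exact_mod_cast this
  rcases int_pm (IsUnit.of_mul_eq_one _ hnm) with rfl | rfl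
  · have h7 : (c : ℚ) ^ 2 = 2 := by push_cast at hm; linarith
    have h8 : ((2 : ℚ)).sqrt * (2 : ℚ).sqrt = 2 := (Rat.exists_mul_self 2).1 ⟨c, by linarith⟩
    revert h8; decide +kernel
  · push_cast at hm
    nlinarith [sq_nonneg (c : ℚ)]

end BQ
end Q2
end

section
open NumberField nonZeroDivisors
namespace Q2
set_option linter.all false

namespace BQ
variable {k0 k1 k2 K : Type*} [Field k0] [NumberField k0] [Field k1] [NumberField k1]
    [Field k2] [NumberField k2] [Field K] [NumberField K] {p d : ℕ} (S : BQ k0 k1 k2 K p d)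

lemma oc01 (x : 𝓞 k1) : S.q0.os (S.q1.of x) = S.q1.of (S.Q1.os x) := RingOfIntegers.ext (S.c01 x)

lemma comap_os (P : Ideal (𝓞 K)) : (P.map S.q0.os).comap S.q1.of = (P.comap S.q1.of).map S.Q1.os := by
  ext x
  rw [Ideal.mem_comap, S.q0.mem_map_os, S.oc01, S.Q1.mem_map_os, Ideal.mem_comap]

lemma map_os (P : Ideal (𝓞 k1)) : (P.map S.q1.of).map S.q0.os = (P.map S.Q1.os).map S.q1.of := by
  rw [Ideal.map_map, Ideal.map_map]
  congr 1
  exact RingHom.ext S.oc01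

lemma J1_rat (x : IG K) (hx : x ∈ S.q1.J) : x * S.q0.ti x ∈ Rt K := by
  obtain ⟨y, rfl⟩ := hx
  obtain ⟨z, hz⟩ := S.Q1.mul_ti_mem y
  refine ⟨z, ?_⟩
  have h1 : S.q0.ti (im S.q1.f y) = im S.q1.f (S.Q1.ti y) := by
    rw [im_comp, im_comp, (RingHom.ext S.c01 : S.q0.s.comp S.q1.f = S.q1.f.comp S.Q1.s)]
  rw [h1, ← map_mul, ← hz, im_comp]
  have : S.q1.f.comp S.Q1.f = algebraMap ℚ K := Subsingleton.elim _ _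
  rw [this]

lemma tw_fix0 : S.q0.ti S.tw = S.tw := by
  unfold tw
  rw [S.q0.ti_dvv]; congr 1
  apply Units.ext
  exact cv S.sa0

lemma tw_fix1 : S.q1.ti S.tw = S.tw := by
  unfold tw
  rw [S.q1.ti_dvv]
  have : S.q1.su (Units.mk0 (S.a : K) (by have := S.a0; intro h; apply this; exact RingOfIntegers.ext h)) =
     (Units.mk0 (S.a : K) (by have := S.a0; intro h; apply this; exact RingOfIntegers.ext h)) * (-1) := by
    apply Units.ext
    have := cv S.sa1
    rw [Units.val_mul]
    show S.q1.s S.a = (S.a : K) * (-1)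
    rw [mul_neg_one]
    exact this
  rw [this, map_mul, MonoidHom.mem_ker.1 (neg_one_ker K), mul_one]

lemma tw_sq1 : S.tw ^ 2 ∈ S.q1.J := by
  obtain ⟨z, hz⟩ := S.tw_sq
  refine ⟨im S.Q1.f z, ?_⟩
  rw [im_comp, ← hz]
  have : S.q1.f.comp S.Q1.f = algebraMap ℚ K := Subsingleton.elim _ _
  rw [this]

lemma odd_pd (hp4 : p % 4 = 1) (hd4 : d % 4 = 1) : p * d % 4 = 1 := by rw [Nat.mul_mod, hp4, hd4]

lemma theta1 (S : BQ k0 k1 k2 K p d) (hp4 : p % 4 = 1) (hd4 : d % 4 = 1) (P : Ideal (𝓞 k1)) (hP : P ≠ ⊤) (h2 : (2 : 𝓞 k1) ∈ P)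
   (h : S.r1 ∈ P) : False := by
  have h3 : ((p * d : ℕ) : 𝓞 k1) ∈ P := by
    rw [Nat.cast_mul, ← S.s1, sq]; exact P.mul_mem_left _ h
  have := int_dvd_of_mem P hP 2 Nat.prime_two (by exact_mod_cast h2) (p * d : ℕ) (by exact_mod_cast h3)
  have := odd_pd hp4 hd4
  omega

lemma th1 (S : BQ k0 k1 k2 K p d) (hp4 : p % 4 = 1) (hd4 : d % 4 = 1) : ∃ θ : 𝓞 k1, 2 * θ = 1 + S.r1 ∧ θ - S.Q1.os θ = S.r1 := by
  have hD : ((p * d : ℕ) : ℤ) = 4 * ((p * d / 4 : ℕ) : ℤ) + 1 := by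
    have := odd_pd hp4 hd4
    omega
  exact S.Q1.theta (p * d / 4 : ℕ) (p * d : ℕ) hD S.r1 (by rw [S.s1]; push_cast; rfl) S.Qs1

lemma two_inert (S : BQ k0 k1 k2 K p d) (hp4 : p % 4 = 1) (hd4 : d % 4 = 1) (P : Ideal (𝓞 k1)) (hP : P.IsPrime) (h2 : (2 : 𝓞 k1) ∈ P)
   (h : P.map S.Q1.os = P) : P = Ideal.span {2} := by
  have hP0 := QE.ne_bot_of_mem P 2 two_ne_zero (by exact_mod_cast h2)
  rcases S.Q1.prime_inv P hP0 h with h3 | ⟨-, h3⟩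
  · rw [S.Q1.comap_map P hP 2 Nat.prime_two (by exact_mod_cast h2)] at h3
    rw [← h3]; norm_cast
  · obtain ⟨θ, _, hθ⟩ := S.th1 hp4 hd4
    exfalso
    exact S.theta1 hp4 hd4 P hP.ne_top h2 (hθ ▸ h3 θ)

lemma two_split (S : BQ k0 k1 k2 K p d) (P : Ideal (𝓞 k1)) (hP : P.IsPrime) (h2 : (2 : 𝓞 k1) ∈ P)
   (h : P.map S.Q1.os ≠ P) : P * P.map S.Q1.os = Ideal.span {2} := by
  have hP0 := QE.ne_bot_of_mem P 2 two_ne_zero (by exact_mod_cast h2)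
  apply le_antisymm
  · have := S.Q1.norm_ideal_le P hP0
    rw [S.Q1.comap_map P hP 2 Nat.prime_two (by exact_mod_cast h2)] at this
    exact_mod_cast this
  · obtain ⟨B, hB⟩ := S.Q1.cop_aux (Ideal.span {2}) P (hP.isMaximal hP0) h
      ((Ideal.span_singleton_le_iff_mem _).2 h2) ((Ideal.span_singleton_le_iff_mem _).2 (by
        rw [S.Q1.mem_map_os, map_ofNat]; exact h2))
    exact hB.le.trans Ideal.mul_le_left

lemma aa : Ideal.span {S.a} * Ideal.span {S.a} = Ideal.span {(2 : 𝓞 K)} := by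
  rw [Ideal.span_singleton_mul_span_singleton, ← sq, S.a2]

lemma sq_mem_of_zpow {G : Type*} [CommGroup G] (T : Subgroup G) (P x : G) (hP : P ^ 2 ∈ T) (hx : x ∈ T ⊔ Subgroup.closure {P}) :
    ∃ t ∈ T, x = t ∨ x = t * P := by
  obtain ⟨t, ht, y, hy, rfl⟩ := Subgroup.mem_sup.1 hx
  obtain ⟨n, rfl⟩ := Subgroup.mem_closure_singleton.1 hy
  rcases Int.even_or_odd' n with ⟨m, rfl | rfl⟩
  · refine ⟨t * (P ^ 2) ^ m, T.mul_mem ht (T.zpow_mem hP m), Or.inl ?_⟩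
    rw [zpow_mul]; norm_cast
  · refine ⟨t * (P ^ 2) ^ m, T.mul_mem ht (T.zpow_mem hP m), Or.inr ?_⟩
    rw [zpow_add, zpow_mul, zpow_one, mul_assoc]; norm_cast

set_option maxHeartbeats 800000 in
lemma fix_rat (hp4 : p % 4 = 1) (hd4 : d % 4 = 1) (x : IG K) (hf : x ∈ Fx S.q1.ti) (hr : x * S.q0.ti x ∈ Rt K) :
    x ∈ S.q1.J ⊔ Subgroup.closure {S.tw} := by
  set T := S.q1.J ⊔ Subgroup.closure {S.tw} with hT
  have hTw : S.tw ∈ T := Subgroup.mem_sup_right (Subgroup.subset_closure rfl)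
  have hram : ∀ P : Ideal (𝓞 K), P.IsPrime → (∀ θ, θ - S.q1.os θ ∈ P) → S.a ∈ P ∧ (2 : 𝓞 K) ∈ P := by
    intro P hP h
    have h1 := h S.a
    rw [S.sa1, show S.a - -S.a = 2 * S.a by ring, ← S.a2, ← pow_succ] at h1
    have h2 := hP.mem_of_pow_mem _ h1
    exact ⟨h2, by rw [← S.a2, sq]; exact P.mul_mem_left _ h2⟩
  by_cases hex : ∃ (P : Ideal (𝓞 K)) (hP0 : P ≠ ⊥), P.IsPrime ∧ P.map S.q1.os = P ∧
      (P.comap S.q1.of).map S.q1.of = P * P ∧ (∀ θ, θ - S.q1.os θ ∈ P) ∧ ii P hP0 ∉ T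
  swap
  · refine S.q1.inv_mem T le_sup_left ?_ hf
    intro P hP0 hP h1 h2 h3
    by_contra h4
    exact hex ⟨P, hP0, hP, h1, h2, h3, h4⟩
  obtain ⟨P, hP0, hP, hs, hPP, hθ, hPT⟩ := hex
  obtain ⟨haP, h2P⟩ := hram P hP hθ
  set 𝔭 := P.comap S.q1.of with h𝔭
  have hp : 𝔭.IsPrime := hP.comap _
  have h2p : (2 : 𝓞 k1) ∈ 𝔭 := by rw [h𝔭, Ideal.mem_comap, map_ofNat]; exact h2P
  have h2p' : ((2 : ℕ) : 𝓞 k1) ∈ 𝔭 := by exact_mod_cast h2p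
  have hns : 𝔭.map S.Q1.os ≠ 𝔭 := by
    intro h
    have h3 := S.two_inert hp4 hd4 𝔭 hp h2p h
    rw [h3, Ideal.map_span, Set.image_singleton, map_ofNat, ← S.aa] at hPP
    have h4 := sq_cancel hPP
    apply hPT
    have : ii P hP0 = S.tw := by
      rw [← S.tw_ii (by rw [h4]; exact hP0), ii_inj]; exact h4.symm
    rw [this]; exact hTw
  have hsp := S.two_split 𝔭 hp h2p hns
  have hPσ0 : P.map S.q0.os ≠ ⊥ := map_ne_bot _ hP0
  have hprod : P * P.map S.q0.os = Ideal.span {S.a} := by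
    apply sq_cancel
    rw [S.aa]
    have h1 : P.map S.q0.os * P.map S.q0.os = (𝔭.map S.Q1.os).map S.q1.of := by
      rw [← Ideal.map_mul, ← hPP, S.map_os]
    calc P * P.map S.q0.os * (P * P.map S.q0.os) = (P * P) * (P.map S.q0.os * P.map S.q0.os) := by ring
      _ = Ideal.span {2} := by
        rw [h1, ← hPP, ← Ideal.map_mul, hsp, Ideal.map_span, Set.image_singleton, map_ofNat]
  have hprod' : ii P hP0 * S.q0.ti (ii P hP0) = S.tw := by
    have h0 : P * P.map S.q0.os ≠ ⊥ := by rw [hprod, Ne, Ideal.span_singleton_eq_bot]; exact S.a0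
    rw [im_ii, ← ii_mul hP0 hPσ0 h0, ← S.tw_ii (hprod ▸ h0), ii_inj]
    exact hprod
  have hsqJ : (ii P hP0) ^ 2 ∈ T := by
    apply Subgroup.mem_sup_left
    have h0 : P * P ≠ ⊥ := by rw [Ne, Ideal.mul_eq_bot]; simpa using hP0
    have h1 : 𝔭 ≠ ⊥ := S.q1.comap_ne_bot P hP0
    refine ⟨ii 𝔭 h1, ?_⟩
    rw [im_ii, sq, ← ii_mul hP0 hP0 h0, ii_inj]
    exact hPP
  have hall : Fx S.q1.ti ≤ T ⊔ Subgroup.closure {ii P hP0} := by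
    apply S.q1.inv_mem _ (le_sup_left.trans le_sup_left)
    intro Q hQ0 hQ _ _ hQθ
    obtain ⟨haQ, h2Q⟩ := hram Q hQ hQθ
    have hPm : ii P hP0 ∈ T ⊔ Subgroup.closure {ii P hP0} := Subgroup.mem_sup_right (Subgroup.subset_closure rfl)
    rcases S.Q1.conjQ 𝔭 (Q.comap S.q1.of) hp (hQ.comap _) 2 Nat.prime_two h2p' (by
      rw [Ideal.mem_comap, map_natCast]; exact_mod_cast h2Q) with h | h
    · have : Q = P := by
        rcases S.q1.conj_prime P Q hP hQ hP0 h.symm with h | h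
        · exact h
        · rw [h, hs]
      have h5 : ii Q hQ0 = ii P hP0 := ii_inj.2 this
      rw [h5]; exact hPm
    · have h6 : P.comap S.q1.of = (Q.map S.q0.os).comap S.q1.of := by
        rw [S.comap_os, h, S.Q1.map_map_os]
      have : Q.map S.q0.os = P := by
        rcases S.q1.conj_prime P _ hP (S.q0.os_prime Q hQ) hP0 h6 with h | h
        · exact h
        · rw [h, hs]
      have h7 : Q = P.map S.q0.os := by rw [← this, S.q0.map_map_os]
      have h5 : ii Q hQ0 = S.q0.ti (ii P hP0) := by rw [im_ii, ii_inj]; exact h7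
      rw [h5]
      have h8 : S.q0.ti (ii P hP0) = S.tw / ii P hP0 := by rw [← hprod']; simp
      rw [h8]
      exact Subgroup.div_mem _ (Subgroup.mem_sup_left hTw) hPm
  obtain ⟨t, ht, rfl | rfl⟩ := sq_mem_of_zpow T _ x hsqJ (hall hf)
  · exact ht
  · exfalso
    have htr : t * S.q0.ti t ∈ Rt K := by
      have : T ≤ (Rt K).comap (Nh S.q0.ti) := by
        refine sup_le ?_ ?_
        · intro y hy
          rw [Subgroup.mem_comap, Nh_apply]; exact S.J1_rat y hy
        · rw [Subgroup.closure_le, Set.singleton_subset_iff]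
          show S.tw ∈ (Rt K).comap (Nh S.q0.ti)
          rw [Subgroup.mem_comap, Nh_apply, S.tw_fix0, ← sq]; exact S.tw_sq
      have := this ht
      rwa [Subgroup.mem_comap, Nh_apply] at this
    apply S.tw_not
    rw [map_mul, mul_mul_mul_comm, hprod'] at hr
    exact ((Rt K).mul_mem_cancel_left htr).1 hr

end BQ
end Q2
end

section
open NumberField nonZeroDivisors
namespace Q2
set_option linter.all false

namespace BQ
variable {k0 k1 k2 K : Type*} [Field k0] [NumberField k0] [Field k1] [NumberField k1]
    [Field k2] [NumberField k2] [Field K] [NumberField K] {p d : ℕ} (S : BQ k0 k1 k2 K p d)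

lemma tw_range : S.tw ∈ (dvv K).range := ⟨_, rfl⟩

lemma fr1 (S : BQ k0 k1 k2 K p d) : Module.finrank ℚ k1 = 2 := by
  have := S.Q1.deg
  rw [Module.finrank_self] at this; exact this

lemma fr2 (S : BQ k0 k1 k2 K p d) : Module.finrank ℚ k2 = 2 := by
  have := S.Q2.deg
  rw [Module.finrank_self] at this; exact this

lemma fr0 (S : BQ k0 k1 k2 K p d) : Module.finrank ℚ k0 = 2 := by
  have := S.Q0.deg
  rw [Module.finrank_self] at this; exact this

lemma UI_nm1 (hq : S.UI) (η : (𝓞 K)ˣ) : ∃ v : (𝓞 k1)ˣ, (η : 𝓞 K) * S.q1.os η = S.q1.of (v ^ 2 : (𝓞 k1)ˣ) ∨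
    (η : 𝓞 K) * S.q1.os η = - S.q1.of (v ^ 2 : (𝓞 k1)ˣ) := by
  obtain ⟨u0, u1, u2, h⟩ := hq η
  obtain ⟨n0, hn0, _, h0⟩ := nmu S.Q0 u0 S.q0.f S.q1.s S.c10
  obtain ⟨n2, hn2, _, h2⟩ := nmu S.Q2 u2 S.q2.f S.q1.s S.c12
  have h0' : S.q0.of u0 * S.q1.os (S.q0.of u0) = n0 := by
    apply RingOfIntegers.ext
    refine Eq.trans h0 ?_
    exact (map_intCast (algebraMap (𝓞 K) K) n0).symm
  have h2' : S.q2.of u2 * S.q1.os (S.q2.of u2) = n2 := by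
    apply RingOfIntegers.ext
    refine Eq.trans h2 ?_
    exact (map_intCast (algebraMap (𝓞 K) K) n2).symm
  have key : (η : 𝓞 K) * S.q1.os η = n0 * n2 * S.q1.of (u1 ^ 2 : (𝓞 k1)ˣ) := by
    rw [h, map_mul, map_mul, S.q1.os_of, Units.val_pow_eq_pow_val, map_pow, ← h0', ← h2']; ring
  refine ⟨u1, ?_⟩
  rw [key]
  rcases hn0 with rfl | rfl <;> rcases hn2 with rfl | rfl <;> simp

lemma back_nm [IsTotallyReal k1] [IsTotallyReal K] (hp4 : p % 4 = 1) (hd4 : d % 4 = 1) (hq : S.UI)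
    (h1 : ¬ 4 ∣ Nat.card (ClassGroup (𝓞 k1))) : Odd ((dvv K).range.relIndex S.q1.J) := by
  set A := (dvv K).range ⊓ Fx S.q1.ti with hA
  set B := (Fx S.q1.su).map (dvv K) with hB
  set C := (dvv K).range ⊓ S.q1.J with hC
  have hBC : B ≤ C := le_inf (by rintro _ ⟨x, _, rfl⟩; exact ⟨x, rfl⟩) S.q1.P0_le
  have hCA : C ≤ A := inf_le_inf_left _ S.q1.J_le
  have e1 : 4 ∣ B.relIndex A := by
    rw [S.q1.H1]
    obtain ⟨c, hc⟩ := S.q1.nm_sub S.fr1 (S.UI_nm1 hq)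
    rw [hc]; exact ⟨c, by ring⟩
  have e2 : C.relIndex A ∣ 2 := by
    have := relIndex_two_pow C A {S.tw} hCA (by
      intro g hg; rw [Finset.mem_singleton] at hg; subst hg
      exact ⟨Subgroup.pow_mem _ S.tw_range 2, S.tw_sq1⟩) (by
      intro x hx
      rw [Finset.coe_singleton]
      obtain ⟨t, ht, h | h⟩ := sq_mem_of_zpow _ _ x S.tw_sq1 (S.fix_rat hp4 hd4 x hx.2 (S.amb_rat hq x hx.1 hx.2))
      · exact Subgroup.mem_sup_left ⟨hx.1, h ▸ ht⟩
      · rw [h]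
        refine Subgroup.mul_mem_sup ⟨?_, ht⟩ (Subgroup.subset_closure rfl)
        have h3 := hx.1
        rw [h] at h3
        exact ((dvv K).range.mul_mem_cancel_right S.tw_range).1 h3)
    simpa using this
  have e3 := Subgroup.relIndex_mul_relIndex B C A hBC hCA
  have e4 := Subgroup.relIndex_mul_relIndex B C S.q1.J hBC inf_le_right
  rw [hB, S.q1.card_F, ← hB, hC, Subgroup.inf_relIndex_right, ← hC] at e4
  rcases (Nat.dvd_prime Nat.prime_two).1 e2 with e2 | e2
  · rw [e2, mul_one] at e3
    exact absurd (e4 ▸ (Dvd.dvd.mul_right (e3 ▸ e1) _)) h1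
  · rw [e2] at e3
    have : 2 ∣ B.relIndex C := by omega
    obtain ⟨c, hc⟩ := this
    rw [← Nat.not_even_iff_odd]
    rintro hE
    obtain ⟨y, hy⟩ := hE.two_dvd
    apply h1
    rw [← e4, hc, hy]
    exact ⟨c * y, by ring⟩

lemma hK_eq : Nat.card (ClassGroup (𝓞 K)) = S.q2.amb * ((dvv K).range.comap (Nh S.q1.ti)).index := by
  rw [card_cl, QE.amb, ← S.ker_eq]
  refine (Subgroup.relIndex_mul_index ?_).symm
  rintro _ ⟨x, rfl⟩
  rw [Subgroup.mem_comap, Nh_apply, S.q1.ti_dvv, ← map_mul]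
  exact ⟨_, rfl⟩

lemma back [IsTotallyReal k1] [IsTotallyReal k2] [IsTotallyReal K] (hp4 : p % 4 = 1) (hd4 : d % 4 = 1) (hq : S.UI)
    (h1 : ¬ 4 ∣ Nat.card (ClassGroup (𝓞 k1))) (h2 : ¬ 8 ∣ Nat.card (ClassGroup (𝓞 k2))) :
    ¬ 4 ∣ Nat.card (ClassGroup (𝓞 K)) := by
  have a1 := S.q2.amb_unram (S.unram2 hp4 hd4)
  have a2 : ¬ 4 ∣ S.q2.amb := by
    rintro ⟨c, hc⟩
    apply h2
    refine dvd_trans ⟨c, ?_⟩ a1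
    rw [hc]; ring
  have a3 : Odd ((dvv K).range.comap (Nh S.q1.ti)).index := by
    have := S.back_nm hp4 hd4 hq h1
    rw [Subgroup.index_comap]
    refine Odd.of_dvd_nat this ?_
    have hle : (Nh S.q1.ti).range ≤ S.q1.J := by
      rintro _ ⟨x, rfl⟩
      rw [Nh_apply]; exact S.q1.mul_ti_mem x
    rw [← Subgroup.relIndex_sup_right, ← Subgroup.relIndex_sup_right (H := S.q1.J) (K := (dvv K).range)]
    have := Subgroup.relIndex_mul_relIndex (dvv K).range ((Nh S.q1.ti).range ⊔ (dvv K).range) (S.q1.J ⊔ (dvv K).range)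
      le_sup_right (sup_le_sup_right hle _)
    exact Dvd.intro _ this
  rw [S.hK_eq]
  intro h
  apply a2
  exact Nat.Coprime.dvd_of_dvd_mul_right ((Nat.coprime_pow_left_iff (n := 2) (by norm_num) 2 _).2 (Nat.coprime_two_left.2 a3)) h

end BQ
end Q2
end

section
open NumberField nonZeroDivisors
namespace Q2
set_option linter.all false

lemma pow_m {G : Type*} [CommGroup G] (P : Subgroup G) (x : G) (h m : ℕ) (hh : Odd h) (h1 : x ^ h ∈ P) (h2 : x ^ (2 * m) ∈ P) : x ^ m ∈ P := by
  obtain ⟨k, rfl⟩ := hh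
  have e : x ^ m = (x ^ (2 * k + 1)) ^ m * ((x ^ (2 * m)) ^ k)⁻¹ := by
    rw [eq_mul_inv_iff_mul_eq, ← pow_mul, ← pow_mul, ← pow_add]; congr 1; ring
  rw [e]
  exact P.mul_mem (P.pow_mem h1 _) (P.inv_mem (P.pow_mem h2 _))

/-- classes killed by m -/
noncomputable def Sm (K : Type*) [Field K] [NumberField K] (m : ℕ) : Subgroup (IG K) := (dvv K).range.comap (powMonoidHom m)
lemma mem_Sm {K : Type*} [Field K] [NumberField K] {m : ℕ} (x : IG K) : x ∈ Sm K m ↔ x ^ m ∈ (dvv K).range := Iff.rfl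

lemma Sm_of {K : Type*} [Field K] [NumberField K] {m : ℕ} (x : IG K) (h : x ∈ (dvv K).range) : x ∈ Sm K m :=
  (mem_Sm x).2 (Subgroup.pow_mem _ h m)

lemma QE.Sm_nm {F K : Type*} [Field F] [NumberField F] [Field K] [NumberField K] (q : QE F K) {m : ℕ}
    (hm : Nat.card (ClassGroup (𝓞 K)) = 2 * m)
    (h2 : (dvv K).range.relIndex ((dvv K).range.comap (sqh (IG K))) ∣ 2) (x : IG K) : x * q.ti x ∈ Sm K m := by
  rw [mem_Sm, mul_pow, ← map_pow]
  have hx : x ^ m ∈ (dvv K).range.comap (sqh (IG K)) := by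
    rw [Subgroup.mem_comap, sqh_apply, ← pow_mul, mul_comm m, ← hm, card_cl]
    exact Subgroup.pow_index_mem _ _
  have hx' : q.ti (x ^ m) ∈ (dvv K).range.comap (sqh (IG K)) := by
    rw [Subgroup.mem_comap, sqh_apply] at hx ⊢
    rw [← map_pow]; exact q.ti_range hx
  obtain ⟨g, hg, h⟩ := Subgroup.relIndex_dvd_two_iff.1 h2
  by_cases h3 : x ^ m ∈ (dvv K).range
  · exact Subgroup.mul_mem _ h3 (q.ti_range h3)
  · have h4 : q.ti (x ^ m) ∉ (dvv K).range := by
      intro h5; apply h3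
      have := q.ti_range h5
      rw [Subgroup.mem_comap, q.ti_ti] at this; exact this
    have a1 := (h _ hx).resolve_right h3
    have a2 := (h _ hx').resolve_right h4
    have a3 : g ^ 2 ∈ (dvv K).range := hg
    have e : x ^ m * q.ti (x ^ m) = (x ^ m * g) * (q.ti (x ^ m) * g) * (g ^ 2)⁻¹ := by
      rw [eq_mul_inv_iff_mul_eq, mul_mul_mul_comm, sq]
    rw [e]
    exact Subgroup.mul_mem _ (Subgroup.mul_mem _ a1 a2) (Subgroup.inv_mem _ a3)

lemma QE.Sm_up {K L : Type*} [Field K] [NumberField K] [Field L] [NumberField L] (q : QE K L) {m : ℕ}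
    (hm : Nat.card (ClassGroup (𝓞 K)) = 2 * m) (hL : Odd (Nat.card (ClassGroup (𝓞 L)))) (x : IG K) (Q : IG L)
    (h : im q.f x = Q * q.ti Q) : x ∈ Sm K m := by
  rw [mem_Sm]
  apply pow_m _ _ _ _ hL
  · have : Q ^ (Nat.card (ClassGroup (𝓞 L))) ∈ (dvv L).range := by
      rw [card_cl]; exact Subgroup.pow_index_mem _ _
    obtain ⟨g, hg⟩ := this
    obtain ⟨c, hc⟩ := q.ufix (g * q.su g) (by rw [map_mul, q.su_su, mul_comm])
    refine ⟨c, im_inj q.f ?_⟩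
    rw [im_dvv, hc, map_mul, ← q.ti_dvv, hg, map_pow, map_pow, h, mul_pow]
  · rw [← hm, card_cl]; exact Subgroup.pow_index_mem _ _

section
variable {k K L : Type*} [Field k] [NumberField k] [Field K] [NumberField K] [Field L] [NumberField L]
/-- odd primes of the quadratic field -/
lemma Sm_odd (q : QE k K) (qL : QE K L) {m : ℕ}
    (hm : Nat.card (ClassGroup (𝓞 K)) = 2 * m) (hL : Odd (Nat.card (ClassGroup (𝓞 L))))
    (h2 : (dvv K).range.relIndex ((dvv K).range.comap (sqh (IG K))) ∣ 2)
    (a : 𝓞 K) (ha : a ^ 2 = 2) (has : q.os a = - a) (p d : ℕ) (hp : p.Prime) (hd : d.Prime) (hpd : p ≠ d)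
    (x y : 𝓞 L) (hx : x ^ 2 = (p : 𝓞 L)) (hy : y ^ 2 = (d : 𝓞 L)) (hsx : qL.os x = -x) (hsy : qL.os y = -y)
    (b : Ideal (𝓞 k)) (hb : b.IsPrime) (hb0 : b ≠ ⊥) (hb2 : (2 : 𝓞 k) ∉ b) : im q.f (ii b hb0) ∈ Sm K m := by
  have main : ∀ (g : ℕ) (z : 𝓞 L), z ^ 2 = (g : 𝓞 L) → qL.os z = - z → (g : 𝓞 k) ∉ b → im q.f (ii b hb0) ∈ Sm K m := by
    intro g z hz hsz hg
    rcases QE.tower q qL 2 g a z (by rw [ha, map_ofNat]) (by rw [hz, map_natCast, map_natCast]) has hsz b hb0 (by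
      intro h
      rw [show (4 : 𝓞 k) * 2 = 2 ^ 3 by norm_num] at h
      rcases hb.mem_or_mem h with h | h
      · exact hb2 (hb.mem_of_pow_mem _ h)
      · exact hg h) with ⟨P, hP0, h⟩ | ⟨Q, hQ0, h⟩
    · have e : im q.f (ii b hb0) = ii P hP0 * q.ti (ii P hP0) := by
        rw [im_ii, im_ii, ← ii_mul hP0 (map_ne_bot _ hP0) (h ▸ map_ne_bot _ hb0), ii_inj]; exact h
      rw [e]; exact q.Sm_nm hm h2 _
    · apply qL.Sm_up hm hL _ (ii Q hQ0)
      rw [im_ii, im_ii, im_ii, ← ii_mul hQ0 (map_ne_bot _ hQ0) (h ▸ map_ne_bot _ (map_ne_bot _ hb0)), ii_inj]; exact h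
  by_cases hpb : (p : 𝓞 k) ∈ b
  · refine main d y hy hsy fun hdb => ?_
    have := int_dvd_of_mem b hb.ne_top p hp hpb d (by exact_mod_cast hdb)
    have := (Nat.prime_dvd_prime_iff_eq hp hd).1 (by exact_mod_cast this)
    exact hpd this
  · exact main p x hx hsx hpb
end

namespace BQ
variable {k0 k1 k2 K : Type*} [Field k0] [NumberField k0] [Field k1] [NumberField k1]
    [Field k2] [NumberField k2] [Field K] [NumberField K] {p d : ℕ} (S : BQ k0 k1 k2 K p d)

lemma two_range : dvv K (Units.mk0 2 two_ne_zero) ∈ (dvv K).range := ⟨_, rfl⟩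

lemma Sm_two1 (hp4 : p % 4 = 1) (hd4 : d % 4 = 1) {m : ℕ}
    (hm : Nat.card (ClassGroup (𝓞 K)) = 2 * m)
    (h2 : (dvv K).range.relIndex ((dvv K).range.comap (sqh (IG K))) ∣ 2)
    (b : Ideal (𝓞 k1)) (hb : b.IsPrime) (hb0 : b ≠ ⊥) (hb2 : (2 : 𝓞 k1) ∈ b) : im S.q1.f (ii b hb0) ∈ Sm K m := by
  by_cases hs : b.map S.Q1.os = b
  · have h := S.two_inert hp4 hd4 b hb hb2 hs
    apply Sm_of
    have e : im S.q1.f (ii b hb0) = ii (Ideal.span {(2 : 𝓞 K)}) (by rw [Ne, Ideal.span_singleton_eq_bot]; exact two_ne_zero) := by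
      rw [im_ii, ii_inj, h, Ideal.map_span, Set.image_singleton, map_ofNat]
    rw [e, ii_span 2 two_ne_zero _ (by
      have : (algebraMap (𝓞 K) K 2) ≠ 0 := by rw [map_ofNat]; exact two_ne_zero
      exact this)]
    exact ⟨_, rfl⟩
  · obtain ⟨P, hP, hP0, hPb, h | h⟩ := S.q1.trich b hb0
    · exfalso
      have hsp := S.two_split b hb hb2 hs
      have haP : S.a ∈ P := by
        apply hP.mem_of_pow_mem 2
        rw [S.a2, ← map_ofNat S.q1.of 2, ← Ideal.mem_comap, hPb]; exact hb2
      have h3 : P * (b.map S.Q1.os).map S.q1.of ≤ P * P := by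
        rw [← h, ← Ideal.map_mul, hsp, Ideal.map_span, Set.image_singleton, map_ofNat, ← S.aa, h]
        have : Ideal.span {S.a} ≤ P := (Ideal.span_singleton_le_iff_mem _).2 haP
        exact Ideal.mul_mono this this
      have h4 : (b.map S.Q1.os).map S.q1.of ≤ P := by
        rw [← Ideal.dvd_iff_le] at h3 ⊢
        exact (mul_dvd_mul_iff_left (a := P) hP0).1 h3
      rw [Ideal.map_le_iff_le_comap, hPb] at h4
      exact hs (((S.Q1.os_prime b hb).isMaximal (map_ne_bot _ hb0)).eq_of_le hb.ne_top h4)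
    · have e : im S.q1.f (ii b hb0) = ii P hP0 * S.q1.ti (ii P hP0) := by
        rw [im_ii, im_ii, ← ii_mul hP0 (map_ne_bot _ hP0) (h ▸ map_ne_bot _ hb0), ii_inj]; exact h
      rw [e]; exact S.q1.Sm_nm hm h2 _

lemma sqf2 (hp : p.Prime) (hd : d.Prime) (hpd : p ≠ d) (hp4 : p % 4 = 1) (hd4 : d % 4 = 1) : Squarefree ((2 * p * d : ℕ) : ℤ) := by
  rw [Int.squarefree_natCast, Nat.squarefree_mul, Nat.squarefree_mul]
  · exact ⟨⟨Nat.prime_two.prime.squarefree, hp.prime.squarefree⟩, hd.prime.squarefree⟩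
  · exact (Nat.coprime_primes Nat.prime_two hp).2 (by omega)
  · exact Nat.Coprime.mul_left ((Nat.coprime_primes Nat.prime_two hd).2 (by omega)) ((Nat.coprime_primes hp hd).2 hpd)

lemma stab2 (S : BQ k0 k1 k2 K p d) (hp : p.Prime) (hd : d.Prime) (hpd : p ≠ d) (hp4 : p % 4 = 1) (hd4 : d % 4 = 1)
    (b : Ideal (𝓞 k2)) (hb2 : (2 : 𝓞 k2) ∈ b) : b.map S.Q2.os = b := by
  have key : ∀ x, x ∈ b → S.Q2.os x ∈ b := by
    intro x hx
    obtain ⟨u, v, n, e1, e2, e3, e4⟩ := S.Q2.qint S.r2 S.hr2 (2 * p * d : ℕ) (by rw [S.s2]; push_cast; rfl) (sqf2 hp hd hpd hp4 hd4) x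
    have hu : u % 2 = 0 := by
      rcases Int.emod_two_eq_zero_or_one u with h | h
      · exact h
      · have h5 : (u ^ 2) % 2 = 1 := by simp [pow_two, Int.mul_emod, h]
        have h6 : u ^ 2 = 2 * (2 * n + p * d * v ^ 2) := by push_cast at e4; linear_combination -e4
        omega
    obtain ⟨w, rfl⟩ := Int.dvd_of_emod_eq_zero hu
    have : S.Q2.os x = 2 * w - x := by
      apply mul_left_cancel₀ (two_ne_zero (α := 𝓞 k2))
      push_cast at e1 e2
      linear_combination e2 + e1
    rw [this]
    exact b.sub_mem (b.mul_mem_right _ hb2) hx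
  ext x
  rw [S.Q2.mem_map_os]
  exact ⟨fun h => by have := key _ h; rwa [S.Q2.os_os] at this, key x⟩

lemma Sm_two2 (hp : p.Prime) (hd : d.Prime) (hpd : p ≠ d) (hp4 : p % 4 = 1) (hd4 : d % 4 = 1) {m : ℕ}
    (b : Ideal (𝓞 k2)) (hb : b.IsPrime) (hb0 : b ≠ ⊥) (hb2 : (2 : 𝓞 k2) ∈ b) : im S.q2.f (ii b hb0) ∈ Sm K m := by
  have hs := S.stab2 hp hd hpd hp4 hd4 b hb2
  have hcm := S.Q2.comap_map b hb 2 Nat.prime_two (by exact_mod_cast hb2)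
  rcases S.Q2.prime_inv b hb0 hs with h | ⟨h, -⟩
  · exfalso
    rw [hcm] at h
    have hr : S.r2 ∈ b := by
      apply hb.mem_of_pow_mem 2
      rw [S.s2, mul_assoc]; exact b.mul_mem_right _ hb2
    rw [← h, Ideal.mem_span_singleton] at hr
    obtain ⟨c, hc⟩ := hr
    have h1 : ((p * d : ℕ) : 𝓞 k2) = 2 * c ^ 2 := by
      apply mul_left_cancel₀ (two_ne_zero (α := 𝓞 k2))
      have := S.s2
      rw [hc] at this
      push_cast at this ⊢
      linear_combination -this
    have h2 : (((p * d : ℕ) : ℤ) : 𝓞 k2) ∈ b := by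
      rw [Int.cast_natCast, h1]; exact b.mul_mem_right _ hb2
    have := int_dvd_of_mem b hb.ne_top 2 Nat.prime_two (by exact_mod_cast hb2) _ h2
    have := odd_pd hp4 hd4
    omega
  · apply Sm_of
    rw [hcm] at h
    have h1 : b.map S.q2.of = Ideal.span {S.a} := by
      apply sq_cancel
      rw [← Ideal.map_mul, ← h, S.aa, Ideal.map_span, Set.image_singleton, map_natCast]; norm_cast
    have e : im S.q2.f (ii b hb0) = S.tw := by
      rw [← S.tw_ii (h1 ▸ map_ne_bot _ hb0), im_ii, ii_inj]; exact h1
    rw [e]; exact S.tw_range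

lemma Sm1 {L : Type*} [Field L] [NumberField L] (hp : p.Prime) (hd : d.Prime) (hpd : p ≠ d) (hp4 : p % 4 = 1) (hd4 : d % 4 = 1) (qL : QE K L) {m : ℕ}
    (hm : Nat.card (ClassGroup (𝓞 K)) = 2 * m) (hL : Odd (Nat.card (ClassGroup (𝓞 L))))
    (h2 : (dvv K).range.relIndex ((dvv K).range.comap (sqh (IG K))) ∣ 2)
    (x y : 𝓞 L) (hx : x ^ 2 = (p : 𝓞 L)) (hy : y ^ 2 = (d : 𝓞 L)) (hsx : qL.os x = -x) (hsy : qL.os y = -y)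
    : S.q1.J ≤ Sm K m := by
  rintro _ ⟨c, rfl⟩
  refine IG_prime_ind ((Sm K m).comap (im S.q1.f)) (fun b hb0 hb => ?_) c
  rw [Subgroup.mem_comap]
  by_cases hb2 : (2 : 𝓞 k1) ∈ b
  · exact S.Sm_two1 hp4 hd4 hm h2 b hb hb0 hb2
  · exact Sm_odd S.q1 qL hm hL h2 S.a S.a2 S.sa1 p d hp hd hpd x y hx hy hsx hsy b hb hb0 hb2

lemma Sm2 {L : Type*} [Field L] [NumberField L] (hp : p.Prime) (hd : d.Prime) (hpd : p ≠ d) (hp4 : p % 4 = 1) (hd4 : d % 4 = 1) (qL : QE K L) {m : ℕ}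
    (hm : Nat.card (ClassGroup (𝓞 K)) = 2 * m) (hL : Odd (Nat.card (ClassGroup (𝓞 L))))
    (h2 : (dvv K).range.relIndex ((dvv K).range.comap (sqh (IG K))) ∣ 2)
    (x y : 𝓞 L) (hx : x ^ 2 = (p : 𝓞 L)) (hy : y ^ 2 = (d : 𝓞 L)) (hsx : qL.os x = -x) (hsy : qL.os y = -y)
    : S.q2.J ≤ Sm K m := by
  rintro _ ⟨c, rfl⟩
  refine IG_prime_ind ((Sm K m).comap (im S.q2.f)) (fun b hb0 hb => ?_) c
  rw [Subgroup.mem_comap]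
  by_cases hb2 : (2 : 𝓞 k2) ∈ b
  · exact S.Sm_two2 hp hd hpd hp4 hd4 b hb hb0 hb2
  · exact Sm_odd S.q2 qL hm hL h2 S.a S.a2 S.sa2 p d hp hd hpd x y hx hy hsx hsy b hb hb0 hb2

end BQ
end Q2
end

section
open NumberField nonZeroDivisors
namespace Q2
set_option linter.all false

lemma odd_relIndex {G : Type*} [CommGroup G] (P J : Subgroup G) (hP : P.index ≠ 0) (m : ℕ) (hm : Odd m) (h : ∀ x ∈ J, x ^ m ∈ P) :
    Odd (P.relIndex J) := by
  rw [← Nat.not_even_iff_odd]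
  intro hE
  have hfin : P.relIndex J ≠ 0 := fun h0 => hP (by
    have : P.relIndex J ∣ P.index := Subgroup.relIndex_dvd_index_of_normal P J
    rw [h0] at this; exact Nat.eq_zero_of_zero_dvd this)
  have : Finite (J ⧸ P.subgroupOf J) := Nat.finite_of_card_ne_zero hfin
  obtain ⟨y, hy⟩ := exists_prime_orderOf_dvd_card' (G := J ⧸ P.subgroupOf J) 2 hE.two_dvd
  obtain ⟨x, rfl⟩ := QuotientGroup.mk_surjective y
  have h1 : ((x : J) : J ⧸ P.subgroupOf J) ^ m = 1 := by
    rw [← QuotientGroup.mk_pow, QuotientGroup.eq_one_iff, Subgroup.mem_subgroupOf]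
    exact h _ x.2
  have := orderOf_dvd_of_pow_eq_one h1
  rw [hy] at this
  exact (Nat.not_even_iff_odd.2 hm) (even_iff_two_dvd.2 this)

namespace BQ
variable {k0 k1 k2 K : Type*} [Field k0] [NumberField k0] [Field k1] [NumberField k1]
    [Field k2] [NumberField k2] [Field K] [NumberField K] {p d : ℕ} (S : BQ k0 k1 k2 K p d)

/-- fundamental unit of Q(√2) in K -/
noncomputable def ep : (𝓞 K)ˣ := ⟨1 + S.a, S.a - 1, by linear_combination S.a2, by linear_combination S.a2⟩
/-- fundamental unit of Q(√2) -/
noncomputable def ep0 (S : BQ k0 k1 k2 K p d) : (𝓞 k0)ˣ := ⟨1 + S.r0, S.r0 - 1, by linear_combination S.s0, by linear_combination S.s0⟩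
lemma of_ep0 : S.q0.of S.ep0 = S.ep := by
  show S.q0.of (1 + S.r0) = 1 + S.a
  rw [map_add, map_one]; rfl

lemma ep1 : (S.ep : 𝓞 K) * S.q1.os S.ep = -1 := by
  show (1 + S.a) * S.q1.os (1 + S.a) = -1
  rw [map_add, map_one, S.sa1]; linear_combination -S.a2
lemma ep2 : (S.ep : 𝓞 K) * S.q2.os S.ep = -1 := by
  show (1 + S.a) * S.q2.os (1 + S.a) = -1
  rw [map_add, map_one, S.sa2]; linear_combination -S.a2

lemma nsq [IsTotallyReal K] (x : 𝓞 K) : x ^ 2 ≠ -1 := by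
  intro h
  apply neg_one_not_sq (x : K)
  have := congrArg (algebraMap (𝓞 K) K) h
  rw [map_pow, map_neg, map_one] at this; exact this

lemma sq_unit [IsTotallyReal k0] [IsTotallyReal K] (ζ : (𝓞 K)ˣ) (h : S.q0.os ((ζ : 𝓞 K) ^ 2) = (ζ : 𝓞 K) ^ 2) :
    ∃ v : (𝓞 k0)ˣ, (ζ : 𝓞 K) = S.q0.of v := by
  have hee : ∀ (x : 𝓞 K), x ^ 2 ≠ S.ep ∧ x ^ 2 ≠ - S.ep := by
    intro x
    have h1 := S.ep1
    constructor <;> intro hx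
    · rw [← hx, map_pow, ← mul_pow] at h1
      exact nsq _ h1
    · have h2 : (S.ep : 𝓞 K) = - x ^ 2 := by rw [hx, neg_neg]
      rw [h2, map_neg, neg_mul_neg, map_pow, ← mul_pow] at h1
      exact nsq _ h1
  -- descend the square
  obtain ⟨c, hc⟩ := S.q0.ofix _ h
  have hinv : S.q0.os (((ζ⁻¹ : (𝓞 K)ˣ) : 𝓞 K) ^ 2) = ((ζ⁻¹ : (𝓞 K)ˣ) : 𝓞 K) ^ 2 := by
    have e : ((ζ⁻¹ : (𝓞 K)ˣ) : 𝓞 K) ^ 2 * (ζ : 𝓞 K) ^ 2 = 1 := by rw [← mul_pow, Units.inv_mul, one_pow]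
    have e2 := congrArg S.q0.os e
    rw [map_mul, h, map_one, ← e] at e2
    exact mul_right_cancel₀ (pow_ne_zero 2 ζ.ne_zero) e2
  obtain ⟨c', hc'⟩ := S.q0.ofix _ hinv
  have hcc : c * c' = 1 := by
    apply om_inj S.q0.f
    show S.q0.of _ = S.q0.of _
    rw [map_mul, hc, hc', map_one, ← mul_pow, Units.mul_inv, one_pow]
  let w : (𝓞 k0)ˣ := ⟨c, c', hcc, by rw [mul_comm]; exact hcc⟩
  have hmem : ∀ u : (𝓞 k0)ˣ, ue k0 u ∈ (dvv k0).ker := fun u => by rw [← ue_range]; exact ⟨u, rfl⟩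
  have hpm : ∀ u : (𝓞 k0)ˣ, ue k0 u ∈ pmS k0 → ∃ v : (𝓞 k0)ˣ, u = v ^ 2 ∨ u = - v ^ 2 := by
    intro u hu
    obtain ⟨v, hv, h⟩ := (mem_pmS _).1 hu
    rw [← ue_range] at hv
    obtain ⟨v, rfl⟩ := hv
    refine ⟨v, h.imp (fun h => ue_inj ?_) (fun h => ?_)⟩
    · rw [h, map_pow]
    · apply Units.ext
      apply RingOfIntegers.ext
      have := congrArg Units.val h
      exact this
  have hidx := pm_idx (F := k0) S.fr0
  obtain ⟨g, hg, hall⟩ := Subgroup.relIndex_eq_two_iff.1 hidx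
  have hep : ue k0 S.ep0 ∉ pmS k0 := by
    intro h
    obtain ⟨v, h | h⟩ := hpm _ h
    · refine (hee (S.q0.of v)).1 ?_
      rw [← map_pow, ← S.of_ep0, h]; rfl
    · refine (hee (S.q0.of v)).2 ?_
      rw [← map_pow, ← S.of_ep0, h, Units.val_neg, map_neg, neg_neg]; rfl
  by_cases hw : ue k0 w ∈ pmS k0
  · obtain ⟨v, h | h⟩ := hpm _ hw
    · have e : (ζ : 𝓞 K) ^ 2 = S.q0.of v ^ 2 := by
        rw [← hc, ← map_pow]; exact congrArg (fun u : (𝓞 k0)ˣ => S.q0.of u) h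
      rcases sq_eq_sq_iff_eq_or_eq_neg.1 e with e | e
      · exact ⟨v, e⟩
      · exact ⟨-v, by rw [e, Units.val_neg, map_neg]⟩
    · exfalso
      have e : (ζ : 𝓞 K) ^ 2 = - S.q0.of v ^ 2 := by
        rw [← hc, ← map_pow, ← map_neg]; exact congrArg (fun u : (𝓞 k0)ˣ => S.q0.of u) h
      apply nsq ((ζ : 𝓞 K) * S.q0.of (v⁻¹ : (𝓞 k0)ˣ))
      rw [mul_pow, e, neg_mul, ← mul_pow, ← map_mul, Units.mul_inv, map_one, one_pow]
  · exfalso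
    have h1 : ue k0 w * ue k0 S.ep0 ∈ pmS k0 := by
      have a1 := hall _ (hmem w)
      have a2 := hall _ (hmem S.ep0)
      have b1 : ue k0 w * g ∈ pmS k0 := a1.or.resolve_right hw
      have b2 : ue k0 S.ep0 * g ∈ pmS k0 := a2.or.resolve_right hep
      have b3 := hall _ (Subgroup.mul_mem _ (hmem w) (hmem S.ep0))
      rcases b3.or with b3 | b3
      · exfalso
        have : ue k0 w * ue k0 S.ep0 * g / (ue k0 w * g) ∈ pmS k0 := Subgroup.div_mem _ b3 b1
        rw [mul_right_comm, mul_div_cancel_left] at this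
        exact hep this
      · exact b3
    rw [← map_mul] at h1
    have fin : ∀ v : (𝓞 k0)ˣ, ((ζ⁻¹ : (𝓞 K)ˣ) * S.q0.of v : 𝓞 K) ^ 2 = ((ζ⁻¹ : (𝓞 K)ˣ) : 𝓞 K) ^ 2 * S.q0.of ((v ^ 2 : (𝓞 k0)ˣ)) := by
      intro v; rw [mul_pow, Units.val_pow_eq_pow_val, map_pow]
    have fin2 : ((ζ⁻¹ : (𝓞 K)ˣ) : 𝓞 K) ^ 2 * S.q0.of ((w * S.ep0 : (𝓞 k0)ˣ)) = S.ep := by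
      rw [Units.val_mul, map_mul, S.of_ep0]
      show _ * (S.q0.of c * _) = _
      rw [hc, ← mul_assoc, ← mul_pow, Units.inv_mul, one_pow, one_mul]
    obtain ⟨v, h | h⟩ := hpm _ h1
    · apply (hee ((ζ⁻¹ : (𝓞 K)ˣ) * S.q0.of v)).1
      rw [fin, ← fin2, h]
    · apply (hee ((ζ⁻¹ : (𝓞 K)ˣ) * S.q0.of v)).2
      rw [fin, ← fin2, h, Units.val_neg, map_neg, mul_neg, neg_neg]

lemma UI_of [IsTotallyReal k0] [IsTotallyReal K]
    (h1 : ∀ η : (𝓞 K)ˣ, ∃ v : (𝓞 k1)ˣ, (η : 𝓞 K) * S.q1.os η = S.q1.of (v ^ 2 : (𝓞 k1)ˣ) ∨ (η : 𝓞 K) * S.q1.os η = - S.q1.of (v ^ 2 : (𝓞 k1)ˣ))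
    (h2 : ∀ η : (𝓞 K)ˣ, ∃ v : (𝓞 k2)ˣ, (η : 𝓞 K) * S.q2.os η = S.q2.of (v ^ 2 : (𝓞 k2)ˣ) ∨ (η : 𝓞 K) * S.q2.os η = - S.q2.of (v ^ 2 : (𝓞 k2)ˣ)) :
    S.UI := by
  intro η
  obtain ⟨v1, hv1⟩ := h1 η
  obtain ⟨v2, hv2⟩ := h2 η
  let v2' : (𝓞 k2)ˣ := Units.map S.Q2.os.toMonoidHom v2
  let U1 : (𝓞 K)ˣ := Units.map S.q1.of.toMonoidHom v1
  let U2 : (𝓞 K)ˣ := Units.map S.q2.of.toMonoidHom v2'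
  let ζ : (𝓞 K)ˣ := η * U2 * U1⁻¹
  have hos : S.q0.os (S.q2.of v2) = U2 := RingOfIntegers.ext (S.c02 _)
  have hs2 : S.q2.os η = S.q0.os (S.q1.os η) := RingOfIntegers.ext (S.s2_eq _)
  have e1 : (η : 𝓞 K) * S.q1.os η = (U1 : 𝓞 K) ^ 2 ∨ (η : 𝓞 K) * S.q1.os η = - (U1 : 𝓞 K) ^ 2 := by
    have : S.q1.of (v1 ^ 2 : (𝓞 k1)ˣ) = (U1 : 𝓞 K) ^ 2 := by rw [Units.val_pow_eq_pow_val, map_pow]; rfl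
    rw [this] at hv1; exact hv1
  have e2 : S.q0.os η * S.q1.os η = (U2 : 𝓞 K) ^ 2 ∨ S.q0.os η * S.q1.os η = - (U2 : 𝓞 K) ^ 2 := by
    have e3 : S.q0.os ((η : 𝓞 K) * S.q2.os η) = S.q0.os η * S.q1.os η := by
      rw [map_mul, hs2, S.q0.os_os]
    have e4 : S.q0.os (S.q2.of (v2 ^ 2 : (𝓞 k2)ˣ)) = (U2 : 𝓞 K) ^ 2 := by
      rw [Units.val_pow_eq_pow_val, map_pow, map_pow, hos]
    rcases hv2 with h | h
    · left; rw [← e3, h, e4]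
    · right; rw [← e3, h, map_neg, e4]
  have key : (ζ : 𝓞 K) ^ 2 = (η : 𝓞 K) * S.q0.os η ∨ (ζ : 𝓞 K) ^ 2 = - ((η : 𝓞 K) * S.q0.os η) := by
    have hz : (ζ : 𝓞 K) * U1 = η * U2 := by
      have : ζ * U1 = η * U2 := by simp [ζ]
      exact_mod_cast congrArg Units.val this
    have hz2 : (ζ : 𝓞 K) ^ 2 * U1 ^ 2 = η ^ 2 * U2 ^ 2 := by rw [← mul_pow, hz, mul_pow]
    have hu : (U1 : 𝓞 K) ^ 2 ≠ 0 := pow_ne_zero 2 U1.ne_zero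
    rcases e1 with e1 | e1 <;> rcases e2 with e2 | e2
    · left; apply mul_right_cancel₀ hu
      rw [hz2, ← e1, ← e2]; ring
    · right; apply mul_right_cancel₀ hu
      rw [hz2, ← e1, (neg_eq_iff_eq_neg.2 e2).symm]; ring
    · right; apply mul_right_cancel₀ hu
      rw [hz2, ← e2, (neg_eq_iff_eq_neg.2 e1).symm]; ring
    · left; apply mul_right_cancel₀ hu
      rw [hz2, (neg_eq_iff_eq_neg.2 e1).symm, (neg_eq_iff_eq_neg.2 e2).symm]; ring
  have hfix : S.q0.os ((ζ : 𝓞 K) ^ 2) = (ζ : 𝓞 K) ^ 2 := by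
    rcases key with h | h <;> rw [h] <;> simp only [map_neg, map_mul, S.q0.os_os, mul_comm]
  obtain ⟨v, hv⟩ := S.sq_unit ζ hfix
  refine ⟨v, v1, v2'⁻¹, ?_⟩
  rw [← hv]
  have : (η : (𝓞 K)ˣ) = ζ * U1 * U2⁻¹ := by simp [ζ]
  have := congrArg Units.val this
  rw [this]
  rfl

end BQ
end Q2
end

section
open NumberField nonZeroDivisors
namespace Q2
set_option linter.all false

/-- rationals of even 2-adic valuation -/
def Ev : Subgroup ℚˣ where
  carrier := {c | Even (padicValRat 2 (c : ℚ))}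
  mul_mem' := by
    intro a b ha hb
    show Even (padicValRat 2 ((a * b : ℚˣ) : ℚ))
    rw [Units.val_mul, padicValRat.mul a.ne_zero b.ne_zero]
    exact Even.add ha hb
  one_mem' := by
    show Even (padicValRat 2 ((1 : ℚˣ) : ℚ))
    simp
  inv_mem' := by
    intro a ha
    show Even (padicValRat 2 ((a⁻¹ : ℚˣ) : ℚ))
    rw [Units.val_inv_eq_inv_val, padicValRat.inv]
    exact Even.neg ha

namespace BQ
variable {k0 k1 k2 K : Type*} [Field k0] [NumberField k0] [Field k1] [NumberField k1]
    [Field k2] [NumberField k2] [Field K] [NumberField K] {p d : ℕ} (S : BQ k0 k1 k2 K p d)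

lemma tw_notJ [IsTotallyReal k1] (hp : p.Prime) (hd : d.Prime) (hp4 : p % 4 = 1) (hd4 : d % 4 = 1) : S.tw ∉ S.q1.J := by
  rintro ⟨c, hc⟩
  have hfix : S.Q1.ti c = c := by
    apply QE.im_inj S.q1.f
    have h1 : S.q0.ti (im S.q1.f c) = im S.q1.f (S.Q1.ti c) := by
      rw [im_comp, im_comp, (RingHom.ext S.c01 : S.q0.s.comp S.q1.f = S.q1.f.comp S.Q1.s)]
    rw [← h1, hc, S.tw_fix0]
  have hF : (dvv ℚ).range = ⊤ := by rw [← Subgroup.index_eq_one, ← card_cl, hQ1]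
  let two : ℚˣ := Units.mk0 2 two_ne_zero
  have hsq : c ^ 2 = im S.Q1.f (dvv ℚ two) := by
    apply QE.im_inj S.q1.f
    rw [map_pow, hc, im_comp, im_dvv]
    unfold tw
    rw [← map_pow]
    congr 1
    apply Units.ext
    rw [Units.val_pow_eq_pow_val]
    refine S.av2.trans ?_
    exact (map_ofNat (S.q1.f.comp S.Q1.f) 2).symm
  have hall : Fx S.Q1.ti ≤ (((Ev.map (dvv ℚ)).map (im S.Q1.f))).comap (sqh (IG k1)) := by
    apply S.Q1.inv_mem
    · rintro _ ⟨z, rfl⟩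
      have : z ∈ (dvv ℚ).range := by rw [hF]; trivial
      obtain ⟨e, rfl⟩ := this
      rw [Subgroup.mem_comap, sqh_apply, ← map_pow, ← map_pow]
      refine ⟨_, ⟨_, ?_, rfl⟩, rfl⟩
      show Even (padicValRat 2 ((e ^ 2 : ℚˣ) : ℚ))
      rw [Units.val_pow_eq_pow_val, padicValRat.pow]
      exact ⟨padicValRat 2 (e : ℚ), by push_cast; ring⟩
    · intro P hP0 hP _ hPP hθ
      have hD := S.Q1.ramQ S.r1 (p * d : ℕ) (by rw [S.s1]; push_cast; rfl) S.Qs1 ((p * d / 4 : ℕ) : ℤ)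
        (by have := odd_pd hp4 hd4; omega) P hθ
      have main : ∀ l : ℕ, l.Prime → l % 4 = 1 → (l : 𝓞 k1) ∈ P →
          ii P hP0 ∈ (((Ev.map (dvv ℚ)).map (im S.Q1.f))).comap (sqh (IG k1)) := by
        intro l hl hl4 hlP
        have hl0 : (l : ℚ) ≠ 0 := by exact_mod_cast hl.ne_zero
        have h1 := OQ_prime (P.comap S.Q1.of) (hP.comap S.Q1.of).ne_top l hl (by rw [Ideal.mem_comap, map_natCast]; exact hlP)
        rw [Subgroup.mem_comap, sqh_apply]
        refine ⟨_, ⟨Units.mk0 (l : ℚ) hl0, ?_, rfl⟩, ?_⟩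
        · show Even (padicValRat 2 (l : ℚ))
          rw [padicValRat.of_nat, padicValNat.eq_zero_of_not_dvd (by omega)]
          simp
        · have hl0' : (l : 𝓞 ℚ) ≠ 0 := by exact_mod_cast hl.ne_zero
          have h0 : P * P ≠ ⊥ := by rw [Ne, Ideal.mul_eq_bot]; simpa using hP0
          have hs0 : Ideal.span {(l : 𝓞 ℚ)} ≠ ⊥ := by rw [Ne, Ideal.span_singleton_eq_bot]; exact hl0'
          have h3 : dvv ℚ (Units.mk0 (l : ℚ) hl0) = ii (Ideal.span {(l : 𝓞 ℚ)}) hs0 := by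
            rw [ii_span (l : 𝓞 ℚ) hl0' hs0 (by
              intro h; apply hl0'; exact RingOfIntegers.ext h)]
            congr 1
          rw [h3, im_ii, sq, ← ii_mul hP0 hP0 h0, ii_inj, ← hPP, h1]
      have hD' : (p : 𝓞 k1) * d ∈ P := by exact_mod_cast hD
      rcases hP.mem_or_mem hD' with h | h
      · exact main p hp hp4 h
      · exact main d hd hd4 h
  have := hall (x := c) hfix
  rw [Subgroup.mem_comap, sqh_apply, hsq] at this
  obtain ⟨z, ⟨e, he, rfl⟩, hz⟩ := this
  have hz := QE.im_inj S.Q1.f hz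
  have hk : e / two ∈ (dvv ℚ).ker := by rw [MonoidHom.mem_ker, map_div, hz, div_self']
  obtain ⟨u, hu⟩ := (mem_ker_dvv _).1 hk
  obtain ⟨n, hn⟩ := OQ_int (u : 𝓞 ℚ)
  obtain ⟨m, hm⟩ := OQ_int ((u⁻¹ : (𝓞 ℚ)ˣ) : 𝓞 ℚ)
  have hnm : n * m = 1 := by
    have : (u : 𝓞 ℚ) * ((u⁻¹ : (𝓞 ℚ)ˣ) : 𝓞 ℚ) = 1 := Units.mul_inv u
    rw [hn, hm] at this
    exact_mod_cast this
  have hn1 : n = 1 ∨ n = -1 := int_pm (IsUnit.of_mul_eq_one _ hnm)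
  have hu2 : (e : ℚ) = n * 2 := by
    rw [hn] at hu
    have h1 : (algebraMap (𝓞 ℚ) ℚ) (n : 𝓞 ℚ) = ((e / two : ℚˣ) : ℚ) := hu
    rw [map_intCast, Units.val_div_eq_div_val] at h1
    rw [h1]; show (e : ℚ) = e / 2 * 2; ring
  have he : Even (padicValRat 2 (e : ℚ)) := he
  have h2 : padicValRat 2 (2 : ℚ) = 1 := by
    have := padicValRat.self (p := 2) (by norm_num)
    exact_mod_cast this
  have : padicValRat 2 (e : ℚ) = 1 := by
    rcases hn1 with rfl | rfl
    · rw [hu2]; simpa using h2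
    · rw [hu2]; push_cast; rw [neg_one_mul, padicValRat.neg, h2]
  rw [this] at he
  exact absurd he (by decide)

variable [IsTotallyReal k0] [IsTotallyReal k1] [IsTotallyReal k2] [IsTotallyReal K]

lemma forward {L : Type*} [Field L] [NumberField L] [IsTotallyReal L] (hp : p.Prime) (hd : d.Prime) (hpd : p ≠ d) (hp4 : p % 4 = 1) (hd4 : d % 4 = 1) (qL : QE K L)
    (hL : Odd (Nat.card (ClassGroup (𝓞 L))))
    (h2 : (dvv K).range.relIndex ((dvv K).range.comap (sqh (IG K))) ∣ 2)
    (x y : 𝓞 L) (hx : x ^ 2 = (p : 𝓞 L)) (hy : y ^ 2 = (d : 𝓞 L)) (hsx : qL.os x = -x) (hsy : qL.os y = -y)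
    (hk1 : 2 ∣ Nat.card (ClassGroup (𝓞 k1))) :
    (4 ∣ Nat.card (ClassGroup (𝓞 k2)) ∧ ¬ 8 ∣ Nat.card (ClassGroup (𝓞 k2))) ∧ S.UI := by
  obtain ⟨hK2, hK4⟩ := qL.two_part (qL.unram_pd p d hp hd hpd hp4 hd4 x y hx hy hsx hsy) hL h2
  obtain ⟨m, hm⟩ := hK2
  have hmo : Odd m := by
    rw [← Nat.not_even_iff_odd]; rintro ⟨t, rfl⟩
    apply hK4; rw [hm]; exact ⟨t, by ring⟩
  have o1 : Odd ((dvv K).range.relIndex S.q1.J) := odd_relIndex _ _ (cl_ne K) m hmo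
    (fun z hz => (mem_Sm z).1 (S.Sm1 hp hd hpd hp4 hd4 qL hm hL h2 x y hx hy hsx hsy hz))
  have o2 : Odd ((dvv K).range.relIndex S.q2.J) := odd_relIndex _ _ (cl_ne K) m hmo
    (fun z hz => (mem_Sm z).1 (S.Sm2 hp hd hpd hp4 hd4 qL hm hL h2 x y hx hy hsx hsy hz))
  -- 4 divides h(k2)
  have d4 : 4 ∣ Nat.card (ClassGroup (𝓞 k2)) := by
    have a1 := S.q2.amb_unram (S.unram2 hp4 hd4)
    have a2 := S.q2.amb_parity
    have a3 : 2 ∣ S.q2.amb := by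
      rw [hm] at a2
      have : (2 * m) % 2 = S.q2.amb % 2 := a2
      omega
    obtain ⟨c, hc⟩ := a3
    refine dvd_trans ⟨c, ?_⟩ a1
    rw [hc]; ring
  -- field 2
  have e2 := Subgroup.relIndex_mul_relIndex ((Fx S.q2.su).map (dvv K)) ((dvv K).range ⊓ S.q2.J) S.q2.J
    (le_inf (by rintro _ ⟨x, _, rfl⟩; exact ⟨x, rfl⟩) S.q2.P0_le) inf_le_right
  rw [S.q2.card_F, Subgroup.inf_relIndex_right] at e2
  have hJ2 : S.q2.J = Fx S.q2.ti := le_antisymm S.q2.J_le (S.unram2 hp4 hd4)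
  have e3 := S.q2.H1
  rw [← hJ2] at e3
  rw [e3] at e2
  have n2 := S.q2.nm_dvd S.fr2 ⟨S.ep, S.ep2⟩
  have c2 : ((dvv K).ker.map (Nh S.q2.su)).relIndex ((dvv K).ker ⊓ Fx S.q2.su) = 2 := by
    rcases (Nat.dvd_prime Nat.prime_two).1 n2 with h | h
    · exfalso
      rw [h, mul_one] at e2
      obtain ⟨t, ht⟩ := o2
      omega
    · exact h
  have d8 : ¬ 8 ∣ Nat.card (ClassGroup (𝓞 k2)) := by
    rw [c2] at e2
    obtain ⟨t, ht⟩ := o2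
    omega
  -- field 1
  set A := (dvv K).range ⊓ Fx S.q1.ti with hA
  set B := (Fx S.q1.su).map (dvv K) with hB
  set C := (dvv K).range ⊓ S.q1.J with hC
  have hBC : B ≤ C := le_inf (by rintro _ ⟨x, _, rfl⟩; exact ⟨x, rfl⟩) S.q1.P0_le
  have hCA : C ≤ A := inf_le_inf_left _ S.q1.J_le
  have f3 := Subgroup.relIndex_mul_relIndex B C A hBC hCA
  have f4 := Subgroup.relIndex_mul_relIndex B C S.q1.J hBC inf_le_right
  rw [hB, S.q1.card_F, ← hB, hC, Subgroup.inf_relIndex_right, ← hC] at f4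
  have f5 : 2 ∣ B.relIndex C := by
    rw [← f4] at hk1
    exact Nat.Coprime.dvd_of_dvd_mul_right (Nat.coprime_two_left.2 o1) hk1
  have f6 : 2 ∣ C.relIndex A := two_dvd_relIndex C A S.tw ⟨S.tw_range, S.tw_fix1⟩
    (fun h => S.tw_notJ hp hd hp4 hd4 h.2) ⟨Subgroup.pow_mem _ S.tw_range 2, S.tw_sq1⟩
  have f7 : 2 ∣ ((dvv K).ker.map (Nh S.q1.su)).relIndex ((dvv K).ker ⊓ Fx S.q1.su) := by
    have := S.q1.H1
    rw [← hA, ← hB, ← f3] at this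
    have h4 : 2 * 2 ∣ B.relIndex C * C.relIndex A := mul_dvd_mul f5 f6
    rw [this] at h4
    exact Nat.dvd_of_mul_dvd_mul_left (by norm_num) h4
  refine ⟨⟨d4, d8⟩, S.UI_of (S.q1.nm_sup S.fr1 ⟨S.ep, S.ep1⟩ f7) (S.q2.nm_sup S.fr2 ⟨S.ep, S.ep2⟩ (by rw [c2]))⟩

end BQ
end Q2
end

section
open NumberField nonZeroDivisors
namespace Q2
set_option linter.all false
open scoped NumberTheorySymbols

lemma par_uv (p : ℕ) (hp8 : p % 8 = 1) (u v : ℤ) (h : u ^ 2 - 2 * v ^ 2 = p) : u % 2 = 1 ∧ v % 2 = 0 := by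
  have hu : u % 2 = 1 := by
    rcases Int.emod_two_eq_zero_or_one u with h1 | h1
    · have : (u ^ 2) % 2 = 0 := by simp [pow_two, Int.mul_emod, h1]
      omega
    · exact h1
  refine ⟨hu, ?_⟩
  rcases Int.emod_two_eq_zero_or_one v with h1 | h1
  · exact h1
  · have h2 : (u ^ 2) % 8 = 1 := by
      have : u % 8 = 1 ∨ u % 8 = 3 ∨ u % 8 = 5 ∨ u % 8 = 7 := by omega
      rcases this with h | h | h | h <;> simp [pow_two, Int.mul_emod, h]
    have h3 : (v ^ 2) % 8 = 1 := by
      have : v % 8 = 1 ∨ v % 8 = 3 ∨ v % 8 = 5 ∨ v % 8 = 7 := by omega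
      rcases this with h | h | h | h <;> simp [pow_two, Int.mul_emod, h]
    omega

lemma cop_uv (p : ℕ) (hp : p.Prime) (u v : ℤ) (h : u ^ 2 - 2 * v ^ 2 = p) : IsCoprime u v := by
  rw [Int.isCoprime_iff_gcd_eq_one]
  have h1 : ((u.gcd v : ℤ)) ^ 2 ∣ p := by
    rw [← h]
    have a1 := pow_dvd_pow_of_dvd (Int.gcd_dvd_left (a := u) (b := v)) 2
    have a2 := pow_dvd_pow_of_dvd (Int.gcd_dvd_right (a := u) (b := v)) 2
    exact dvd_sub a1 (a2.mul_left _)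
  have h2 : (u.gcd v) ^ 2 ∣ p := by exact_mod_cast h1
  rw [sq] at h2
  exact Nat.isUnit_iff.1 ((Nat.squarefree_iff_prime_squarefree.2 (fun x hx hxx => by
    have := (Nat.prime_dvd_prime_iff_eq hx hp).1 ((Dvd.intro _ rfl).trans hxx)
    subst this
    have := Nat.le_of_dvd hp.pos hxx
    nlinarith [hp.two_le])) _ h2)

lemma typ3 (p : ℕ) (hp : p.Prime) (hp8 : p % 8 = 1) (u v : ℤ) (h : u ^ 2 - 2 * v ^ 2 = p) (hu : 0 < u)
    (h3 : (u + v) % 4 = 3) (z : ℤ) (hz : (p : ℤ) ∣ v * (v - u) - z ^ 2) : False := by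
  haveI := Fact.mk hp
  obtain ⟨hu2, hv2⟩ := par_uv p hp8 u v h
  have hc := cop_uv p hp u v h
  have hpp : (0 : ℤ) < p := by exact_mod_cast hp.pos
  have huv : 0 < u - v := by nlinarith
  have hv0 : v ≠ 0 := by
    rintro rfl
    have h1 : u ^ 2 = p := by linarith
    have hpr := Nat.prime_iff_prime_int.1 hp
    rw [← h1] at hpr
    exact hpr.irreducible.not_isSquare (IsSquare.sq u)
  have hp4 : p % 4 = 1 := by omega
  obtain ⟨e, y, hy, hvy, hJ⟩ := j_rec p hp4 v hv0
  rw [j_two_one p hp8, one_pow, one_mul] at hJ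
  have hyv : (y : ℤ) ∣ v := by
    rw [← Int.dvd_natAbs, hvy]; push_cast; exact Dvd.intro_left _ rfl
  have hJ1 : J(v | p) = 1 := by
    rw [hJ, jacobiSym.mod_left' (b := y) (a₁ := p) (a₂ := u ^ 2)]
    · exact jacobiSym.sq_one' (Int.isCoprime_iff_gcd_eq_one.1 (hc.of_isCoprime_of_dvd_right hyv))
    · rw [← h]
      apply Int.ModEq.symm
      rw [Int.modEq_iff_dvd]
      exact (hyv.mul_left (-2 * v)).trans (by ring_nf; exact dvd_rfl)
  obtain ⟨e', y', hy', hvy', hJ'⟩ := j_rec p hp4 (v - u) (by omega)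
  rw [j_two_one p hp8, one_pow, one_mul] at hJ'
  have he' : e' = 0 := by
    by_contra hne
    obtain ⟨k, rfl⟩ := Nat.exists_eq_succ_of_ne_zero hne
    rw [pow_succ, mul_comm (2 ^ k) 2, mul_assoc] at hvy'
    omega
  rw [he', pow_zero, one_mul] at hvy'
  have hy4 : y' % 4 = 3 := by omega
  have hyy : (y' : ℤ) = u - v := by omega
  have hJ2 : J(v - u | p) = -1 := by
    rw [hJ', jacobiSym.mod_left' (b := y') (a₁ := p) (a₂ := -1 * u ^ 2)]
    · rw [jacobiSym.mul_left, jacobiSym.at_neg_one hy', ZMod.χ₄_nat_three_mod_four hy4, jacobiSym.sq_one', mul_one]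
      rw [hyy, ← Int.isCoprime_iff_gcd_eq_one]
      have := hc.neg_right.add_mul_left_right 1
      rwa [mul_one, show -v + u = u - v by ring] at this
    · rw [← h]
      apply Int.ModEq.symm
      rw [Int.modEq_iff_dvd, hyy]
      exact ⟨2 * (u + v), by ring⟩
  have hJ3 : J(v * (v - u) | p) = -1 := by rw [jacobiSym.mul_left, hJ1, hJ2]; norm_num
  rw [jacobiSym.mod_left' (b := p) (a₁ := v * (v - u)) (a₂ := z ^ 2)
    ((Int.modEq_iff_dvd.2 hz).symm), jacobiSym.pow_left] at hJ3
  nlinarith [sq_nonneg J(z | p)]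

namespace BQ
variable {k0 k1 k2 K : Type*} [Field k0] [NumberField k0] [Field k1] [NumberField k1]
    [Field k2] [NumberField k2] [Field K] [NumberField K] {p d : ℕ} (S : BQ k0 k1 k2 K p d)

/-- exchange the primes -/
noncomputable def swap : BQ k0 k1 k2 K d p :=
  { S with
    s1 := by rw [S.s1, mul_comm]
    s2 := by rw [S.s2]; ring }

lemma pr5 (S : BQ k0 k1 k2 K p d) (l : ℕ) (hl : l.Prime) (h5 : l % 8 = 5) :
    ∃ Q0 : Ideal (𝓞 k0), ∀ Q : Ideal (𝓞 k0), Q.IsPrime → (l : 𝓞 k0) ∈ Q → Q = Q0 := by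
  haveI := Fact.mk hl
  by_cases hex : ∃ Q : Ideal (𝓞 k0), Q.IsPrime ∧ (l : 𝓞 k0) ∈ Q
  · obtain ⟨Q0, h1, h2⟩ := hex
    refine ⟨Q0, fun Q h3 h4 => ?_⟩
    have hi := S.Q0.inertQ S.r0 S.hr0 2 (by exact_mod_cast S.s0) Int.prime_two.squarefree l hl (by omega)
      (fun a b hab => legendreSym.prime_dvd_of_eq_neg_one (a := 2) (by
        rw [jacobiSym.legendreSym.to_jacobiSym]; exact j_two_five l h5) hab) Q0 h1 h2
    rcases S.Q0.conjQ Q0 Q h1 h3 l hl h2 h4 with h | h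
    · exact h
    · rw [h, hi]
  · exact ⟨⊤, fun Q h1 h2 => (hex ⟨Q, h1, h2⟩).elim⟩

lemma pr1 (S : BQ k0 k1 k2 K p d) (l : ℕ) (hl : l.Prime) :
    ∃ Q0 Q1 : Ideal (𝓞 k0), ∀ Q : Ideal (𝓞 k0), Q.IsPrime → (l : 𝓞 k0) ∈ Q → Q = Q0 ∨ Q = Q1 := by
  by_cases hex : ∃ Q : Ideal (𝓞 k0), Q.IsPrime ∧ (l : 𝓞 k0) ∈ Q
  · obtain ⟨Q0, h1, h2⟩ := hex
    exact ⟨Q0, Q0.map S.Q0.os, fun Q h3 h4 => S.Q0.conjQ Q0 Q h1 h3 l hl h2 h4⟩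
  · exact ⟨⊤, ⊤, fun Q h1 h2 => (hex ⟨Q, h1, h2⟩).elim⟩

lemma ram0 (hp4 : p % 4 = 1) (hd4 : d % 4 = 1) (P : Ideal (𝓞 K)) (hP : P.IsPrime) (hθ : ∀ θ, θ - S.q0.os θ ∈ P) :
    (p : 𝓞 k0) ∈ P.comap S.q0.of ∨ (d : 𝓞 k0) ∈ P.comap S.q0.of := by
  have hD : ((p * d : ℕ) : ℤ) = 4 * ((p * d / 4 : ℕ) : ℤ) + 1 := by
    have : p * d % 4 = 1 := by rw [Nat.mul_mod, hp4, hd4]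
    omega
  obtain ⟨θ, -, hθ'⟩ := S.q0.theta (p * d / 4 : ℕ) (p * d : ℕ) hD S.b (by rw [S.b2]; push_cast; rfl) S.sb0
  have h1 := hθ θ
  rw [hθ'] at h1
  have h2 : (p : 𝓞 K) * d ∈ P := by rw [← S.b2, sq]; exact P.mul_mem_left _ h1
  rw [Ideal.mem_comap, Ideal.mem_comap, map_natCast, map_natCast]
  exact hP.mem_or_mem h2

variable [IsTotallyReal k0] [IsTotallyReal K]

lemma cl2_55 (S : BQ k0 k1 k2 K p d) (hp : p.Prime) (hd : d.Prime) (hp8 : p % 8 = 5) (hd8 : d % 8 = 5) :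
    (dvv K).range.relIndex ((dvv K).range.comap (sqh (IG K))) ∣ 2 := by
  classical
  obtain ⟨Q1, hQ1⟩ := S.pr5 p hp hp8
  obtain ⟨Q2, hQ2⟩ := S.pr5 d hd hd8
  have hb : S.q0.J.relIndex (Fx S.q0.ti) ∣ 2 ^ (1 + 1) := by
    refine (S.q0.ram_bound {Q1, Q2} ?_).trans (pow_dvd_pow 2 Finset.card_le_two)
    intro P hP hP0 hPs hθ
    rw [Finset.mem_insert, Finset.mem_singleton]
    exact (S.ram0 (by omega) (by omega) P hP hθ).imp (hQ1 _ (hP.comap _)) (hQ2 _ (hP.comap _))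
  have := S.q0.amb_ram hb
  rw [S.h0] at this
  unfold QE.amb at this
  rwa [S.q0.amb_one S.h0] at this

lemma nonnorm (hp : p.Prime) (hd : d.Prime) (hpd : p ≠ d) (hp8 : p % 8 = 1) (u v : ℤ) (h : u ^ 2 - 2 * v ^ 2 = p) (hu : 0 < u)
    (h3 : (u + v) % 4 = 3) (y : K) : y * S.q0.s y ≠ S.q0.f (S.ep0 : 𝓞 k0) := by
  intro hy
  have hN : ((u : 𝓞 k0) + v * S.r0) * (u - v * S.r0) = (p : 𝓞 k0) := by
    have h' : ((u ^ 2 - 2 * v ^ 2 : ℤ) : 𝓞 k0) = ((p : ℤ) : 𝓞 k0) := by rw [h]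
    push_cast at h'
    rw [← h']; linear_combination -(v : 𝓞 k0) ^ 2 * S.s0
  have hpi := Nat.prime_iff_prime_int.1 hp
  have hnu : Ideal.span {(u : 𝓞 k0) + v * S.r0} ≠ ⊤ := by
    rw [Ne, Ideal.span_singleton_eq_top]
    rintro ⟨w, hw⟩
    have := S.Q0.nm_of_unit w p (by
      rw [hw, map_add, map_mul, map_intCast, map_intCast, S.Qs0, mul_neg, ← sub_eq_add_neg, hN]; simp)
    exact hpi.not_isUnit this
  obtain ⟨Q, hQm, hQ⟩ := Ideal.exists_le_maximal _ hnu
  haveI := hQm.isPrime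
  have hπ : (u : 𝓞 k0) + v * S.r0 ∈ Q := hQ (Ideal.mem_span_singleton_self _)
  have hpQ : (p : 𝓞 k0) ∈ Q := by rw [← hN]; exact Q.mul_mem_right _ hπ
  have hInt : ∀ n : ℤ, (n : 𝓞 k0) ∈ Q → (p : ℤ) ∣ n := fun n hn => int_dvd_of_mem Q hQm.ne_top p hp hpQ n hn
  have hp2 : (p : 𝓞 k0) ∉ Q ^ 2 := by
    apply S.Q0.notsq Q hQm.isPrime p hp hpQ S.r0
    rw [S.Qs0]
    intro h4
    have h5 : ((8 : ℤ) : 𝓞 k0) ∈ Q := by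
      have := Q.mul_mem_left (S.r0 - -S.r0) h4
      have e : (S.r0 - -S.r0) * (S.r0 - -S.r0) = ((8 : ℤ) : 𝓞 k0) := by
        push_cast; linear_combination 4 * S.s0
      rwa [e] at this
    have h6 := hInt 8 h5
    have h7 : p ∣ 2 ^ 3 := by exact_mod_cast h6
    have := (Nat.prime_dvd_prime_iff_eq hp Nat.prime_two).1 (hp.dvd_of_dvd_pow h7)
    omega
  have hD2 : (p : 𝓞 k0) * d ∉ Q ^ 2 := by
    intro h4
    obtain ⟨a, b, hab⟩ := (Nat.isCoprime_iff_coprime (m := p) (n := d)).2 ((Nat.coprime_primes hp hd).2 hpd)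
    apply hp2
    have hab' : (a : 𝓞 k0) * p + b * d = 1 := by exact_mod_cast congrArg (fun n : ℤ => (n : 𝓞 k0)) hab
    have h5 : (p : 𝓞 k0) = a * (p * p) + b * (p * d) := by linear_combination -(p : 𝓞 k0) * hab'
    rw [h5]
    refine (Q ^ 2).add_mem ((Q ^ 2).mul_mem_left _ ?_) ((Q ^ 2).mul_mem_left _ h4)
    rw [sq]; exact Ideal.mul_mem_mul hpQ hpQ
  obtain ⟨c, hc⟩ := S.q0.NN ((p : 𝓞 k0) * d) (by
      have h1 := cv S.b2
      rw [S.e0]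
      have h2 : S.q0.of ((p : 𝓞 k0) * d) = (p : 𝓞 K) * d := by rw [map_mul, map_natCast, map_natCast]
      have h3 := cv h2
      exact h1.trans h3.symm) Q (Q.mul_mem_right _ hpQ) hD2 S.ep0 y hy
  obtain ⟨m, n, rfl⟩ := S.Q0.int_of_two S.r0 S.hr0 S.s0 c
  apply typ3 p hp hp8 u v h hu h3 (v * m - n * u)
  apply hInt
  have h5 : (1 : 𝓞 k0) + S.r0 - (m + n * S.r0) ^ 2 ∈ Q := hc
  have e : ((v * (v - u) - (v * m - n * u) ^ 2 : ℤ) : 𝓞 k0) = (v : 𝓞 k0) ^ 2 * ((1 : 𝓞 k0) + S.r0 - (m + n * S.r0) ^ 2)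
      + (-(v : 𝓞 k0) + n * (2 * v * m + n * (v * S.r0 - u))) * ((u : 𝓞 k0) + v * S.r0) := by
    push_cast; ring
  rw [e]
  exact Q.add_mem (Q.mul_mem_left _ h5) (Q.mul_mem_left _ hπ)

lemma cl2_15 (S : BQ k0 k1 k2 K p d) (hp : p.Prime) (hd : d.Prime) (hpd : p ≠ d) (hp8 : p % 8 = 1) (hd8 : d % 8 = 5) (u v : ℤ)
    (h : u ^ 2 - 2 * v ^ 2 = p) (hu : 0 < u) (h3 : (u + v) % 4 = 3) :
    (dvv K).range.relIndex ((dvv K).range.comap (sqh (IG K))) ∣ 2 := by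
  classical
  obtain ⟨Q1, Q1', hQ1⟩ := S.pr1 p hp
  obtain ⟨Q2, hQ2⟩ := S.pr5 d hd hd8
  have hb : S.q0.J.relIndex (Fx S.q0.ti) ∣ 2 ^ (1 + 2) := by
    refine (S.q0.ram_bound {Q1, Q1', Q2} ?_).trans (pow_dvd_pow 2 Finset.card_le_three)
    intro P hP hP0 hPs hθ
    rw [Finset.mem_insert, Finset.mem_insert, Finset.mem_singleton, ← or_assoc]
    exact (S.ram0 (by omega) (by omega) P hP hθ).imp (hQ1 _ (hP.comap _)) (hQ2 _ (hP.comap _))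
  have := S.q0.amb_ram' hb (S.q0.W_even S.ep0 (S.nonnorm hp hd hpd hp8 u v h hu h3))
  rw [S.h0] at this
  unfold QE.amb at this
  rwa [S.q0.amb_one S.h0] at this

end BQ
end Q2
end

section
open NumberField nonZeroDivisors
namespace Q2
set_option linter.all false

lemma int_quad' {M : Type*} [Field M] [NumberField M] (θ : M) (x c : 𝓞 M) (h : θ ^ 2 - x * θ + c = 0) : IsIntegral ℤ θ := by
  apply isIntegral_trans (R := ℤ) (A := 𝓞 M)
  refine ⟨Polynomial.X ^ 2 - Polynomial.C x * Polynomial.X + Polynomial.C c, ?_, ?_⟩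
  · monicity!
  · simp only [Polynomial.eval₂_add, Polynomial.eval₂_sub, Polynomial.eval₂_mul, Polynomial.eval₂_pow, Polynomial.eval₂_X, Polynomial.eval₂_C]
    exact h

namespace QE
variable {L M : Type*} [Field L] [NumberField L] [Field M] [NumberField M] (q : QE L M)

lemma theta' (t : 𝓞 M) (x c : 𝓞 L) (h : t ^ 2 = q.of (x ^ 2 - 4 * c)) (hs : q.os t = -t) :
    ∃ θ : 𝓞 M, θ - q.os θ = t := by
  have h2 : (2 : M) ≠ 0 := two_ne_zero
  have hx' : (t : M) ^ 2 = (q.of x : M) ^ 2 - 4 * (q.of c : M) := by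
    have h1 : t ^ 2 = (q.of x) ^ 2 - 4 * q.of c := by rw [h, map_sub, map_mul, map_pow, map_ofNat q.of 4]
    have := congrArg (algebraMap (𝓞 M) M) h1
    rw [map_pow, map_sub, map_pow, map_mul, map_ofNat] at this
    exact this
  have hs' : q.s (t : M) = - t := congrArg (algebraMap (𝓞 M) M) hs
  have hi : IsIntegral ℤ (((q.of x : M) + (t : M)) / 2) := by
    apply int_quad' _ (q.of x) (q.of c)
    field_simp
    linear_combination hx'
  refine ⟨⟨_, hi⟩, ?_⟩
  apply RingOfIntegers.ext
  show (((q.of x : M) + (t : M)) / 2) - q.s (((q.of x : M) + (t : M)) / 2) = t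
  rw [map_div₀, map_add, hs', show q.s (q.of x : M) = q.of x from q.sf x]
  simp only [map_ofNat]
  field_simp; ring

lemma theta_rs (w : 𝓞 L) (hw : w ^ 2 = 2) (r s : ℤ) (hs2 : s % 2 = 0) (h1 : (r + s) % 4 = 1)
    (t : 𝓞 M) (ht : t ^ 2 = q.of (r + s * w)) (hst : q.os t = -t) : ∃ θ : 𝓞 M, θ - q.os θ = t := by
  have : s % 4 = 0 ∨ s % 4 = 2 := by omega
  rcases this with h | h
  · obtain ⟨m, rfl⟩ : ∃ m, r = 1 + 4 * m := ⟨r / 4, by omega⟩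
    obtain ⟨n, rfl⟩ : ∃ n, s = 4 * n := ⟨s / 4, by omega⟩
    apply q.theta' t 1 (-m - n * w) _ hst
    rw [ht]; congr 1; push_cast; ring
  · obtain ⟨m, rfl⟩ : ∃ m, r = 3 + 4 * m := ⟨r / 4, by omega⟩
    obtain ⟨n, rfl⟩ : ∃ n, s = 2 + 4 * n := ⟨s / 4, by omega⟩
    apply q.theta' t (1 + w) (-m - n * w) _ hst
    rw [ht]; congr 1; push_cast; linear_combination -hw

lemma unram_M (w : 𝓞 L) (hw : w ^ 2 = 2) (r s : ℤ) (hc : IsCoprime r s) (hs2 : s % 2 = 0) (h1 : (r + s) % 4 = 1)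
    (t t' : 𝓞 M) (ht : t ^ 2 = q.of (r + s * w)) (ht' : t' ^ 2 = q.of (r - s * w))
    (hst : q.os t = -t) (hst' : q.os t' = -t') : Fx q.ti ≤ q.J := by
  obtain ⟨θ, hθ⟩ := q.theta_rs w hw r s hs2 h1 t ht hst
  obtain ⟨θ', hθ'⟩ := q.theta_rs w hw r (-s) (by omega) (by omega) t' (by rw [ht']; congr 1; push_cast; ring) hst'
  have m1 : t ^ 2 ∈ Ideal.span {t, t'} := by rw [sq]; exact Ideal.mul_mem_left _ _ (Ideal.subset_span (by simp))
  have m2 : t' ^ 2 ∈ Ideal.span {t, t'} := by rw [sq]; exact Ideal.mul_mem_left _ _ (Ideal.subset_span (by simp))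
  apply q.unram_two θ θ' t t' hθ hθ' (2 * r) (r ^ 2 - 2 * s ^ 2)
  · apply IsCoprime.mul_left
    · rw [Int.isCoprime_iff_gcd_eq_one]
      have : r % 2 = 1 := by omega
      have h3 : (r ^ 2) % 2 = 1 := by simp [pow_two, Int.mul_emod, this]
      rcases Nat.Prime.eq_one_or_self_of_dvd Nat.prime_two _ (by
        have := Int.gcd_dvd_left (a := 2) (b := r ^ 2 - 2 * s ^ 2)
        exact_mod_cast this) with h | h
      · exact h
      · have := Int.gcd_dvd_right (a := 2) (b := r ^ 2 - 2 * s ^ 2)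
        rw [h] at this
        omega
    · have h2 : IsCoprime r (-2 * s ^ 2) := by
        apply IsCoprime.mul_right _ (hc.pow_right)
        rw [Int.isCoprime_iff_gcd_eq_one]
        rcases Nat.Prime.eq_one_or_self_of_dvd Nat.prime_two _ (by
          have := Int.gcd_dvd_right (a := r) (b := -2)
          have h9 : ((r.gcd (-2) : ℕ) : ℤ) ∣ ((2 : ℕ) : ℤ) := dvd_neg.1 this
          exact Int.natCast_dvd_natCast.1 h9) with h | h
        · exact h
        · have := Int.gcd_dvd_left (a := r) (b := -2)
          rw [h] at this
          omega
      have := h2.add_mul_left_right r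
      rwa [show -2 * s ^ 2 + r * r = r ^ 2 - 2 * s ^ 2 by ring] at this
  · have : ((2 * r : ℤ) : 𝓞 M) = t ^ 2 + t' ^ 2 := by
      rw [ht, ht', ← map_add, show ((r : 𝓞 L) + s * w + (r - s * w)) = ((2 * r : ℤ) : 𝓞 L) by push_cast; ring, map_intCast]
    rw [this]; exact Ideal.add_mem _ m1 m2
  · have : ((r ^ 2 - 2 * s ^ 2 : ℤ) : 𝓞 M) = t ^ 2 * t' ^ 2 := by
      rw [ht, ht', ← map_mul, show ((r : 𝓞 L) + s * w) * (r - s * w) = ((r ^ 2 - 2 * s ^ 2 : ℤ) : 𝓞 L) by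
        push_cast; linear_combination -(s : 𝓞 L) ^ 2 * hw, map_intCast]
    rw [this]; exact Ideal.mul_mem_left _ _ m2

lemma caseA [IsTotallyReal L] [IsTotallyReal M] (w : 𝓞 L) (hw : w ^ 2 = 2) (r s : ℤ) (hc : IsCoprime r s) (hs2 : s % 2 = 0) (h1 : (r + s) % 4 = 1)
    (t t' : 𝓞 M) (ht : t ^ 2 = q.of (r + s * w)) (ht' : t' ^ 2 = q.of (r - s * w))
    (hst : q.os t = -t) (hst' : q.os t' = -t') : 2 ∣ Nat.card (ClassGroup (𝓞 L)) :=
  (Dvd.intro_left _ rfl).trans (q.amb_unram (q.unram_M w hw r s hc hs2 h1 t t' ht ht' hst hst'))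
end QE

lemma cop_uv' (D : ℕ) (hD : Squarefree D) (u v : ℤ) (h : u ^ 2 - 2 * v ^ 2 = D) : IsCoprime u v := by
  rw [Int.isCoprime_iff_gcd_eq_one]
  have h1 : ((u.gcd v : ℤ)) ^ 2 ∣ D := by
    rw [← h]
    have a1 := pow_dvd_pow_of_dvd (Int.gcd_dvd_left (a := u) (b := v)) 2
    have a2 := pow_dvd_pow_of_dvd (Int.gcd_dvd_right (a := u) (b := v)) 2
    exact dvd_sub a1 (a2.mul_left _)
  have h2 : (u.gcd v) ^ 2 ∣ D := by exact_mod_cast h1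
  rw [sq] at h2
  exact Nat.isUnit_iff.1 (hD _ h2)

lemma prod_pos' (u v u' v' : ℤ) (hu : 0 < u) (hu' : 0 < u') (h : 2 * v ^ 2 < u ^ 2) (h' : 2 * v' ^ 2 < u' ^ 2) :
    0 < u * u' + 2 * v * v' := by
  have h1 : (2 * v * v') ^ 2 < (u * u') ^ 2 := by
    have := mul_lt_mul'' h h' (by positivity) (by positivity)
    nlinarith
  have := (abs_lt_of_sq_lt_sq h1 (by positivity))
  rw [abs_lt] at this
  linarith [this.1]

/-- explicit small certificate for an unramified extension -/
def CaseA (p d : ℕ) : Prop :=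
  ∃ (D : ℕ) (r s : ℤ), (D = p ∨ D = d ∨ D = p * d) ∧ r ^ 2 - 2 * s ^ 2 = D ∧ 0 < r ∧ s % 2 = 0 ∧ (r + s) % 4 = 1

namespace BQ
variable {k0 k1 k2 K : Type*} [Field k0] [NumberField k0] [Field k1] [NumberField k1]
    [Field k2] [NumberField k2] [Field K] [NumberField K] {p d : ℕ} (S : BQ k0 k1 k2 K p d)
    [IsTotallyReal k0] [IsTotallyReal K]

lemma dich (S : BQ k0 k1 k2 K p d) (hp : p.Prime) (hd : d.Prime) (hpd : p ≠ d) (hp4 : p % 4 = 1) (hd4 : d % 4 = 1) :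
    CaseA p d ∨ (dvv K).range.relIndex ((dvv K).range.comap (sqh (IG K))) ∣ 2 := by
  have rep : ∀ l : ℕ, l.Prime → l % 4 = 1 → l % 8 = 5 ∨ (∃ u v : ℤ, u ^ 2 - 2 * v ^ 2 = l ∧ 0 < u ∧ v % 2 = 0 ∧ u % 2 = 1 ∧ l % 8 = 1) := by
    intro l hl hl4
    have : l % 8 = 5 ∨ l % 8 = 1 := by omega
    rcases this with h | h
    · exact Or.inl h
    · obtain ⟨u, v, h1, h2⟩ := S.Q0.rep_two S.r0 S.hr0 S.s0 S.Qs0 l hl h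
      obtain ⟨h3, h4⟩ := par_uv l h u v h1
      exact Or.inr ⟨u, v, h1, h2, h4, h3, h⟩
  rcases rep p hp hp4 with h5 | ⟨u, v, h1, h2, h3, h4, h8⟩
  · rcases rep d hd hd4 with h5' | ⟨u', v', h1', h2', h3', h4', h8'⟩
    · exact Or.inr (S.cl2_55 hp hd h5 h5')
    · have : (u' + v') % 4 = 1 ∨ (u' + v') % 4 = 3 := by omega
      rcases this with h | h
      · exact Or.inl ⟨d, u', v', Or.inr (Or.inl rfl), h1', h2', h3', h⟩
      · exact Or.inr (S.swap.cl2_15 hd hp hpd.symm h8' h5 u' v' h1' h2' h)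
  · have : (u + v) % 4 = 1 ∨ (u + v) % 4 = 3 := by omega
    rcases this with h | h
    · exact Or.inl ⟨p, u, v, Or.inl rfl, h1, h2, h3, h⟩
    rcases rep d hd hd4 with h5' | ⟨u', v', h1', h2', h3', h4', h8'⟩
    · exact Or.inr (S.cl2_15 hp hd hpd h8 h5' u v h1 h2 h)
    · have : (u' + v') % 4 = 1 ∨ (u' + v') % 4 = 3 := by omega
      rcases this with h' | h'
      · exact Or.inl ⟨d, u', v', Or.inr (Or.inl rfl), h1', h2', h3', h'⟩
      · left
        have hp0 : (0 : ℤ) < p := by exact_mod_cast hp.pos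
        have hd0 : (0 : ℤ) < d := by exact_mod_cast hd.pos
        refine ⟨p * d, u * u' + 2 * v * v', u * v' + v * u', Or.inr (Or.inr rfl), ?_, ?_, ?_, ?_⟩
        · push_cast; rw [← h1, ← h1']; ring
        · exact prod_pos' u v u' v' h2 h2' (by linarith) (by linarith)
        · rw [Int.add_emod, Int.mul_emod u v', Int.mul_emod v u', h3, h3']; simp
        · obtain ⟨m, rfl⟩ : ∃ m, v = 2 * m := ⟨v / 2, by omega⟩
          obtain ⟨n, rfl⟩ : ∃ n, v' = 2 * n := ⟨v' / 2, by omega⟩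
          obtain ⟨a, ha⟩ : ∃ a, u + 2 * m = 4 * a + 3 := ⟨(u + 2 * m) / 4, by omega⟩
          obtain ⟨b, hb⟩ : ∃ b, u' + 2 * n = 4 * b + 3 := ⟨(u' + 2 * n) / 4, by omega⟩
          have e : u * u' + 2 * (2 * m) * (2 * n) + (u * (2 * n) + 2 * m * u') = (u + 2 * m) * (u' + 2 * n) + 4 * (m * n) := by ring
          rw [e, ha, hb, show (4 * a + 3) * (4 * b + 3) + 4 * (m * n) = 1 + 4 * (4 * a * b + 3 * a + 3 * b + 2 + m * n) by ring]
          omega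
end BQ
end Q2
end

section
open NumberField nonZeroDivisors
namespace Q2
set_option linter.all false

lemma adj_rep (S : Set ℝ) (r : ℝ) (hr : r ^ 2 ∈ Qadj S) (x : ℝ) (hx : x ∈ Qadj (insert r S)) :
    ∃ a ∈ Qadj S, ∃ b ∈ Qadj S, x = a + b * r := by
  unfold Qadj at hx
  induction hx using IntermediateField.adjoin_induction with
  | mem x hx =>
    rcases hx with rfl | hx
    · exact ⟨0, zero_mem _, 1, one_mem _, by ring⟩
    · exact ⟨x, IntermediateField.subset_adjoin ℚ S hx, 0, zero_mem _, by ring⟩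
  | algebraMap x => exact ⟨_, (Qadj S).algebraMap_mem x, 0, zero_mem _, by ring⟩
  | add x y _ _ hx hy =>
    obtain ⟨a, ha, b, hb, rfl⟩ := hx
    obtain ⟨a', ha', b', hb', rfl⟩ := hy
    exact ⟨a + a', add_mem ha ha', b + b', add_mem hb hb', by ring⟩
  | mul x y _ _ hx hy =>
    obtain ⟨a, ha, b, hb, rfl⟩ := hx
    obtain ⟨a', ha', b', hb', rfl⟩ := hy
    exact ⟨a * a' + b * b' * r ^ 2, add_mem (mul_mem ha ha') (mul_mem (mul_mem hb hb') hr),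
      a * b' + b * a', add_mem (mul_mem ha hb') (mul_mem hb ha'), by ring⟩
  | inv x _ hx =>
    obtain ⟨a, ha, b, hb, rfl⟩ := hx
    by_cases h0 : a ^ 2 - b ^ 2 * r ^ 2 = 0
    · have : (a - b * r) * (a + b * r) = 0 := by linear_combination h0
      rcases mul_eq_zero.1 this with h | h
      · refine ⟨(a + a)⁻¹, inv_mem (add_mem ha ha), 0, zero_mem _, ?_⟩
        rw [show b * r = a by linear_combination -h]; ring
      · rw [h]; exact ⟨0, zero_mem _, 0, zero_mem _, by simp⟩
    · have h1 : a + b * r ≠ 0 := by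
        intro h; apply h0; linear_combination (a - b * r) * h
      have hm : a ^ 2 - b ^ 2 * r ^ 2 ∈ Qadj S := sub_mem (pow_mem ha 2) (mul_mem (pow_mem hb 2) hr)
      refine ⟨a * (a ^ 2 - b ^ 2 * r ^ 2)⁻¹, mul_mem ha (inv_mem hm), -b * (a ^ 2 - b ^ 2 * r ^ 2)⁻¹, mul_mem (neg_mem hb) (inv_mem hm), ?_⟩
      field_simp
      ring

lemma sub_adj {S : Set ℝ} {x : ℝ} (h : x ∈ S) : x ∈ Qadj S := IntermediateField.subset_adjoin ℚ S h

lemma Qadj_mono {S T : Set ℝ} (h : ∀ x ∈ S, x ∈ Qadj T) : Qadj S ≤ Qadj T :=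
  IntermediateField.adjoin_le_iff.2 h

lemma mem_empty (x : ℝ) : x ∈ Qadj ∅ ↔ ∃ c : ℚ, (c : ℝ) = x := by
  unfold Qadj
  rw [IntermediateField.adjoin_empty, IntermediateField.mem_bot]
  rfl

lemma nonsq (S : Set ℝ) (r x : ℝ) (hr : r ^ 2 ∈ Qadj S) (hx2 : x ^ 2 ∈ Qadj S) (hrn : r ∉ Qadj S)
    (hx : x ∈ Qadj (insert r S)) : x ∈ Qadj S ∨ x * r ∈ Qadj S := by
  obtain ⟨a, ha, b, hb, rfl⟩ := adj_rep S r hr x hx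
  by_cases hab : a * b = 0
  · rcases mul_eq_zero.1 hab with rfl | rfl
    · right
      rw [show (0 + b * r) * r = b * r ^ 2 by ring]; exact mul_mem hb hr
    · left; simpa using ha
  · exfalso
    apply hrn
    have h1 : a ≠ 0 := left_ne_zero_of_mul hab
    have h2 : b ≠ 0 := right_ne_zero_of_mul hab
    have : r = ((a + b * r) ^ 2 - a ^ 2 - b ^ 2 * r ^ 2) * (a * b + a * b)⁻¹ := by
      have h3 : a * b + a * b ≠ 0 := by rw [← two_mul]; exact mul_ne_zero two_ne_zero hab
      field_simp; ring
    rw [this]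
    exact mul_mem (sub_mem (sub_mem hx2 (pow_mem ha 2)) (mul_mem (pow_mem hb 2) hr)) (inv_mem (add_mem (mul_mem ha hb) (mul_mem ha hb)))

lemma mkQE {F : Type*} [Field F] (i : F →+* ℝ) (E : IntermediateField ℚ ℝ) (hi : ∀ y, i y ∈ E) (r : ℝ) (hr : r ∈ E) (c : F)
    (hc : r ^ 2 = i c) (hn : ∀ y, i y ≠ r) (hrep : ∀ x ∈ E, ∃ a b, x = i a + i b * r) :
    ∃ q : QE F E, (∀ y, ((q.f y : E) : ℝ) = i y) ∧ ((q.r : E) : ℝ) = r := by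
  have huniq : ∀ a b a' b', i a + i b * r = i a' + i b' * r → a = a' ∧ b = b' := by
    intro a b a' b' h
    by_cases hb : b = b'
    · subst hb; exact ⟨i.injective (by linarith), rfl⟩
    · exfalso
      have h1 : i b - i b' ≠ 0 := fun h => hb (i.injective (by linarith))
      apply hn ((a' - a) / (b - b'))
      rw [map_div₀, map_sub, map_sub, div_eq_iff h1]; linear_combination -h
  choose! A B hAB using hrep
  have hA : ∀ a b, A (i a + i b * r) = a ∧ B (i a + i b * r) = b := fun a b => by
    have := hAB (i a + i b * r) (E.add_mem (hi a) (E.mul_mem (hi b) hr))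
    obtain ⟨h1, h2⟩ := huniq _ _ _ _ this
    exact ⟨h1.symm, h2.symm⟩
  have hmem : ∀ a b, i a + i b * r ∈ E := fun a b => E.add_mem (hi a) (E.mul_mem (hi b) hr)
  let s0 : E → E := fun x => ⟨i (A x) + i (-(B x)) * r, hmem _ _⟩
  have hs0 : ∀ a b, s0 ⟨i a + i b * r, hmem a b⟩ = ⟨i a + i (-b) * r, hmem a (-b)⟩ := fun a b => by
    apply Subtype.ext
    show i (A (i a + i b * r)) + i (-(B (i a + i b * r))) * r = _
    rw [(hA a b).1, (hA a b).2]
  have hrepE : ∀ x : E, ∃ a b, x = ⟨i a + i b * r, hmem a b⟩ := fun x => ⟨A x, B x, Subtype.ext (hAB x x.2)⟩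
  let s : E →+* E :=
    { toFun := s0
      map_one' := by
        have : (1 : E) = ⟨i 1 + i 0 * r, hmem 1 0⟩ := Subtype.ext (by simp)
        rw [this, hs0]; apply Subtype.ext; simp
      map_zero' := by
        have : (0 : E) = ⟨i 0 + i 0 * r, hmem 0 0⟩ := Subtype.ext (by simp)
        rw [this, hs0]; apply Subtype.ext; simp
      map_add' := by
        intro x y
        obtain ⟨a, b, rfl⟩ := hrepE x
        obtain ⟨a', b', rfl⟩ := hrepE y
        have : (⟨i a + i b * r, hmem a b⟩ : E) + ⟨i a' + i b' * r, hmem a' b'⟩ = ⟨i (a + a') + i (b + b') * r, hmem _ _⟩ :=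
          Subtype.ext (by
            show i a + i b * r + (i a' + i b' * r) = i (a + a') + i (b + b') * r
            rw [map_add, map_add]; ring)
        rw [this, hs0, hs0, hs0]
        apply Subtype.ext
        show i (a + a') + i (-(b + b')) * r = i a + i (-b) * r + (i a' + i (-b') * r)
        simp only [map_add, map_neg]; ring
      map_mul' := by
        intro x y
        obtain ⟨a, b, rfl⟩ := hrepE x
        obtain ⟨a', b', rfl⟩ := hrepE y
        have : (⟨i a + i b * r, hmem a b⟩ : E) * ⟨i a' + i b' * r, hmem a' b'⟩ = ⟨i (a * a' + b * b' * c) + i (a * b' + b * a') * r, hmem _ _⟩ :=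
          Subtype.ext (by
            show (i a + i b * r) * (i a' + i b' * r) = i (a * a' + b * b' * c) + i (a * b' + b * a') * r
            simp only [map_add, map_mul]; rw [← hc]; ring)
        rw [this, hs0, hs0, hs0]
        apply Subtype.ext
        show i (a * a' + b * b' * c) + i (-(a * b' + b * a')) * r = (i a + i (-b) * r) * (i a' + i (-b') * r)
        simp only [map_add, map_neg, map_mul]; rw [← hc]; ring }
  have hse : ∀ x, s x = s0 x := fun x => rfl
  let f : F →+* E :=
    { toFun := fun y => ⟨i y, hi y⟩
      map_one' := Subtype.ext (map_one i)
      map_zero' := Subtype.ext (map_zero i)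
      map_add' := fun x y => Subtype.ext (map_add i x y)
      map_mul' := fun x y => Subtype.ext (map_mul i x y) }
  refine ⟨{ f := f, s := s, r := ⟨r, hr⟩, ss := ?_, sf := ?_, fix := ?_, sr := ?_, r0 := ?_ }, fun y => rfl, rfl⟩
  · intro x
    obtain ⟨a, b, rfl⟩ := hrepE x
    rw [hse ⟨_, hmem a b⟩, hs0, hse ⟨_, hmem a (-b)⟩, hs0]; apply Subtype.ext; simp
  · intro y
    have : f y = ⟨i y + i 0 * r, hmem y 0⟩ := Subtype.ext (by show i y = _; simp)
    rw [this, hse, hs0]; apply Subtype.ext; simp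
  · intro x hx
    obtain ⟨a, b, rfl⟩ := hrepE x
    rw [hse, hs0] at hx
    have h1 := congrArg (fun z : E => (z : ℝ)) hx
    obtain ⟨-, h2⟩ := huniq _ _ _ _ h1
    have h3 : i b = 0 := by
      have := congrArg i h2
      rw [map_neg] at this; linarith
    exact ⟨a, Subtype.ext (by show i a = i a + i b * r; rw [h3]; ring)⟩
  · have : (⟨r, hr⟩ : E) = ⟨i 0 + i 1 * r, hmem 0 1⟩ := Subtype.ext (by simp)
    rw [hse, this, hs0]; apply Subtype.ext; simp
  · intro h
    have h1 : r = 0 := congrArg (fun z : E => (z : ℝ)) h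
    apply hn 0; rw [map_zero, h1]

lemma mkq (S : Set ℝ) (E : IntermediateField ℚ ℝ) (r : ℝ) (hE : E = Qadj (insert r S)) (hr2 : r ^ 2 ∈ Qadj S) (hn : r ∉ Qadj S) :
    ∃ q : QE (Qadj S) E, (∀ y, ((q.f y : E) : ℝ) = y) ∧ ((q.r : E) : ℝ) = r := by
  subst hE
  refine mkQE (algebraMap (Qadj S) ℝ) _ ?_ r (sub_adj (Set.mem_insert _ _)) ⟨r ^ 2, hr2⟩ rfl ?_ ?_
  · intro y
    exact Qadj_mono (fun x hx => sub_adj (Set.mem_insert_of_mem _ hx)) y.2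
  · intro y h; apply hn; rw [← h]; exact y.2
  · intro x hx
    obtain ⟨a, ha, b, hb, h⟩ := adj_rep S r hr2 x hx
    exact ⟨⟨a, ha⟩, ⟨b, hb⟩, h⟩

lemma mkq0 (r : ℝ) (c : ℚ) (hr2 : r ^ 2 = c) (hn : r ∉ Qadj ∅) :
    ∃ q : QE ℚ (Qadj {r}), ((q.r : Qadj {r}) : ℝ) = r := by
  obtain ⟨q, -, h⟩ := mkQE (algebraMap ℚ ℝ) (Qadj {r}) (fun y => (Qadj {r}).algebraMap_mem y) r (sub_adj rfl) c hr2
    (fun y h => hn ((mem_empty _).2 ⟨y, h⟩)) (by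
      intro x hx
      obtain ⟨a, ha, b, hb, h⟩ := adj_rep ∅ r ((mem_empty _).2 ⟨c, hr2.symm⟩) x (by rwa [insert_empty_eq])
      obtain ⟨a, rfl⟩ := (mem_empty _).1 ha
      obtain ⟨b, rfl⟩ := (mem_empty _).1 hb
      exact ⟨a, b, h⟩)
  exact ⟨q, h⟩

lemma nf (S : Set ℝ) (hf : S.Finite) (h : ∀ x ∈ S, IsIntegral ℤ x) : NumberField (Qadj S) := by
  haveI : Finite S := hf
  haveI : FiniteDimensional ℚ (Qadj S) := IntermediateField.finiteDimensional_adjoin (fun x hx => (h x hx).tower_top)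
  exact { to_charZero := inferInstance, to_finiteDimensional := inferInstance }

lemma tr_ext {F L : Type*} [Field F] [NumberField F] [Field L] [NumberField L] (q : QE F L) [hF : IsTotallyReal F] (c : F)
    (hr : q.r ^ 2 = q.f c) (hc : ∀ φ : F →+* ℂ, ∃ x : ℝ, 0 ≤ x ∧ φ c = x) : IsTotallyReal L := by
  refine ⟨fun v => ?_⟩
  rw [InfinitePlace.isReal_iff]
  generalize v.embedding = ψ
  have h1 : ComplexEmbedding.IsReal (ψ.comp q.f) := IsTotallyReal.complexEmbedding_isReal _
  have h1' : ∀ a, star (ψ (q.f a)) = ψ (q.f a) := fun a => by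
    have := congrArg (fun g : F →+* ℂ => g a) h1
    exact this
  have h2 : star (ψ q.r) = ψ q.r := by
    obtain ⟨x, hx0, hx⟩ := hc (ψ.comp q.f)
    have h3 : (ψ q.r) ^ 2 = ((Real.sqrt x : ℝ) : ℂ) ^ 2 := by
      rw [← map_pow, hr, ← Complex.ofReal_pow, Real.sq_sqrt hx0]; exact hx
    rcases sq_eq_sq_iff_eq_or_eq_neg.1 h3 with h | h
    · rw [h]; exact Complex.conj_ofReal _
    · rw [h, star_neg]; congr 1; exact Complex.conj_ofReal _
  apply RingHom.ext
  intro x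
  obtain ⟨a, b, rfl⟩ := q.decomp x
  show star (ψ _) = ψ _
  rw [map_add, map_mul, star_add, star_mul', h1', h1', h2]

lemma tr_nat {F L : Type*} [Field F] [NumberField F] [Field L] [NumberField L] (q : QE F L) [hF : IsTotallyReal F] (n : ℕ)
    (hr : q.r ^ 2 = n) : IsTotallyReal L :=
  tr_ext q (n : F) (by rw [hr, map_natCast]) (fun φ => ⟨n, by positivity, by simp⟩)

lemma irr (n : ℕ) (hn : Squarefree n) (h1 : n ≠ 1) : Real.sqrt n ∉ Qadj ∅ := by
  rw [mem_empty]
  have : Irrational (Real.sqrt n) := by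
    rw [irrational_sqrt_natCast_iff]
    rintro ⟨m, hm⟩
    have := hn m ⟨1, by rw [hm, mul_one]⟩
    rw [Nat.isUnit_iff] at this
    subst this; omega
  rintro ⟨c, hc⟩
  exact this ⟨c, hc⟩

lemma h2_one (K : IntermediateField ℚ ℝ) (h : Nat.card (ClassGroup (𝓞 K)) ≠ 0) : h2pow K = 1 ↔ Odd (Nat.card (ClassGroup (𝓞 K))) := by
  unfold h2pow
  rw [← Nat.not_even_iff_odd, even_iff_two_dvd, Nat.pow_eq_one, Nat.prime_two.dvd_iff_one_le_factorization h]
  omega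

lemma h2_four (K : IntermediateField ℚ ℝ) (h : Nat.card (ClassGroup (𝓞 K)) ≠ 0) :
    h2pow K = 4 ↔ 4 ∣ Nat.card (ClassGroup (𝓞 K)) ∧ ¬ 8 ∣ Nat.card (ClassGroup (𝓞 K)) := by
  unfold h2pow
  rw [show 4 = 2 ^ 2 by rfl, show 8 = 2 ^ 3 by rfl, Nat.prime_two.pow_dvd_iff_le_factorization h,
    Nat.prime_two.pow_dvd_iff_le_factorization h]
  constructor
  · intro h
    have := Nat.pow_right_injective le_rfl h
    omega
  · intro h
    congr 1; omega
end Q2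
end

section
open NumberField nonZeroDivisors
namespace Q2
set_option linter.all false

/-- real value of an algebraic integer -/
noncomputable def vl (E : IntermediateField ℚ ℝ) : 𝓞 E →+* ℝ := (algebraMap E ℝ).comp (algebraMap (𝓞 E) E)

lemma vl_inj {E : IntermediateField ℚ ℝ} {x y : 𝓞 E} (h : vl E x = vl E y) : x = y :=
  RingOfIntegers.ext (Subtype.ext h)

lemma vl_mk (E : IntermediateField ℚ ℝ) (x : ℝ) (hx : x ∈ E) (hi : IsIntegral ℤ x) : ∃ z : 𝓞 E, vl E z = x := by
  have : IsIntegral ℤ (⟨x, hx⟩ : E) := by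
    have := isIntegral_algHom_iff ((algebraMap E ℝ).toIntAlgHom) (x := (⟨x, hx⟩ : E)) (algebraMap E ℝ).injective
    exact this.1 hi
  exact ⟨⟨⟨x, hx⟩, this⟩, rfl⟩

lemma int_sq (x : ℝ) (y : ℝ) (h : x ^ 2 = y) (hy : IsIntegral ℤ y) : IsIntegral ℤ x := by
  apply IsIntegral.of_pow (n := 2) (by norm_num); rw [h]; exact hy

lemma int_sqrt (n : ℕ) : IsIntegral ℤ (Real.sqrt n) :=
  int_sq _ n (Real.sq_sqrt (by positivity)) (isIntegral_algebraMap (R := ℤ) (A := ℝ) (x := (n : ℤ)) |> fun h => by simpa using h)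

lemma nscale (E : IntermediateField ℚ ℝ) (n : ℕ) (hn : n ≠ 0) (y : ℝ) (hy : y ∉ E) : (n : ℝ) * y ∉ E := by
  intro h
  apply hy
  have h0 : (n : ℝ) ≠ 0 := by exact_mod_cast hn
  rw [show y = (n : ℝ)⁻¹ * (n * y) by field_simp]
  exact mul_mem (inv_mem (natCast_mem E n)) h

lemma nmem (S : Set ℝ) (r x : ℝ) (hr : r ^ 2 ∈ Qadj S) (hx2 : x ^ 2 ∈ Qadj S) (hrn : r ∉ Qadj S)
    (h1 : x ∉ Qadj S) (h2 : x * r ∉ Qadj S) : x ∉ Qadj (insert r S) := fun h =>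
  (nonsq S r x hr hx2 hrn h).elim h1 h2

lemma sqm (E : IntermediateField ℚ ℝ) (n : ℕ) : (Real.sqrt n) ^ 2 ∈ E := by
  rw [Real.sq_sqrt (by positivity)]; exact natCast_mem E n

lemma sqm' (n : ℕ) : (Real.sqrt n) ^ 2 = (n : ℝ) := Real.sq_sqrt (by positivity)

/-- ground data -/
structure Dat (p d : ℕ) : Prop where
  hp : p.Prime
  hd : d.Prime
  hpd : p ≠ d
  hp4 : p % 4 = 1
  hd4 : d % 4 = 1

/-- the fields -/
noncomputable abbrev fk0 : IntermediateField ℚ ℝ := Qadj {Real.sqrt 2}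
/-- the fields -/
noncomputable abbrev fk1 (p d : ℕ) : IntermediateField ℚ ℝ := Qadj {Real.sqrt (p * d)}
/-- the fields -/
noncomputable abbrev fk2 (p d : ℕ) : IntermediateField ℚ ℝ := Qadj {Real.sqrt (2 * p * d)}
/-- the fields -/
noncomputable abbrev fK (p d : ℕ) : IntermediateField ℚ ℝ := Qadj {Real.sqrt (p * d), Real.sqrt 2}
/-- the fields -/
noncomputable abbrev fL (p d : ℕ) : IntermediateField ℚ ℝ := Qadj {Real.sqrt p, Real.sqrt d, Real.sqrt 2}
/-- the fields -/
noncomputable abbrev fB (p : ℕ) : IntermediateField ℚ ℝ := Qadj {Real.sqrt p}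
/-- the fields -/
noncomputable abbrev fF (p d : ℕ) : IntermediateField ℚ ℝ := Qadj {Real.sqrt p, Real.sqrt d}

instance nf0 : NumberField fk0 := nf _ (by simp) (by rintro x rfl; exact_mod_cast int_sqrt 2)
instance nf1 (p d : ℕ) : NumberField (fk1 p d) := nf _ (by simp) (by rintro x rfl; exact_mod_cast int_sqrt (p * d))
instance nf2 (p d : ℕ) : NumberField (fk2 p d) := nf _ (by simp) (by rintro x rfl; exact_mod_cast int_sqrt (2 * p * d))
instance nfK (p d : ℕ) : NumberField (fK p d) := nf _ (by simp) (by
  rintro x (rfl | rfl)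
  · exact_mod_cast int_sqrt (p * d)
  · exact_mod_cast int_sqrt 2)
instance nfL (p d : ℕ) : NumberField (fL p d) := nf _ (by simp) (by
  rintro x (rfl | rfl | rfl)
  · exact int_sqrt p
  · exact int_sqrt d
  · exact_mod_cast int_sqrt 2)
instance nfB (p : ℕ) : NumberField (fB p) := nf _ (by simp) (by rintro x rfl; exact int_sqrt p)
instance nfF (p d : ℕ) : NumberField (fF p d) := nf _ (by simp) (by
  rintro x (rfl | rfl)
  · exact int_sqrt p
  · exact int_sqrt d)

lemma r_pd (p d : ℕ) : Real.sqrt (p * d) = Real.sqrt p * Real.sqrt d := Real.sqrt_mul (by positivity) _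
lemma r_2pd (p d : ℕ) : Real.sqrt (2 * p * d) = Real.sqrt 2 * (Real.sqrt p * Real.sqrt d) := by
  rw [mul_assoc, Real.sqrt_mul (by positivity), r_pd]
lemma c_pd (p d : ℕ) : Real.sqrt ((p * d : ℕ) : ℝ) = Real.sqrt p * Real.sqrt d := by push_cast; exact r_pd p d
lemma c_2p (p : ℕ) : Real.sqrt ((2 * p : ℕ) : ℝ) = Real.sqrt 2 * Real.sqrt p := by push_cast; exact Real.sqrt_mul (by positivity) _
lemma c_2pd (p d : ℕ) : Real.sqrt ((2 * p * d : ℕ) : ℝ) = Real.sqrt 2 * (Real.sqrt p * Real.sqrt d) := by push_cast; exact r_2pd p d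
lemma s2 : Real.sqrt 2 ^ 2 = 2 := Real.sq_sqrt (by norm_num)
lemma s2m : Real.sqrt 2 * Real.sqrt 2 = 2 := Real.mul_self_sqrt (by norm_num)
lemma snm (n : ℕ) : Real.sqrt n * Real.sqrt n = n := Real.mul_self_sqrt (by positivity)

namespace Dat
variable {p d : ℕ}

lemma symm (D : Dat p d) : Dat d p := ⟨D.hd, D.hp, D.hpd.symm, D.hd4, D.hp4⟩

lemma sq_pd (D : Dat p d) : Squarefree (p * d) := (Nat.squarefree_mul ((Nat.coprime_primes D.hp D.hd).2 D.hpd)).2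
  ⟨D.hp.prime.squarefree, D.hd.prime.squarefree⟩
lemma p2 (D : Dat p d) : 2 ≠ p := by have := D.hp4; rintro rfl; omega
lemma sq_2p (D : Dat p d) : Squarefree (2 * p) := (Nat.squarefree_mul ((Nat.coprime_primes Nat.prime_two D.hp).2 D.p2)).2
  ⟨Nat.prime_two.prime.squarefree, D.hp.prime.squarefree⟩
lemma sq_2pd (D : Dat p d) : Squarefree (2 * p * d) := by
  rw [mul_assoc]
  refine (Nat.squarefree_mul ?_).2 ⟨Nat.prime_two.prime.squarefree, D.sq_pd⟩
  exact ((Nat.coprime_primes Nat.prime_two D.hp).2 D.p2).mul_right ((Nat.coprime_primes Nat.prime_two D.hd).2 D.symm.p2)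

lemma i2 : Real.sqrt 2 ∉ Qadj ∅ := by
  have := irr 2 Nat.prime_two.prime.squarefree (by norm_num)
  exact_mod_cast this
lemma ip (D : Dat p d) : Real.sqrt p ∉ Qadj ∅ := irr p D.hp.prime.squarefree D.hp.ne_one
lemma ipd (D : Dat p d) : Real.sqrt p * Real.sqrt d ∉ Qadj ∅ := by
  rw [← c_pd]; refine irr _ D.sq_pd (fun h => D.hp.ne_one (Nat.eq_one_of_mul_eq_one_right h))
lemma i2p (D : Dat p d) : Real.sqrt 2 * Real.sqrt p ∉ Qadj ∅ := by
  rw [← c_2p]; refine irr _ D.sq_2p (fun h => by omega)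
lemma i2pd (D : Dat p d) : Real.sqrt 2 * (Real.sqrt p * Real.sqrt d) ∉ Qadj ∅ := by
  rw [← c_2pd]; refine irr _ D.sq_2pd (fun h => by rw [mul_assoc] at h; omega)

lemma two_mem (E : IntermediateField ℚ ℝ) : (Real.sqrt 2) ^ 2 ∈ E := by rw [s2]; exact ofNat_mem E 2
lemma pd_sq (p d : ℕ) : (Real.sqrt p * Real.sqrt d) ^ 2 = ((p * d : ℕ) : ℝ) := by
  rw [mul_pow, sqm', sqm']; push_cast; rfl
lemma pd_mem (E : IntermediateField ℚ ℝ) : (Real.sqrt p * Real.sqrt d) ^ 2 ∈ E := by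
  rw [pd_sq]; exact natCast_mem E _
lemma t2pd_mem (E : IntermediateField ℚ ℝ) : (Real.sqrt 2 * (Real.sqrt p * Real.sqrt d)) ^ 2 ∈ E := by
  rw [mul_pow]; exact mul_mem (two_mem E) (pd_mem E)

lemma n1 {r x : ℝ} (hr : r ^ 2 ∈ Qadj ∅) (hx2 : x ^ 2 ∈ Qadj ∅) (hrn : r ∉ Qadj ∅)
    (h1 : x ∉ Qadj ∅) (h2 : x * r ∉ Qadj ∅) : x ∉ Qadj {r} := by
  have := nmem ∅ r x hr hx2 hrn h1 h2
  rwa [insert_empty_eq] at this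

lemma pd_k0 (D : Dat p d) : Real.sqrt p * Real.sqrt d ∉ fk0 := by
  apply n1 (two_mem _) (pd_mem _) i2 D.ipd; rw [mul_comm]; exact D.i2pd
lemma p_k0 (D : Dat p d) : Real.sqrt p ∉ fk0 := by
  apply n1 (two_mem _) (sqm _ p) i2 D.ip; rw [mul_comm]; exact D.i2p
lemma two_k1 (D : Dat p d) : Real.sqrt 2 ∉ fk1 p d := by
  unfold fk1; rw [r_pd]
  exact n1 (pd_mem _) (two_mem _) D.ipd i2 D.i2pd
lemma two_k2 (D : Dat p d) : Real.sqrt 2 ∉ fk2 p d := by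
  unfold fk2; rw [r_2pd]
  apply n1 (t2pd_mem _) (two_mem _) D.i2pd i2
  rw [← mul_assoc, s2m]
  exact_mod_cast nscale _ 2 (by norm_num) _ D.ipd
lemma p_k1 (D : Dat p d) : Real.sqrt p ∉ fk1 p d := by
  unfold fk1; rw [r_pd]
  apply n1 (pd_mem _) (sqm _ p) D.ipd D.ip
  rw [← mul_assoc, snm]
  exact nscale _ p D.hp.ne_zero _ D.symm.ip
lemma p_K (D : Dat p d) : Real.sqrt p ∉ fK p d := by
  unfold fK; rw [r_pd]
  apply nmem _ _ _ (pd_mem _) (sqm _ p) D.pd_k0 D.p_k0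
  rw [← mul_assoc, snm]
  exact nscale _ p D.hp.ne_zero _ D.symm.p_k0
lemma d_B (D : Dat p d) : Real.sqrt d ∉ fB p := by
  apply n1 (sqm _ p) (sqm _ d) D.ip D.symm.ip
  rw [mul_comm]; exact D.ipd
lemma d_k02 (D : Dat p d) : Real.sqrt d ∉ fk0 := D.symm.p_k0
lemma p_Ld (D : Dat p d) : Real.sqrt p ∉ Qadj {Real.sqrt d, Real.sqrt 2} := by
  apply nmem _ _ _ (sqm _ d) (sqm _ p) D.symm.p_k0 D.p_k0 D.pd_k0

end Dat
end Q2
end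

section
open NumberField nonZeroDivisors
namespace Q2
set_option linter.all false

lemma vl_of {E E' : IntermediateField ℚ ℝ} [NumberField E] [NumberField E'] (q : QE E E') (hq : ∀ y, ((q.f y : E') : ℝ) = y) (z : 𝓞 E) :
    vl E' (q.of z) = vl E z := hq z

lemma vl_os_neg {F : Type*} [Field F] [NumberField F] {E : IntermediateField ℚ ℝ} [NumberField E] (q : QE F E) (z : 𝓞 E) (r : ℝ) (hz : vl E z = r) (hr : ((q.r : E) : ℝ) = r) :
    q.os z = -z := by
  apply q.os_r
  apply Subtype.ext
  rw [hr, ← hz]; rfl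

lemma tr_q {F : Type*} [Field F] [NumberField F] [IsTotallyReal F] {E : IntermediateField ℚ ℝ} [NumberField E] (q : QE F E) (r : ℝ) (n : ℕ)
    (hr : ((q.r : E) : ℝ) = r) (hn : r ^ 2 = n) : IsTotallyReal E := by
  apply tr_nat q n
  apply Subtype.ext
  show ((q.r : E) : ℝ) ^ 2 = ((n : E) : ℝ)
  rw [hr, hn]; rfl

namespace Dat
variable {p d : ℕ}

lemma pd_ss (p d : ℕ) : Real.sqrt (p * d) ^ 2 = (p * d : ℝ) := Real.sq_sqrt (by positivity)
lemma t2pd_ss (p d : ℕ) : Real.sqrt (2 * p * d) ^ 2 = (2 * p * d : ℝ) := Real.sq_sqrt (by positivity)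

lemma exQ0 : ∃ q : QE ℚ fk0, ((q.r : fk0) : ℝ) = Real.sqrt 2 :=
  mkq0 _ 2 (by rw [s2]; norm_num) i2
lemma exQ1 (D : Dat p d) : ∃ q : QE ℚ (fk1 p d), ((q.r : fk1 p d) : ℝ) = Real.sqrt (p * d) :=
  mkq0 _ (p * d) (by rw [pd_ss]; push_cast; rfl) (by rw [r_pd]; exact D.ipd)
lemma exQ2 (D : Dat p d) : ∃ q : QE ℚ (fk2 p d), ((q.r : fk2 p d) : ℝ) = Real.sqrt (2 * p * d) :=
  mkq0 _ (2 * p * d) (by rw [t2pd_ss]; push_cast; rfl) (by rw [r_2pd]; exact D.i2pd)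
lemma exQB (D : Dat p d) : ∃ q : QE ℚ (fB p), ((q.r : fB p) : ℝ) = Real.sqrt p :=
  mkq0 _ p (by rw [sqm']; push_cast; rfl) D.ip

lemma exq0 (D : Dat p d) : ∃ q : QE fk0 (fK p d), (∀ y, ((q.f y : fK p d) : ℝ) = y) ∧ ((q.r : fK p d) : ℝ) = Real.sqrt (p * d) :=
  mkq _ _ _ rfl (by rw [r_pd]; exact pd_mem _) (by rw [r_pd]; exact D.pd_k0)
lemma exq1 (D : Dat p d) : ∃ q : QE (fk1 p d) (fK p d), (∀ y, ((q.f y : fK p d) : ℝ) = y) ∧ ((q.r : fK p d) : ℝ) = Real.sqrt 2 :=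
  mkq _ _ _ (by unfold fK; rw [Set.pair_comm]) (two_mem _) D.two_k1
lemma exq2 (D : Dat p d) : ∃ q : QE (fk2 p d) (fK p d), (∀ y, ((q.f y : fK p d) : ℝ) = y) ∧ ((q.r : fK p d) : ℝ) = Real.sqrt 2 := by
  refine mkq _ _ _ ?_ (two_mem _) D.two_k2
  have e : Real.sqrt (2 * p * d) = Real.sqrt 2 * Real.sqrt (p * d) := by rw [r_2pd, r_pd]
  apply le_antisymm
  · apply Qadj_mono
    rintro x (rfl | rfl)
    · rw [show Real.sqrt (p * d) = (2 : ℝ)⁻¹ * (Real.sqrt 2 * Real.sqrt (2 * p * d)) by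
        rw [e, ← mul_assoc (Real.sqrt 2), s2m]; ring]
      exact mul_mem (inv_mem (ofNat_mem _ 2)) (mul_mem (sub_adj (by simp)) (sub_adj (by simp)))
    · exact sub_adj (by simp)
  · apply Qadj_mono
    rintro x (rfl | rfl)
    · exact sub_adj (by simp)
    · rw [e]; exact mul_mem (sub_adj (by simp)) (sub_adj (by simp))

lemma pd_of (D : Dat p d) (E : IntermediateField ℚ ℝ) (hp : Real.sqrt p ∈ E) (h : Real.sqrt (p * d) ∈ E) : Real.sqrt d ∈ E := by
  have h0 : (p : ℝ) ≠ 0 := by exact_mod_cast D.hp.ne_zero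
  rw [show Real.sqrt d = (p : ℝ)⁻¹ * (Real.sqrt p * Real.sqrt (p * d)) by
        rw [r_pd, ← mul_assoc (Real.sqrt p), snm]; field_simp]
  exact mul_mem (inv_mem (natCast_mem _ p)) (mul_mem hp h)

lemma exqL (D : Dat p d) : ∃ q : QE (fK p d) (fL p d), (∀ y, ((q.f y : fL p d) : ℝ) = y) ∧ ((q.r : fL p d) : ℝ) = Real.sqrt p := by
  refine mkq _ _ _ ?_ (sqm _ p) D.p_K
  apply le_antisymm
  · apply Qadj_mono
    rintro x (rfl | rfl | rfl)
    · exact sub_adj (by simp)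
    · exact D.pd_of _ (sub_adj (by simp)) (sub_adj (by simp))
    · exact sub_adj (by simp)
  · apply Qadj_mono
    rintro x (rfl | rfl | rfl)
    · exact sub_adj (by simp)
    · rw [r_pd]; exact mul_mem (sub_adj (by simp)) (sub_adj (by simp))
    · exact sub_adj (by simp)

lemma exq1F (D : Dat p d) : ∃ q : QE (fk1 p d) (fF p d), (∀ y, ((q.f y : fF p d) : ℝ) = y) ∧ ((q.r : fF p d) : ℝ) = Real.sqrt p := by
  refine mkq _ _ _ ?_ (sqm _ p) D.p_k1
  apply le_antisymm
  · apply Qadj_mono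
    rintro x (rfl | rfl)
    · exact sub_adj (by simp)
    · exact D.pd_of _ (sub_adj (by simp)) (sub_adj (by simp))
  · apply Qadj_mono
    rintro x (rfl | rfl)
    · exact sub_adj (by simp)
    · rw [r_pd]; exact mul_mem (sub_adj (by simp)) (sub_adj (by simp))

lemma exqBF (D : Dat p d) : ∃ q : QE (fB p) (fF p d), (∀ y, ((q.f y : fF p d) : ℝ) = y) ∧ ((q.r : fF p d) : ℝ) = Real.sqrt d :=
  mkq _ _ _ (by unfold fF; rw [Set.pair_comm]) (sqm _ d) D.d_B

lemma exBQ (D : Dat p d) : ∃ S : BQ fk0 (fk1 p d) (fk2 p d) (fK p d) p d,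
    (∀ y, ((S.q0.f y : fK p d) : ℝ) = y) ∧ (∀ y, ((S.q1.f y : fK p d) : ℝ) = y) ∧ (∀ y, ((S.q2.f y : fK p d) : ℝ) = y) := by
  obtain ⟨Q0, hQ0⟩ := exQ0
  obtain ⟨Q1, hQ1⟩ := D.exQ1
  obtain ⟨Q2, hQ2⟩ := D.exQ2
  obtain ⟨q0, hq0, hr0⟩ := D.exq0
  obtain ⟨q1, hq1, hr1⟩ := D.exq1
  obtain ⟨q2, hq2, hr2⟩ := D.exq2
  obtain ⟨z0, hz0⟩ := vl_mk fk0 (Real.sqrt 2) (sub_adj rfl) (by exact_mod_cast int_sqrt 2)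
  obtain ⟨z1, hz1⟩ := vl_mk (fk1 p d) (Real.sqrt (p * d)) (sub_adj rfl) (by exact_mod_cast int_sqrt (p * d))
  obtain ⟨z2, hz2⟩ := vl_mk (fk2 p d) (Real.sqrt (2 * p * d)) (sub_adj rfl) (by exact_mod_cast int_sqrt (2 * p * d))
  refine ⟨{ Q0 := Q0, Q1 := Q1, Q2 := Q2, q0 := q0, q1 := q1, q2 := q2, r0 := z0, r1 := z1, r2 := z2,
            hr0 := Subtype.ext (hz0.trans hQ0.symm), hr1 := Subtype.ext (hz1.trans hQ1.symm), hr2 := Subtype.ext (hz2.trans hQ2.symm),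
            s0 := ?_, s1 := ?_, s2 := ?_, m := ?_, e0 := ?_, e1 := ?_, e2 := ?_ }, hq0, hq1, hq2⟩
  · apply vl_inj; rw [map_pow, hz0, s2, map_ofNat]
  · apply vl_inj; rw [map_pow, hz1, pd_ss, map_mul, map_natCast, map_natCast]
  · apply vl_inj; rw [map_pow, hz2, t2pd_ss, map_mul, map_mul, map_natCast, map_natCast, map_ofNat]
  · apply vl_inj; rw [map_mul, vl_of q2 hq2, vl_of q0 hq0, vl_of q1 hq1, hz0, hz1, hz2, r_2pd, r_pd]
  · exact Subtype.ext (hr0.trans (hz1.symm.trans (vl_of q1 hq1 z1).symm))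
  · exact Subtype.ext (hr1.trans (hz0.symm.trans (vl_of q0 hq0 z0).symm))
  · exact Subtype.ext (hr2.trans (hz0.symm.trans (vl_of q0 hq0 z0).symm))

lemma tr0 : IsTotallyReal fk0 := by
  obtain ⟨q, h⟩ := exQ0
  exact tr_q q _ 2 h (by rw [s2]; norm_num)
lemma tr1 (D : Dat p d) : IsTotallyReal (fk1 p d) := by
  obtain ⟨q, h⟩ := D.exQ1
  exact tr_q q _ (p * d) h (by rw [pd_ss]; push_cast; rfl)
lemma tr2 (D : Dat p d) : IsTotallyReal (fk2 p d) := by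
  obtain ⟨q, h⟩ := D.exQ2
  exact tr_q q _ (2 * p * d) h (by rw [t2pd_ss]; push_cast; rfl)
lemma trB (D : Dat p d) : IsTotallyReal (fB p) := by
  obtain ⟨q, h⟩ := D.exQB
  exact tr_q q _ p h (sqm' p)
lemma trK (D : Dat p d) : IsTotallyReal (fK p d) := by
  obtain ⟨q, -, h⟩ := D.exq1
  haveI := D.tr1
  exact tr_q q _ 2 h (by rw [s2]; norm_num)
lemma trL (D : Dat p d) : IsTotallyReal (fL p d) := by
  obtain ⟨q, -, h⟩ := D.exqL
  haveI := D.trK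
  exact tr_q q _ p h (sqm' p)
lemma trF (D : Dat p d) : IsTotallyReal (fF p d) := by
  obtain ⟨q, -, h⟩ := D.exqBF
  haveI := D.trB
  exact tr_q q _ d h (sqm' d)

/-- roots with sign behaviour -/
lemma roots (D : Dat p d) {E E' : IntermediateField ℚ ℝ} [NumberField E] [NumberField E'] (q : QE E E')
    (hq : ∀ y, ((q.f y : E') : ℝ) = y) (hr : ((q.r : E') : ℝ) = Real.sqrt p) (hpd : Real.sqrt (p * d) ∈ E)
    (hp : Real.sqrt p ∈ E') (hd : Real.sqrt d ∈ E') :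
    ∃ x y : 𝓞 E', x ^ 2 = (p : 𝓞 E') ∧ y ^ 2 = (d : 𝓞 E') ∧ q.os x = -x ∧ q.os y = -y := by
  obtain ⟨x, hx⟩ := vl_mk E' _ hp (int_sqrt p)
  obtain ⟨y, hy⟩ := vl_mk E' _ hd (int_sqrt d)
  obtain ⟨z, hz⟩ := vl_mk E _ hpd (by exact_mod_cast int_sqrt (p * d))
  have hx2 : x ^ 2 = (p : 𝓞 E') := by apply vl_inj; rw [map_pow, hx, sqm', map_natCast]
  have hy2 : y ^ 2 = (d : 𝓞 E') := by apply vl_inj; rw [map_pow, hy, sqm', map_natCast]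
  have hsx := vl_os_neg q x _ hx hr
  have hxy : x * y = q.of z := by apply vl_inj; rw [map_mul, vl_of q hq, hx, hy, hz, r_pd]
  have hx0 : x ≠ 0 := by
    rintro rfl
    have : ((p : ℕ) : 𝓞 E') = 0 := by rw [← hx2]; ring
    exact D.hp.ne_zero (by exact_mod_cast this)
  refine ⟨x, y, hx2, hy2, hsx, ?_⟩
  have h1 : q.os (x * y) = x * y := by rw [hxy, q.os_of]
  rw [map_mul, hsx] at h1
  apply mul_left_cancel₀ hx0
  linear_combination -h1
end Dat
end Q2
end

section
open NumberField nonZeroDivisors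
namespace Q2
set_option linter.all false

lemma core_ns (r s : ℤ) (D m : ℕ) (hD : Real.sqrt D ∉ Qadj ∅) (hm : m ≠ 0) (h : r ^ 2 - 2 * s ^ 2 = D) (z : ℝ) (hz : z ∈ fk0)
    (hz2 : z ^ 2 = m * (r + s * Real.sqrt 2)) : False := by
  obtain ⟨a, ha, b, hb, rfl⟩ := adj_rep ∅ (Real.sqrt 2) (Dat.two_mem _) z (by rwa [insert_empty_eq])
  obtain ⟨a, rfl⟩ := (mem_empty _).1 ha
  obtain ⟨b, rfl⟩ := (mem_empty _).1 hb
  have h1 : (2 * a * b - m * s : ℝ) * Real.sqrt 2 = m * r - a ^ 2 - 2 * b ^ 2 := by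
    linear_combination hz2 - (b : ℝ) ^ 2 * s2
  have h2 : (2 * a * b - m * s : ℝ) = 0 := by
    by_contra h0
    apply Dat.i2
    rw [mem_empty]
    refine ⟨(m * r - a ^ 2 - 2 * b ^ 2) / (2 * a * b - m * s), ?_⟩
    push_cast
    rw [div_eq_iff h0, ← h1]; ring
  rw [h2, zero_mul] at h1
  have hm0 : (m : ℝ) ≠ 0 := by exact_mod_cast hm
  have h' : (r : ℝ) ^ 2 - 2 * s ^ 2 = D := by exact_mod_cast h
  have h3 : (((a : ℝ) ^ 2 - 2 * b ^ 2) / m) ^ 2 = D := by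
    rw [div_pow, div_eq_iff (pow_ne_zero 2 hm0), ← h']
    linear_combination ((m * r : ℝ) + a ^ 2 + 2 * b ^ 2) * h1 - (2 * a * b + m * s : ℝ) * 2 * h2
  apply hD
  rw [← h3, Real.sqrt_sq_eq_abs, mem_empty]
  exact ⟨|(a ^ 2 - 2 * b ^ 2) / m|, by push_cast; rfl⟩

namespace Dat
variable {p d : ℕ}

lemma exw (p d : ℕ) : ∃ w : 𝓞 (fL p d), vl _ w = Real.sqrt 2 :=
  vl_mk _ _ (sub_adj (by simp)) (by exact_mod_cast int_sqrt 2)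

lemma caseA_contra (H : Dat p d) (h : CaseA p d) : 2 ∣ Nat.card (ClassGroup (𝓞 (fL p d))) := by
  obtain ⟨D, r, s, hD, hrs, hr0, hs2, h1⟩ := h
  have hDi : Real.sqrt D ∉ Qadj ∅ := by
    rcases hD with rfl | rfl | rfl
    · exact H.ip
    · exact H.symm.ip
    · rw [c_pd]; exact H.ipd
  have hDL : Real.sqrt D ∈ fL p d := by
    rcases hD with rfl | rfl | rfl
    · exact sub_adj (by simp)
    · exact sub_adj (by simp)
    · rw [c_pd]; exact mul_mem (sub_adj (by simp)) (sub_adj (by simp))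
  have hDs : Squarefree D := by
    rcases hD with rfl | rfl | rfl
    · exact H.hp.prime.squarefree
    · exact H.hd.prime.squarefree
    · exact H.sq_pd
  have hD0 : 0 < (D : ℝ) := by exact_mod_cast Nat.pos_of_ne_zero hDs.ne_zero
  have hrsR : (r : ℝ) ^ 2 - 2 * s ^ 2 = D := by exact_mod_cast hrs
  have hr0R : (0 : ℝ) < r := by exact_mod_cast hr0
  have hlt : |(s : ℝ) * Real.sqrt 2| < r := by
    apply abs_lt_of_sq_lt_sq _ hr0R.le
    rw [mul_pow, s2]; linarith
  obtain ⟨hl1, hl2⟩ := abs_lt.1 hlt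
  have hpos : 0 < (r : ℝ) + s * Real.sqrt 2 := by linarith
  have hpos' : 0 < (r : ℝ) - s * Real.sqrt 2 := by linarith
  set t : ℝ := Real.sqrt (r + s * Real.sqrt 2) with ht
  set t' : ℝ := Real.sqrt (r - s * Real.sqrt 2) with ht'
  have hts : t ^ 2 = r + s * Real.sqrt 2 := Real.sq_sqrt hpos.le
  have hts' : t' ^ 2 = r - s * Real.sqrt 2 := Real.sq_sqrt hpos'.le
  have htt : t * t' = Real.sqrt D := by
    rw [ht, ht', ← Real.sqrt_mul hpos.le]; congr 1
    linear_combination hrsR - (s : ℝ) ^ 2 * s2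
  have ht0 : t ≠ 0 := (Real.sqrt_pos.2 hpos).ne'
  have hmem : ∀ E : IntermediateField ℚ ℝ, Real.sqrt 2 ∈ E → t ^ 2 ∈ E := fun E hE => by
    rw [hts]; exact add_mem (intCast_mem E r) (mul_mem (intCast_mem E s) hE)
  have hk0 : ∀ m : ℕ, m ≠ 0 → ∀ y : ℝ, y ^ 2 = m → t * y ∉ fk0 := fun m hm y hy hz =>
    core_ns r s D m hDi hm hrs (t * y) hz (by rw [mul_pow, hts, hy]; ring)
  have htL : t ∉ fL p d := by
    have hp2 := sqm' p
    have hd2 := sqm' d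
    apply nmem _ _ _ (sqm _ p) (hmem _ (sub_adj (by simp))) H.p_Ld
    · apply nmem _ _ _ (sqm _ d) (hmem _ (sub_adj (by simp))) H.symm.p_k0
      · rw [← mul_one t]; exact hk0 1 one_ne_zero 1 (by norm_num)
      · exact hk0 d H.hd.ne_zero _ hd2
    · apply nmem _ _ _ (sqm _ d) (by rw [mul_pow]; exact mul_mem (hmem _ (sub_adj (by simp))) (sqm _ p)) H.symm.p_k0
      · exact hk0 p H.hp.ne_zero _ hp2
      · rw [mul_assoc]; exact hk0 (p * d) (mul_ne_zero H.hp.ne_zero H.hd.ne_zero) _ (pd_sq p d)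
  have i2' : IsIntegral ℤ (Real.sqrt 2) := by exact_mod_cast int_sqrt 2
  have iZ : ∀ n : ℤ, IsIntegral ℤ (n : ℝ) := fun n => by simpa using isIntegral_algebraMap (R := ℤ) (A := ℝ) (x := n)
  have it : IsIntegral ℤ t := int_sq _ _ hts ((iZ r).add ((iZ s).mul i2'))
  have it' : IsIntegral ℤ t' := int_sq _ _ hts' ((iZ r).sub ((iZ s).mul i2'))
  haveI nM : NumberField (Qadj (insert t {Real.sqrt p, Real.sqrt d, Real.sqrt 2})) := nf _ (by simp) (by
    rintro x (rfl | rfl | rfl | rfl)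
    · exact it
    · exact int_sqrt p
    · exact int_sqrt d
    · exact i2')
  obtain ⟨q, hq, hqr⟩ := mkq {Real.sqrt p, Real.sqrt d, Real.sqrt 2} _ t rfl (hmem _ (sub_adj (by simp))) htL
  obtain ⟨w, hw⟩ := exw p d
  haveI := H.trL
  have hw2 : w ^ 2 = 2 := by apply vl_inj; rw [map_pow, hw, s2, map_ofNat]
  haveI : IsTotallyReal (Qadj (insert t {Real.sqrt p, Real.sqrt d, Real.sqrt 2})) := by
    refine tr_ext q ((r + s * w : 𝓞 (fL p d)) : fL p d) ?_ ?_
    · apply Subtype.ext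
      rw [hq]
      have e1 : (((q.r ^ 2 : Qadj (insert t {Real.sqrt p, Real.sqrt d, Real.sqrt 2}))) : ℝ) = t ^ 2 :=
        congrArg (fun z : ℝ => z ^ 2) hqr
      rw [e1]
      show t ^ 2 = vl (fL p d) (r + s * w)
      rw [hts, map_add, map_mul, map_intCast, map_intCast, hw]
    · intro φ
      have e : φ ((r + s * w : 𝓞 (fL p d)) : fL p d) = r + s * φ (w : fL p d) := by
        show (φ.comp (algebraMap (𝓞 (fL p d)) (fL p d))) _ = _
        rw [map_add, map_mul, map_intCast, map_intCast]; rfl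
      have e2 : (φ (w : fL p d)) ^ 2 = ((Real.sqrt 2 : ℝ) : ℂ) ^ 2 := by
        rw [← Complex.ofReal_pow, s2]
        show (φ.comp (algebraMap (𝓞 (fL p d)) (fL p d))) w ^ 2 = _
        rw [← map_pow, hw2, map_ofNat]; norm_num
      rcases sq_eq_sq_iff_eq_or_eq_neg.1 e2 with h | h
      · exact ⟨_, hpos.le, by rw [e, h]; push_cast; rfl⟩
      · exact ⟨_, hpos'.le, by rw [e, h]; push_cast; ring⟩
  have htM : t ∈ Qadj (insert t {Real.sqrt p, Real.sqrt d, Real.sqrt 2}) := sub_adj (by simp)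
  have hDM : Real.sqrt D ∈ Qadj (insert t {Real.sqrt p, Real.sqrt d, Real.sqrt 2}) :=
    Qadj_mono (fun x hx => sub_adj (Set.mem_insert_of_mem _ hx)) hDL
  have htM' : t' ∈ Qadj (insert t {Real.sqrt p, Real.sqrt d, Real.sqrt 2}) := by
    rw [show t' = Real.sqrt D * t⁻¹ by rw [← htt]; field_simp]
    exact mul_mem hDM (inv_mem htM)
  obtain ⟨T, hT⟩ := vl_mk _ t htM it
  obtain ⟨T', hT'⟩ := vl_mk _ t' htM' it'
  obtain ⟨z, hz⟩ := vl_mk _ _ hDL (int_sqrt D)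
  have hsT := vl_os_neg q T _ hT hqr
  have hTT : T * T' = q.of z := by apply vl_inj; rw [map_mul, vl_of q hq, hT, hT', hz, htt]
  have hT0 : T ≠ 0 := by rintro rfl; rw [map_zero] at hT; exact ht0 hT.symm
  have hsT' : q.os T' = -T' := by
    have h1 : q.os (T * T') = T * T' := by rw [hTT, q.os_of]
    rw [map_mul, hsT] at h1
    apply mul_left_cancel₀ hT0
    linear_combination -h1
  refine q.caseA w hw2 r s (cop_uv' D hDs r s hrs) hs2 h1 T T' ?_ ?_ hsT hsT'
  · apply vl_inj; rw [map_pow, hT, vl_of q hq, hts, map_add, map_mul, map_intCast, map_intCast, hw]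
  · apply vl_inj; rw [map_pow, hT', vl_of q hq, hts', map_sub, map_mul, map_intCast, map_intCast, hw]

lemma k1facts (H : Dat p d) (hsym : @legendreSym d ⟨H.hd⟩ (p : ℤ) = -1 ∨
      (@legendreSym d ⟨H.hd⟩ (p : ℤ) = 1 ∧ quarticSym d p ≠ quarticSym p d)) :
    2 ∣ Nat.card (ClassGroup (𝓞 (fk1 p d))) ∧ ¬ 4 ∣ Nat.card (ClassGroup (𝓞 (fk1 p d))) := by
  haveI := H.tr1
  haveI := H.trB
  haveI := H.trF
  obtain ⟨q, hqr⟩ := H.exQB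
  obtain ⟨q', hq', hqr'⟩ := H.exqBF
  obtain ⟨ρ, hρ⟩ := vl_mk (fB p) _ (sub_adj rfl) (int_sqrt p)
  obtain ⟨δ, hδ⟩ := vl_mk (fF p d) (Real.sqrt d) (sub_adj (by simp)) (int_sqrt d)
  have hρ2 : ρ ^ 2 = (p : 𝓞 (fB p)) := by apply vl_inj; rw [map_pow, hρ, sqm', map_natCast]
  have hδ2 : δ ^ 2 = (d : 𝓞 (fF p d)) := by apply vl_inj; rw [map_pow, hδ, sqm', map_natCast]
  have hρr : (ρ : fB p) = q.r := Subtype.ext (hρ.trans hqr.symm)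
  have hδr : (δ : fF p d) = q'.r := Subtype.ext (hδ.trans hqr'.symm)
  have hρs := vl_os_neg q ρ _ hρ hqr
  have hδs := vl_os_neg q' δ _ hδ hqr'
  obtain ⟨hB, e, he⟩ := q.QB p H.hp H.hp4 ρ hρ2 hρs
  have hF : Odd (Nat.card (ClassGroup (𝓞 (fF p d)))) := by
    rcases hsym with h | ⟨h, h'⟩
    · exact QE.F_inert q q' p d H.hp H.hd H.hd4 hB ρ hρr hρ2 δ hδ2 hδs h
    · exact QE.F_split q q' p d H.hp H.hd H.hpd H.hp4 H.hd4 hB e he ρ hρr hρ2 hρs δ hδr hδ2 hδs h h'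
  obtain ⟨q1, hq1, hr1⟩ := H.exq1F
  obtain ⟨x, y, hx, hy, hsx, hsy⟩ := H.roots q1 hq1 hr1 (sub_adj rfl) (sub_adj (by simp)) (sub_adj (by simp))
  obtain ⟨S, -⟩ := H.exBQ
  exact q1.two_part (q1.unram_pd p d H.hp H.hd H.hpd H.hp4 H.hd4 x y hx hy hsx hsy) hF
    (S.Q1.Qk1 p d H.hp H.hd H.hp4 H.hd4 S.r1 S.s1 S.Qs1)
end Dat

lemma unit_lift {E E' : IntermediateField ℚ ℝ} [NumberField E] [NumberField E'] (q : QE E E') (hq : ∀ y, ((q.f y : E') : ℝ) = y)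
    (u : (𝓞 E')ˣ) (h : vl E' (u : 𝓞 E') ∈ E) : ∃ v : (𝓞 E)ˣ, (u : 𝓞 E') = q.of v := by
  have key : ∀ u : (𝓞 E')ˣ, vl E' (u : 𝓞 E') ∈ E → ∃ v : 𝓞 E, q.of v = u := fun u h => by
    have hi : IsIntegral ℤ (vl E' (u : 𝓞 E')) := (RingOfIntegers.isIntegral (u : 𝓞 E')).map ((vl E').toIntAlgHom)
    obtain ⟨v, hv⟩ := vl_mk E _ h hi
    exact ⟨v, vl_inj (by rw [vl_of q hq, hv])⟩
  obtain ⟨v, hv⟩ := key u h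
  have h' : vl E' ((u⁻¹ : (𝓞 E')ˣ) : 𝓞 E') ∈ E := by
    have e : vl E' ((u⁻¹ : (𝓞 E')ˣ) : 𝓞 E') = (vl E' (u : 𝓞 E'))⁻¹ := by
      apply eq_inv_of_mul_eq_one_left
      rw [← map_mul, Units.inv_mul, map_one]
    rw [e]; exact inv_mem h
  obtain ⟨v', hv'⟩ := key u⁻¹ h'
  have h1 : v * v' = 1 := by
    apply vl_inj
    rw [← vl_of q hq, map_mul, hv, hv', Units.mul_inv, map_one, map_one]
  exact ⟨Units.mkOfMulEqOne v v' h1, hv.symm⟩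

lemma index_UI {p d : ℕ} (S : BQ fk0 (fk1 p d) (fk2 p d) (fK p d) p d)
    (h0 : ∀ y, ((S.q0.f y : fK p d) : ℝ) = y) (h1 : ∀ y, ((S.q1.f y : fK p d) : ℝ) = y) (h2 : ∀ y, ((S.q2.f y : fK p d) : ℝ) = y) :
    (subfieldUnits (fK p d) {fk0, fk1 p d, fk2 p d}).index = 1 ↔ S.UI := by
  rw [Subgroup.index_eq_one]
  constructor
  · intro h η
    have hη : η ∈ subfieldUnits (fK p d) {fk0, fk1 p d, fk2 p d} := by rw [h]; trivial
    unfold subfieldUnits at hη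
    induction hη using Subgroup.closure_induction with
    | mem u hu =>
      obtain ⟨F, hF, hu⟩ := hu
      rcases hF with rfl | rfl | rfl
      · obtain ⟨v, hv⟩ := unit_lift S.q0 h0 u hu
        exact ⟨v, 1, 1, by rw [hv]; simp⟩
      · obtain ⟨v, hv⟩ := unit_lift S.q1 h1 u hu
        exact ⟨1, v, 1, by rw [hv]; simp⟩
      · obtain ⟨v, hv⟩ := unit_lift S.q2 h2 u hu
        exact ⟨1, 1, v, by rw [hv]; simp⟩
    | one => exact ⟨1, 1, 1, by simp⟩
    | mul x y _ _ hx hy =>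
      obtain ⟨a, b, c, hx⟩ := hx
      obtain ⟨a', b', c', hy⟩ := hy
      refine ⟨a * a', b * b', c * c', ?_⟩
      rw [Units.val_mul, hx, hy, Units.val_mul, Units.val_mul, Units.val_mul, map_mul, map_mul, map_mul]; ring
    | inv x _ hx =>
      obtain ⟨a, b, c, hx⟩ := hx
      refine ⟨a⁻¹, b⁻¹, c⁻¹, ?_⟩
      have e : x = Units.map (S.q0.of : _ →* _) a * Units.map (S.q1.of : _ →* _) b * Units.map (S.q2.of : _ →* _) c := Units.ext hx
      rw [e, mul_inv, mul_inv, ← map_inv, ← map_inv, ← map_inv]; rfl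
  · intro h
    rw [eq_top_iff]
    rintro η -
    obtain ⟨a, b, c, hx⟩ := h η
    have e : η = Units.map (S.q0.of : _ →* _) a * Units.map (S.q1.of : _ →* _) b * Units.map (S.q2.of : _ →* _) c := Units.ext hx
    rw [e]
    refine mul_mem (mul_mem (Subgroup.subset_closure ⟨fk0, by simp, ?_⟩) (Subgroup.subset_closure ⟨fk1 p d, by simp, ?_⟩))
      (Subgroup.subset_closure ⟨fk2 p d, by simp, ?_⟩)
    · show vl (fK p d) (S.q0.of a) ∈ fk0
      rw [vl_of S.q0 h0]; exact ((a : 𝓞 fk0) : fk0).2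
    · show vl (fK p d) (S.q1.of b) ∈ fk1 p d
      rw [vl_of S.q1 h1]; exact ((b : 𝓞 (fk1 p d)) : fk1 p d).2
    · show vl (fK p d) (S.q2.of c) ∈ fk2 p d
      rw [vl_of S.q2 h2]; exact ((c : 𝓞 (fk2 p d)) : fk2 p d).2

theorem main {p d : ℕ} (H : Dat p d) (hsym : @legendreSym d ⟨H.hd⟩ (p : ℤ) = -1 ∨
      (@legendreSym d ⟨H.hd⟩ (p : ℤ) = 1 ∧ quarticSym d p ≠ quarticSym p d)) :
    h2pow (fL p d) = 1 ↔ (h2pow (fk2 p d) = 4 ∧ (subfieldUnits (fK p d) {fk0, fk1 p d, fk2 p d}).index = 1) := by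
  haveI := Dat.tr0
  haveI := H.tr1
  haveI := H.tr2
  haveI := H.trK
  haveI := H.trL
  obtain ⟨S, h0, h1, h2⟩ := H.exBQ
  obtain ⟨qL, hqL, hrL⟩ := H.exqL
  obtain ⟨x, y, hx, hy, hsx, hsy⟩ := H.roots qL hqL hrL (sub_adj (by simp)) (sub_adj (by simp)) (sub_adj (by simp))
  obtain ⟨k12, k14⟩ := H.k1facts hsym
  rw [index_UI S h0 h1 h2, h2_one _ Nat.card_pos.ne', h2_four _ Nat.card_pos.ne']
  constructor
  · intro hL
    rcases S.dich H.hp H.hd H.hpd H.hp4 H.hd4 with h | h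
    · exact absurd (even_iff_two_dvd.2 (H.caseA_contra h)) (Nat.not_even_iff_odd.2 hL)
    · exact S.forward H.hp H.hd H.hpd H.hp4 H.hd4 qL hL h x y hx hy hsx hsy k12
  · rintro ⟨⟨-, h8⟩, hU⟩
    have hK := S.back H.hp4 H.hd4 hU k14 h8
    have ha := qL.amb_unram (qL.unram_pd p d H.hp H.hd H.hpd H.hp4 H.hd4 x y hx hy hsx hsy)
    apply qL.amb_odd
    rw [← Nat.not_even_iff_odd, even_iff_two_dvd]
    intro h
    exact hK ((Nat.mul_dvd_mul_right h 2).trans ha)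
end Q2
end

/-- Let p ≡ 1 (mod 4) and d ≡ 1 (mod 4) be two primes with (p/d) = -1 or
[(p/d) = 1 and (p/d)₄ ≠ (d/p)₄]. Let K₁ = Q(√p, √d, √2) and k₁ = Q(√(pd), √2). Then the
2-class number of K₁ is odd (i.e. = 1) if and only if h₂(2pd) = 4 and q(k₁) = 1, where
q(k₁) is the index in E_{k₁} of the subgroup generated by the units of the quadratic
subfields Q(√2), Q(√(pd)), Q(√(2pd)). -/
theorem stmt5 (p d : ℕ) (hp : p.Prime) (hd : d.Prime) (hpd : p ≠ d)
    (hp4 : p % 4 = 1) (hd4 : d % 4 = 1)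
    (hsym : @legendreSym d ⟨hd⟩ (p : ℤ) = -1 ∨
      (@legendreSym d ⟨hd⟩ (p : ℤ) = 1 ∧ quarticSym d p ≠ quarticSym p d)) :
    h2pow (Qadj {Real.sqrt p, Real.sqrt d, Real.sqrt 2}) = 1 ↔
      (h2pow (Qadj {Real.sqrt (2 * p * d)}) = 4 ∧
        (subfieldUnits (Qadj {Real.sqrt (p * d), Real.sqrt 2})
          {Qadj {Real.sqrt 2}, Qadj {Real.sqrt (p * d)},
            Qadj {Real.sqrt (2 * p * d)}}).index = 1) := by
  exact Q2.main ⟨hp, hd, hpd, hp4, hd4⟩ hsym
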